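/- For every C > 0 there exist ε₀ > 0 and N such that the following holds for all integers n ≥ N. Let k be an integer with |k − 2·log₂ n| ≤ C·log log n, let r be an integer with 1 ≤ r ≤ ε₀·(log log n)/(log log log n), and let j ∈ {1, …, r}. Then P(α_{r+1}(G_{n,1/2}) ≥ kr + j) ≤ P(Z_{k+1,μ_j} ≥ ξ_j) + (log n)^{−1/2}. -/

import Mathlib

open scoped Classical

/-- Probability of an event under the uniform measure on simple graphs on `Fin n`
(equivalently, `G_{n,1/2}`). -/
noncomputable def grPr (n : ℕ) (S : Set (SimpleGraph (Fin n))) : ℝ :=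
  ((PMF.uniformOfFintype (SimpleGraph (Fin n))).toOuterMeasure S).toReal

/-- Number of edges of `G` with both endpoints in `s`. -/
noncomputable def edgesIn {n : ℕ} (G : SimpleGraph (Fin n)) (s : Finset (Fin n)) : ℕ :=
  {e ∈ G.edgeSet | ∀ v ∈ e, v ∈ s}.ncard

/-- `Z_{k,i}(G)`: the number of `k`-element vertex subsets inducing exactly `i` edges. -/
noncomputable def numZ (n k i : ℕ) (G : SimpleGraph (Fin n)) : ℕ :=
  (((Finset.univ : Finset (Fin n)).powersetCard k).filter (fun s => edgesIn G s = i)).card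

/-- `α_r(G)`: the maximum number of vertices in an induced `K_r`-free subgraph of `G`. -/
noncomputable def alphaClq (n r : ℕ) (G : SimpleGraph (Fin n)) : ℕ :=
  sSup {m | ∃ s : Finset (Fin n), s.card = m ∧ (G.induce (s : Set (Fin n))).CliqueFree r}

/-- `μ_j = ⌊(r - j)/j⌋`. -/
def muD (r j : ℕ) : ℕ := (r - j) / j

/-- `ξ_j = j(μ_j + 2) - r`. -/
def xiD (r j : ℕ) : ℕ := j * (muD r j + 2) - r

theorem grPr_eq (n : ℕ) (S : Set (SimpleGraph (Fin n))) :
    grPr n S = ((Finset.univ.filter (fun G => G ∈ S)).card : ℝ) /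
      (Fintype.card (SimpleGraph (Fin n)) : ℝ) := by
  unfold grPr
  rw [PMF.toOuterMeasure_uniformOfFintype_apply, ENNReal.toReal_div]
  simp [Fintype.card_subtype]

theorem grPr_card_pos (n : ℕ) : (0 : ℝ) < Fintype.card (SimpleGraph (Fin n)) := by
  exact_mod_cast Fintype.card_pos

theorem grPr_nonneg (n : ℕ) (S : Set (SimpleGraph (Fin n))) : 0 ≤ grPr n S :=
  ENNReal.toReal_nonneg

theorem grPr_mono {n : ℕ} {S T : Set (SimpleGraph (Fin n))} (h : S ⊆ T) :
    grPr n S ≤ grPr n T := by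
  rw [grPr_eq, grPr_eq]
  gcongr

theorem grPr_univ (n : ℕ) : grPr n Set.univ = 1 := by
  rw [grPr_eq]
  have := grPr_card_pos n
  simp [Finset.card_univ]

theorem grPr_le_one (n : ℕ) (S : Set (SimpleGraph (Fin n))) : grPr n S ≤ 1 :=
  (grPr_mono (Set.subset_univ S)).trans (grPr_univ n).le

theorem grPr_union_le {n : ℕ} (S T : Set (SimpleGraph (Fin n))) :
    grPr n (S ∪ T) ≤ grPr n S + grPr n T := by
  rw [grPr_eq, grPr_eq, grPr_eq, ← add_div]
  gcongr
  calc _ = (((Finset.univ.filter (fun G => G ∈ S)) ∪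
        (Finset.univ.filter (fun G => G ∈ T))).card : ℝ) := by congr 2; ext G; simp
    _ ≤ _ := by exact_mod_cast Finset.card_union_le _ _

theorem grPr_empty (n : ℕ) : grPr n ∅ = 0 := by
  rw [grPr_eq]; simp

theorem grPr_iUnion_le {n : ℕ} {ι : Type*} (s : Finset ι) (A : ι → Set (SimpleGraph (Fin n)))
    (S : Set (SimpleGraph (Fin n))) (h : ∀ G ∈ S, ∃ i ∈ s, G ∈ A i) :
    grPr n S ≤ ∑ i ∈ s, grPr n (A i) := by
  induction s using Finset.induction_on generalizing S with
  | empty =>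
    have : S = ∅ := by
      ext G; constructor
      · intro hG; obtain ⟨i, hi, _⟩ := h G hG; simp at hi
      · simp
    rw [this, grPr_empty]; simp
  | insert a s ha ih =>
    rw [Finset.sum_insert ha]
    have h1 := ih (S \ A a) (by
      rintro G ⟨hG, hG'⟩
      obtain ⟨i, hi, hGi⟩ := h G hG
      rcases Finset.mem_insert.1 hi with rfl | hi
      · exact absurd hGi hG'
      · exact ⟨i, hi, hGi⟩)
    calc grPr n S ≤ grPr n (A a ∪ (S \ A a)) := grPr_mono (by
            intro G hG; by_cases h : G ∈ A a <;> simp [h, hG])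
      _ ≤ _ := (grPr_union_le _ _).trans (by linarith)

theorem grPr_sum_disjoint {n : ℕ} {ι : Type*} (s : Finset ι) (A : ι → Set (SimpleGraph (Fin n)))
    (S : Set (SimpleGraph (Fin n))) (h : ∀ G, G ∈ S ↔ ∃ i ∈ s, G ∈ A i)
    (hd : ∀ i ∈ s, ∀ j ∈ s, ∀ G, G ∈ A i → G ∈ A j → i = j) :
    grPr n S = ∑ i ∈ s, grPr n (A i) := by
  simp_rw [grPr_eq]
  rw [← Finset.sum_div]
  congr 1
  have : (Finset.univ.filter (fun G => G ∈ S)) =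
      s.biUnion (fun i => Finset.univ.filter (fun G => G ∈ A i)) := by
    ext G; simp [h]
  rw [this, Finset.card_biUnion]
  · push_cast; rfl
  · intro i hi j hj hij
    rw [Function.onFun, Finset.disjoint_left]
    intro G h1 h2
    simp at h1 h2
    exact hij (hd i hi j hj G h1 h2)

/-- The event `A` only depends on the pairs in `D`. -/
def DepOn {n : ℕ} (D : Set (Sym2 (Fin n))) (A : Set (SimpleGraph (Fin n))) : Prop :=
  ∀ G G' : SimpleGraph (Fin n), (∀ e ∈ D, e ∈ G.edgeSet ↔ e ∈ G'.edgeSet) → G ∈ A → G' ∈ A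

theorem DepOn.inter {n : ℕ} {D D' : Set (Sym2 (Fin n))} {A A' : Set (SimpleGraph (Fin n))}
    (h : DepOn D A) (h' : DepOn D' A') : DepOn (D ∪ D') (A ∩ A') :=
  fun G G' hG hA => ⟨h G G' (fun e he => hG e (Or.inl he)) hA.1,
    h' G G' (fun e he => hG e (Or.inr he)) hA.2⟩

/-- The graph agreeing with `G` on `D` and with `G'` off `D`. -/
def mixGraph {n : ℕ} (D : Set (Sym2 (Fin n))) (G G' : SimpleGraph (Fin n)) :
    SimpleGraph (Fin n) :=
  SimpleGraph.fromEdgeSet {e | (e ∈ D ∧ e ∈ G.edgeSet) ∨ (e ∉ D ∧ e ∈ G'.edgeSet)}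

theorem mem_mixGraph {n : ℕ} {D : Set (Sym2 (Fin n))} {G G' : SimpleGraph (Fin n)}
    {e : Sym2 (Fin n)} : e ∈ (mixGraph D G G').edgeSet ↔
      (e ∈ D ∧ e ∈ G.edgeSet) ∨ (e ∉ D ∧ e ∈ G'.edgeSet) := by
  unfold mixGraph
  rw [SimpleGraph.edgeSet_fromEdgeSet]
  constructor
  · rintro ⟨h, _⟩; exact h
  · intro h
    refine ⟨h, fun hd => ?_⟩
    rcases h with ⟨_, h⟩ | ⟨_, h⟩
    · exact SimpleGraph.not_isDiag_of_mem_edgeSet _ h hd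
    · exact SimpleGraph.not_isDiag_of_mem_edgeSet _ h hd

theorem grPr_inter_of_depOn {n : ℕ} {D D' : Set (Sym2 (Fin n))}
    {A B : Set (SimpleGraph (Fin n))} (hA : DepOn D A) (hB : DepOn D' B)
    (hd : Disjoint D D') : grPr n (A ∩ B) = grPr n A * grPr n B := by
  have hd' : ∀ e, e ∈ D' → e ∉ D := fun e he he' => Set.disjoint_left.1 hd he' he
  have key : (Finset.univ.filter (fun G => G ∈ A)).card *
      (Finset.univ.filter (fun G => G ∈ B)).card =
      (Finset.univ.filter (fun G => G ∈ A ∩ B)).card *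
        (Finset.univ : Finset (SimpleGraph (Fin n))).card := by
    rw [← Finset.card_product, ← Finset.card_product]
    refine Finset.card_nbij' (fun p => (mixGraph D p.1 p.2, mixGraph D p.2 p.1))
      (fun p => (mixGraph D p.1 p.2, mixGraph D p.2 p.1)) ?_ ?_ ?_ ?_
    · rintro ⟨G, G'⟩ h
      simp only [Finset.coe_product, Finset.coe_filter, Set.mem_prod, Set.mem_ofPred_eq,
        Finset.mem_univ, true_and, Finset.coe_univ, Set.mem_univ, and_true] at h ⊢
      refine ⟨hA G _ (fun e he => ?_) h.1, hB G' _ (fun e he => ?_) h.2⟩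
      · rw [mem_mixGraph]; simp [he]
      · rw [mem_mixGraph]; simp [hd' e he]
    · rintro ⟨G, G'⟩ h
      simp only [Finset.coe_product, Finset.coe_filter, Set.mem_prod, Set.mem_ofPred_eq,
        Finset.mem_univ, true_and, Finset.coe_univ, Set.mem_univ, and_true] at h ⊢
      refine ⟨hA G _ (fun e he => ?_) h.1, hB G _ (fun e he => ?_) h.2⟩
      · rw [mem_mixGraph]; simp [he]
      · rw [mem_mixGraph]; simp [hd' e he]
    · rintro ⟨G, G'⟩ h
      ext1
      · apply SimpleGraph.edgeSet_injective; ext e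
        simp only [mem_mixGraph]; tauto
      · apply SimpleGraph.edgeSet_injective; ext e
        simp only [mem_mixGraph]; tauto
    · rintro ⟨G, G'⟩ h
      ext1
      · apply SimpleGraph.edgeSet_injective; ext e
        simp only [mem_mixGraph]; tauto
      · apply SimpleGraph.edgeSet_injective; ext e
        simp only [mem_mixGraph]; tauto
  have hp := grPr_card_pos n
  have e1 : grPr n (A ∩ B) = ((Finset.univ.filter (fun G => G ∈ A ∩ B)).card : ℝ) /
      (Fintype.card (SimpleGraph (Fin n)) : ℝ) := by rw [grPr_eq]; congr
  rw [e1, grPr_eq, grPr_eq]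
  have key' : ((Finset.univ.filter (fun G => G ∈ A)).card : ℝ) *
      (Finset.univ.filter (fun G => G ∈ B)).card =
      (Finset.univ.filter (fun G => G ∈ A ∩ B)).card *
        (Fintype.card (SimpleGraph (Fin n)) : ℝ) := by
    rw [← Finset.card_univ]; exact_mod_cast key
  field_simp
  linarith

theorem grPr_biInter_of_depOn {n : ℕ} {ι : Type*} (s : Finset ι) {D : ι → Set (Sym2 (Fin n))}
    {A : ι → Set (SimpleGraph (Fin n))} (h : ∀ i ∈ s, DepOn (D i) (A i))
    (hd : ∀ i ∈ s, ∀ j ∈ s, i ≠ j → Disjoint (D i) (D j)) :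
    grPr n {G | ∀ i ∈ s, G ∈ A i} = ∏ i ∈ s, grPr n (A i) := by
  induction s using Finset.induction_on with
  | empty => simp only [Finset.notMem_empty, false_imp_iff, implies_true, Finset.prod_empty]
             exact grPr_univ n
  | insert a s ha ih =>
    rw [Finset.prod_insert ha, ← ih (fun i hi => h i (Finset.mem_insert_of_mem hi))
      (fun i hi j hj => hd i (Finset.mem_insert_of_mem hi) j (Finset.mem_insert_of_mem hj))]
    have hd2 : DepOn (⋃ i ∈ s, D i) {G | ∀ i ∈ s, G ∈ A i} := by
      intro G G' hG hA i hi
      exact h i (Finset.mem_insert_of_mem hi) G G' (fun e he => hG e (by simp; exact ⟨i, hi, he⟩))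
        (hA i hi)
    rw [← grPr_inter_of_depOn (h a (Finset.mem_insert_self a s)) hd2]
    · congr 1; ext G; simp
    · simp only [Set.disjoint_iUnion_right]
      intro i hi
      exact hd a (Finset.mem_insert_self a s) i (Finset.mem_insert_of_mem hi)
        (by rintro rfl; exact ha hi)

theorem grPr_edge {n : ℕ} {e : Sym2 (Fin n)} (he : ¬ e.IsDiag) (p : Prop) :
    grPr n {G | e ∈ G.edgeSet ↔ p} = 1 / 2 := by
  have hsum : ∀ p : Prop, grPr n {G | e ∈ G.edgeSet ↔ p} = grPr n {G | e ∈ G.edgeSet ↔ ¬ p} := by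
    intro p
    rw [grPr_eq, grPr_eq]
    congr 2
    let t : SimpleGraph (Fin n) → SimpleGraph (Fin n) := fun G => mixGraph {e} Gᶜ G
    have ht : ∀ G e', e' ∈ (t G).edgeSet ↔ (e' = e ∧ e' ∉ G.edgeSet) ∨ (e' ≠ e ∧ e' ∈ G.edgeSet) := by
      intro G e'
      simp only [t, mem_mixGraph, Set.mem_singleton_iff]
      have : e' = e → (e' ∈ (Gᶜ).edgeSet ↔ e' ∉ G.edgeSet) := by
        rintro rfl
        induction e' with
        | _ a b =>
          simp only [SimpleGraph.mem_edgeSet, SimpleGraph.compl_adj]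
          simp at he
          simp [he]
      tauto
    have htt : ∀ G, t (t G) = G := by
      intro G
      apply SimpleGraph.edgeSet_injective; ext e'
      rw [ht, ht]; tauto
    refine Finset.card_nbij' t t ?_ ?_ (fun G _ => htt G) (fun G _ => htt G)
    · intro G hG
      simp only [Finset.coe_filter, Set.mem_ofPred_eq, Finset.mem_univ, true_and, ht] at hG ⊢
      tauto
    · intro G hG
      simp only [Finset.coe_filter, Set.mem_ofPred_eq, Finset.mem_univ, true_and, ht] at hG ⊢
      tauto
  have h2 : grPr n {G | e ∈ G.edgeSet ↔ p} + grPr n {G | e ∈ G.edgeSet ↔ ¬ p} = 1 := by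
    have := grPr_sum_disjoint (n := n) (Finset.univ : Finset Bool)
      (fun b => {G | e ∈ G.edgeSet ↔ (b = true ↔ p)}) Set.univ
      (by intro G; simp; tauto) (by
        intro i _ j _ G h1 h2
        simp only [Set.mem_ofPred_eq] at h1 h2
        cases i <;> cases j <;> simp_all)
    rw [grPr_univ] at this
    simp at this
    linarith
  have := hsum p
  linarith

/-- The pairs of distinct vertices inside `A`. -/
noncomputable def prs {n : ℕ} (A : Finset (Fin n)) : Finset (Sym2 (Fin n)) :=
  A.offDiag.image (fun p => s(p.1, p.2))

theorem mem_prs {n : ℕ} {A : Finset (Fin n)} {e : Sym2 (Fin n)} :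
    e ∈ prs A ↔ ¬ e.IsDiag ∧ ∀ v ∈ e, v ∈ A := by
  induction e with
  | _ a b =>
    simp only [prs, Finset.mem_image, Finset.mem_offDiag, Prod.exists, Sym2.mk_isDiag_iff,
      Sym2.mem_iff, forall_eq_or_imp, forall_eq, Sym2.eq_iff]
    constructor
    · rintro ⟨x, y, ⟨hx, hy, hxy⟩, (⟨rfl, rfl⟩ | ⟨rfl, rfl⟩)⟩
      · exact ⟨hxy, hx, hy⟩
      · exact ⟨fun h => hxy h.symm, hy, hx⟩
    · rintro ⟨h, ha, hb⟩
      exact ⟨a, b, ⟨ha, hb, h⟩, Or.inl ⟨rfl, rfl⟩⟩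

theorem mk_mem_prs {n : ℕ} {A : Finset (Fin n)} {a b : Fin n} :
    s(a, b) ∈ prs A ↔ a ≠ b ∧ a ∈ A ∧ b ∈ A := by
  rw [mem_prs]; simp

theorem card_prs {n : ℕ} (A : Finset (Fin n)) : (prs A).card = A.card.choose 2 :=
  Sym2.card_image_offDiag A

/-- The edges of `G` among the pairs in `D`. -/
noncomputable def tr {n : ℕ} (G : SimpleGraph (Fin n)) (D : Finset (Sym2 (Fin n))) :
    Finset (Sym2 (Fin n)) :=
  D.filter (fun e => e ∈ G.edgeSet)

theorem edgesIn_eq {n : ℕ} (G : SimpleGraph (Fin n)) (A : Finset (Fin n)) :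
    edgesIn G A = (tr G (prs A)).card := by
  unfold edgesIn
  rw [← Set.ncard_coe_finset]
  congr 1
  ext e
  simp only [tr, Finset.coe_filter, mem_prs, Set.mem_ofPred_eq]
  constructor
  · rintro ⟨h1, h2⟩; exact ⟨⟨SimpleGraph.not_isDiag_of_mem_edgeSet _ h1, h2⟩, h1⟩
  · rintro ⟨⟨_, h2⟩, h1⟩; exact ⟨h1, h2⟩

theorem grPr_pattern {n : ℕ} {D P : Finset (Sym2 (Fin n))} (hD : ∀ e ∈ D, ¬ e.IsDiag)
    (hP : P ⊆ D) : grPr n {G | tr G D = P} = (1 / 2 : ℝ) ^ D.card := by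
  have : {G | tr G D = P} = {G : SimpleGraph (Fin n) | ∀ e ∈ D,
      G ∈ {G : SimpleGraph (Fin n) | e ∈ G.edgeSet ↔ e ∈ P}} := by
    ext G
    simp only [Set.mem_ofPred_eq, tr]
    constructor
    · rintro rfl e he; simp [he]
    · intro h; ext e
      simp only [Finset.mem_filter]
      constructor
      · rintro ⟨h1, h2⟩; exact (h e h1).1 h2
      · intro h1; exact ⟨hP h1, (h e (hP h1)).2 h1⟩
  rw [this, grPr_biInter_of_depOn D (D := fun e => {e})
    (A := fun e => {G : SimpleGraph (Fin n) | e ∈ G.edgeSet ↔ e ∈ P})]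
  · rw [Finset.prod_congr rfl (fun e he => grPr_edge (hD e he) (e ∈ P)), Finset.prod_const]
  · intro e _ G G' h hG
    simp only [Set.mem_singleton_iff, forall_eq, Set.mem_ofPred_eq] at h hG ⊢
    rw [← h]; exact hG
  · intro i _ j _ hij; simpa using hij

theorem grPr_family {n : ℕ} {D : Finset (Sym2 (Fin n))} (hD : ∀ e ∈ D, ¬ e.IsDiag)
    (F : Finset (Finset (Sym2 (Fin n)))) (hF : F ⊆ D.powerset) :
    grPr n {G | tr G D ∈ F} = F.card * (1 / 2 : ℝ) ^ D.card := by
  rw [grPr_sum_disjoint F (fun P => {G | tr G D = P})]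
  · rw [Finset.sum_congr rfl (fun P hP => grPr_pattern hD (Finset.mem_powerset.1 (hF hP)))]
    simp
  · intro G; simp
  · intro i _ j _ G h1 h2
    simp only [Set.mem_ofPred_eq] at h1 h2
    rw [← h1, h2]

theorem depOn_tr {n : ℕ} (D : Finset (Sym2 (Fin n))) (F : Finset (Sym2 (Fin n)) → Prop) :
    DepOn (D : Set (Sym2 (Fin n))) {G | F (tr G D)} := by
  intro G G' h hG
  simp only [Set.mem_ofPred_eq] at hG ⊢
  have : tr G' D = tr G D := by
    unfold tr
    apply Finset.filter_congr
    intro e he; exact (h e he).symm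
  rwa [this]

theorem grPr_card_eq {n : ℕ} {D : Finset (Sym2 (Fin n))} (hD : ∀ e ∈ D, ¬ e.IsDiag) (i : ℕ) :
    grPr n {G | (tr G D).card = i} = D.card.choose i * (1 / 2 : ℝ) ^ D.card := by
  rw [← Finset.card_powersetCard, ← grPr_family hD]
  · congr 1; ext G
    simp only [Set.mem_ofPred_eq, Finset.mem_powersetCard]
    simp [tr]
  · intro P hP
    rw [Finset.mem_powersetCard] at hP
    simpa using hP.1

theorem prs_not_isDiag {n : ℕ} (A : Finset (Fin n)) : ∀ e ∈ prs A, ¬ e.IsDiag :=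
  fun _ he => (mem_prs.1 he).1

theorem sum_choose_le_pow (M t : ℕ) : ∑ i ∈ Finset.range (t + 1), M.choose i ≤ (M + 1) ^ t := by
  induction t with
  | zero => simp
  | succ t ih =>
    rw [Finset.sum_range_succ]
    have h1 : M.choose (t + 1) ≤ M * (M + 1) ^ t := by
      calc M.choose (t + 1) ≤ M ^ (t + 1) := Nat.choose_le_pow M (t + 1)
        _ = M * M ^ t := by ring
        _ ≤ M * (M + 1) ^ t := by gcongr; omega
    calc _ ≤ (M + 1) ^ t + M * (M + 1) ^ t := by omega
      _ = (M + 1) ^ (t + 1) := by ring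

theorem grPr_card_le {n : ℕ} {D : Finset (Sym2 (Fin n))} (hD : ∀ e ∈ D, ¬ e.IsDiag) (t : ℕ) :
    grPr n {G | (tr G D).card ≤ t} ≤ (D.card + 1 : ℝ) ^ t * (1 / 2 : ℝ) ^ D.card := by
  rw [grPr_sum_disjoint (Finset.range (t + 1)) (fun i => {G | (tr G D).card = i})]
  · rw [Finset.sum_congr rfl (fun i _ => grPr_card_eq hD i), ← Finset.sum_mul]
    gcongr
    exact_mod_cast sum_choose_le_pow D.card t
  · intro G; simp
  · intro i _ j _ G h1 h2
    simp only [Set.mem_ofPred_eq] at h1 h2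
    rw [← h1, h2]

/-- If all but fewer than `t` of `w` independent unlikely events occur. -/
theorem grPr_most {n : ℕ} {ι : Type*} (s : Finset ι) {D : ι → Set (Sym2 (Fin n))}
    {A : ι → Set (SimpleGraph (Fin n))} (h : ∀ i ∈ s, DepOn (D i) (A i))
    (hd : ∀ i ∈ s, ∀ j ∈ s, i ≠ j → Disjoint (D i) (D j)) {ρ : ℝ} (hρ0 : 0 ≤ ρ) (hρ1 : ρ ≤ 1)
    (hρ : ∀ i ∈ s, grPr n (A i) ≤ ρ) (t : ℕ) :
    grPr n {G | (s.filter (fun i => G ∉ A i)).card ≤ t} ≤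
      (s.card + 1 : ℝ) ^ t * ρ ^ (s.card - t) := by
  have h1 := grPr_iUnion_le (n := n) (s.powerset.filter (fun P => P.card ≤ t))
    (fun P => {G | ∀ i ∈ s \ P, G ∈ A i}) {G | (s.filter (fun i => G ∉ A i)).card ≤ t} (by
      intro G hG
      refine ⟨s.filter (fun i => G ∉ A i), by simpa using hG, ?_⟩
      intro i hi
      simp at hi
      by_contra hh; exact hh (hi.2 hi.1))
  refine h1.trans ?_
  have h2 : ∀ P ∈ s.powerset.filter (fun P => P.card ≤ t),
      grPr n {G | ∀ i ∈ s \ P, G ∈ A i} ≤ ρ ^ (s.card - t) := by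
    intro P hP
    simp only [Finset.mem_filter, Finset.mem_powerset] at hP
    rw [grPr_biInter_of_depOn (D := D) _ (fun i hi => h i (Finset.sdiff_subset hi))
      (fun i hi j hj => hd i (Finset.sdiff_subset hi) j (Finset.sdiff_subset hj))]
    calc _ ≤ ∏ i ∈ s \ P, ρ := Finset.prod_le_prod (fun i _ => grPr_nonneg _ _)
            (fun i hi => hρ i (Finset.sdiff_subset hi))
      _ = ρ ^ (s \ P).card := by simp
      _ ≤ _ := by
        apply pow_le_pow_of_le_one hρ0 hρ1
        rw [Finset.card_sdiff_of_subset hP.1]; omega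
  refine (Finset.sum_le_sum h2).trans ?_
  rw [Finset.sum_const, nsmul_eq_mul]
  gcongr
  have : (s.powerset.filter (fun P => P.card ≤ t)).card ≤ (s.card + 1) ^ t := by
    refine le_trans ?_ (sum_choose_le_pow s.card t)
    have : s.powerset.filter (fun P => P.card ≤ t) ⊆
        (Finset.range (t + 1)).biUnion (fun i => s.powersetCard i) := by
      intro P hP
      simp only [Finset.mem_filter, Finset.mem_powerset] at hP
      simp only [Finset.mem_biUnion, Finset.mem_range, Finset.mem_powersetCard]
      exact ⟨P.card, by omega, hP.1, rfl⟩
    refine (Finset.card_le_card this).trans (Finset.card_biUnion_le.trans ?_)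
    simp
  exact_mod_cast this

section Container
variable {V : Type*} [Fintype V] [DecidableEq V]

/-- Neighbourhood as a finset. -/
noncomputable def nbF (G : SimpleGraph V) (x : V) : Finset V :=
  Finset.univ.filter (fun y => G.Adj x y)

omit [DecidableEq V] in
theorem mem_nbF {G : SimpleGraph V} {x y : V} : y ∈ nbF G x ↔ G.Adj x y := by simp [nbF]

/-- Number of ordered pairs in `X × Y` related by `R`. -/
noncomputable def eR (R : V → V → Prop) (X Y : Finset V) : ℝ :=
  ∑ x ∈ X, ∑ y ∈ Y, if R x y then 1 else 0

omit [Fintype V] [DecidableEq V] in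
theorem eR_nonneg (R : V → V → Prop) (X Y : Finset V) : 0 ≤ eR R X Y :=
  Finset.sum_nonneg fun _ _ => Finset.sum_nonneg fun _ _ => by split_ifs <;> norm_num

omit [Fintype V] [DecidableEq V] in
theorem eR_le_mul (R : V → V → Prop) (X Y : Finset V) : eR R X Y ≤ X.card * Y.card := by
  unfold eR
  calc _ ≤ ∑ x ∈ X, ∑ y ∈ Y, (1 : ℝ) := Finset.sum_le_sum fun _ _ =>
        Finset.sum_le_sum fun _ _ => by split_ifs <;> norm_num
    _ = _ := by simp

omit [Fintype V] [DecidableEq V] in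
theorem eR_mono {R R' : V → V → Prop} {X Y : Finset V}
    (h : ∀ x ∈ X, ∀ y ∈ Y, R x y → R' x y) : eR R X Y ≤ eR R' X Y := by
  unfold eR
  refine Finset.sum_le_sum fun x hx => Finset.sum_le_sum fun y hy => ?_
  by_cases h1 : R x y
  · simp [h1, h x hx y hy h1]
  · simp only [h1, if_false]; split_ifs <;> norm_num

omit [Fintype V] [DecidableEq V] in
theorem eR_congr {R R' : V → V → Prop} {X Y : Finset V}
    (h : ∀ x ∈ X, ∀ y ∈ Y, R x y ↔ R' x y) : eR R X Y = eR R' X Y :=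
  le_antisymm (eR_mono fun x hx y hy => (h x hx y hy).1) (eR_mono fun x hx y hy => (h x hx y hy).2)

omit [Fintype V] [DecidableEq V] in
theorem eR_or_le {R R' R'' : V → V → Prop} {X Y : Finset V}
    (h : ∀ x ∈ X, ∀ y ∈ Y, R x y → R' x y ∨ R'' x y) : eR R X Y ≤ eR R' X Y + eR R'' X Y := by
  unfold eR
  rw [← Finset.sum_add_distrib]
  refine Finset.sum_le_sum fun x hx => ?_
  rw [← Finset.sum_add_distrib]
  refine Finset.sum_le_sum fun y hy => ?_
  have := h x hx y hy
  by_cases h1 : R x y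
  · rcases this h1 with h | h
    · simp only [h1, h, if_true]; split_ifs <;> norm_num
    · simp only [h1, h, if_true]; split_ifs <;> norm_num
  · simp only [h1, if_false]; split_ifs <;> norm_num

omit [Fintype V] [DecidableEq V] in
theorem eR_symm {R : V → V → Prop} (hR : ∀ x y, R x y → R y x) (X Y : Finset V) :
    eR R X Y = eR R Y X := by
  unfold eR
  rw [Finset.sum_comm]
  have : ∀ x y, R x y ↔ R y x := fun x y => ⟨hR x y, hR y x⟩
  simp_rw [this]

omit [Fintype V] in
theorem eR_split_left (R : V → V → Prop) (A S Y : Finset V) :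
    eR R A Y = eR R (A ∩ S) Y + eR R (A \ S) Y := by
  unfold eR
  exact (Finset.sum_inter_add_sum_sdiff A S _).symm

omit [Fintype V] in
theorem eR_split_right (R : V → V → Prop) (X A S : Finset V) :
    eR R X A = eR R X (A ∩ S) + eR R X (A \ S) := by
  unfold eR
  rw [← Finset.sum_add_distrib]
  refine Finset.sum_congr rfl fun x _ => ?_
  exact (Finset.sum_inter_add_sum_sdiff A S _).symm

theorem eR_adj (G : SimpleGraph V) (X Y : Finset V) :
    eR G.Adj X Y = ∑ x ∈ X, ((Y ∩ nbF G x).card : ℝ) := by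
  unfold eR
  refine Finset.sum_congr rfl fun x _ => ?_
  rw [Finset.sum_ite]
  simp
  congr 1
  ext; simp [mem_nbF]

theorem exists_top (G : SimpleGraph V) (A : Finset V) (h : ℕ) :
    ∃ T ⊆ A, T.card = min h A.card ∧
      ∀ z ∈ T, ∀ y ∈ A \ T, (A ∩ nbF G y).card ≤ (A ∩ nbF G z).card := by
  induction h with
  | zero => exact ⟨∅, by simp, by simp, by simp⟩
  | succ h ih =>
    obtain ⟨T, hT, hc, hz⟩ := ih
    by_cases hn : (A \ T).Nonempty
    · obtain ⟨m, hm, hmax⟩ := Finset.exists_max_image (A \ T) (fun y => (A ∩ nbF G y).card) hn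
      simp only [Finset.mem_sdiff] at hm
      refine ⟨insert m T, Finset.insert_subset hm.1 hT, ?_, ?_⟩
      · rw [Finset.card_insert_of_notMem hm.2, hc]
        have : T.card < A.card := Finset.card_lt_card ⟨hT, fun hh => hm.2 (hh hm.1)⟩
        omega
      · intro z hz' y hy
        simp only [Finset.mem_sdiff, Finset.mem_insert, not_or] at hy
        rcases Finset.mem_insert.1 hz' with rfl | hz'
        · exact hmax y (by simp [hy])
        · exact hz z hz' y (by simp [hy])
    · rw [Finset.not_nonempty_iff_eq_empty, Finset.sdiff_eq_empty_iff_subset] at hn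
      have : T = A := Finset.Subset.antisymm hT hn
      refine ⟨T, hT, ?_, hz⟩
      subst this; omega

/-- A set of `min h |A|` vertices of largest degree in `A`. -/
noncomputable def topF (G : SimpleGraph V) (h : ℕ) (A : Finset V) : Finset V :=
  (exists_top G A h).choose

theorem topF_subset (G : SimpleGraph V) (h : ℕ) (A : Finset V) : topF G h A ⊆ A :=
  (exists_top G A h).choose_spec.1

theorem topF_card (G : SimpleGraph V) (h : ℕ) (A : Finset V) :
    (topF G h A).card = min h A.card :=
  (exists_top G A h).choose_spec.2.1

theorem topF_deg (G : SimpleGraph V) (h : ℕ) (A : Finset V) : ∀ z ∈ topF G h A,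
    ∀ y ∈ A \ topF G h A, (A ∩ nbF G y).card ≤ (A ∩ nbF G z).card :=
  (exists_top G A h).choose_spec.2.2

/-- The candidate sets along a greedy sequence of vertices. -/
noncomputable def candF (G : SimpleGraph V) (h : ℕ) : ℕ → Finset V → List V → Finset V
  | r, A, [] => if r = 0 then A else topF G h A
  | r, A, x :: l => candF G h (r - 1) (A ∩ nbF G x) l

/-- Each entry of the list is a candidate after the preceding ones. -/
def ChainF : (List V → Finset V) → List V → Prop
  | _, [] => True
  | X, x :: l => x ∈ X [] ∧ ChainF (fun l' => X (x :: l')) l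

theorem candF_subset (G : SimpleGraph V) (h : ℕ) (l : List V) (r : ℕ) (A : Finset V) :
    candF G h r A l ⊆ A := by
  induction l generalizing r A with
  | nil => unfold candF; split_ifs; exacts [subset_rfl, topF_subset _ _ _]
  | cons x l ih => unfold candF; exact (ih _ _).trans Finset.inter_subset_left

theorem candF_subset_nb (G : SimpleGraph V) (h : ℕ) (l : List V) (r : ℕ) (A : Finset V) :
    ∀ x ∈ l, candF G h r A l ⊆ nbF G x := by
  induction l generalizing r A with
  | nil => simp
  | cons x l ih =>
    intro z hz
    unfold candF
    rcases List.mem_cons.1 hz with rfl | hz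
    · exact (candF_subset _ _ _ _ _).trans Finset.inter_subset_right
    · exact ih _ _ z hz

theorem furedi_aux (G : SimpleGraph V) (h : ℕ) (l : List V) (r : ℕ) (A : Finset V)
    (hl : l.length ≤ r) (hch : ChainF (candF G h r A) l) (hs : (candF G h r A l).card < h) :
    ∃ c : V → ℕ, (∀ v, c v ≤ l.length) ∧ (A.filter (fun v => c v = 0)).card < h ∧
      eR G.Adj A A + eR (fun x y => G.Adj x y ∧ c x = c y) A A ≤
        ((l.length - 1 : ℕ) : ℝ) / l.length * A.card ^ 2 +
          (4 * l.length + 2) * (h * Fintype.card V) := by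
  induction l generalizing r A with
  | nil =>
    have hA : A.card < h := by
      unfold candF at hs
      split_ifs at hs
      · exact hs
      · rw [topF_card] at hs; omega
    refine ⟨fun _ => 0, by simp, by simpa using hA, ?_⟩
    have h1 : (A.card : ℝ) ≤ h := by exact_mod_cast hA.le
    have h2 : (A.card : ℝ) ≤ Fintype.card V := by exact_mod_cast Finset.card_le_univ A
    have h3 := eR_le_mul G.Adj A A
    have h4 := eR_le_mul (fun x y => G.Adj x y ∧ (0 : ℕ) = 0) A A
    have h5 : (A.card : ℝ) * A.card ≤ h * Fintype.card V := by gcongr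
    simp only [List.length_nil]
    norm_num at h4 ⊢
    linarith
  | cons x l ih =>
    simp only [List.length_cons] at hl
    obtain ⟨hx, hch'⟩ := hch
    have hr : r ≠ 0 := by omega
    have hx' : x ∈ topF G h A := by simpa [candF, hr] using hx
    set A' := A ∩ nbF G x with hA'
    set W := A \ nbF G x with hW
    obtain ⟨c, hc1, hc2, hc3⟩ := ih (r - 1) A' (by omega) hch' (by simpa [candF] using hs)
    refine ⟨fun v => if v ∈ A' then c v else l.length + 1, ?_, ?_, ?_⟩
    · intro v
      simp only [List.length_cons]
      split_ifs
      · have := hc1 v; omega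
      · exact le_rfl
    · refine lt_of_le_of_lt (Finset.card_le_card ?_) hc2
      intro v hv
      simp only [Finset.mem_filter] at hv ⊢
      by_cases hvA : v ∈ A'
      · simp [hvA] at hv; exact ⟨hvA, hv.2⟩
      · simp [hvA] at hv
    · have hWn : ∀ v ∈ W, v ∉ A' := by intro v hv; simp [hW, hA'] at hv ⊢; tauto
      have hsym : eR G.Adj A' W = eR G.Adj W A' := eR_symm (fun x y h => h.symm) _ _
      have e1 : eR G.Adj A A = eR G.Adj A' A' + eR G.Adj A' W + eR G.Adj W A := by
        rw [eR_split_left _ A (nbF G x), eR_split_right _ (A ∩ nbF G x) A (nbF G x)]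
      have e2 : eR G.Adj W A = eR G.Adj W A' + eR G.Adj W W := eR_split_right _ _ _ _
      set R := fun x y => G.Adj x y ∧ (if x ∈ A' then c x else l.length + 1) =
        (if y ∈ A' then c y else l.length + 1) with hR
      have e3 : eR R A A = eR R A' A' + eR R A' W + (eR R W A' + eR R W W) := by
        rw [eR_split_left _ A (nbF G x), eR_split_right _ (A ∩ nbF G x) A (nbF G x),
          eR_split_right _ (A \ nbF G x) A (nbF G x)]
      have hz : ∀ X Y : Finset V, (∀ x ∈ X, ∀ y ∈ Y, ¬ R x y) → eR R X Y = 0 := by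
        intro X Y hXY
        unfold eR
        exact Finset.sum_eq_zero fun x hx => Finset.sum_eq_zero fun y hy => by simp [hXY x hx y hy]
      have e4 : eR R A' W = 0 := hz _ _ (by
        rintro u hu v hv ⟨_, h2⟩
        simp only [hu, hWn v hv, if_true, if_false] at h2
        have := hc1 u; omega)
      have e5 : eR R W A' = 0 := hz _ _ (by
        rintro u hu v hv ⟨_, h2⟩
        simp only [hv, hWn u hu, if_true, if_false] at h2
        have := hc1 v; omega)
      have e6 : eR R W W ≤ eR G.Adj W W := eR_mono fun _ _ _ _ h => h.1
      have e7 : eR R A' A' = eR (fun x y => G.Adj x y ∧ c x = c y) A' A' :=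
        eR_congr fun u hu v hv => by simp [hR, hu, hv]
      -- degrees
      have hN : (A.card : ℝ) ≤ Fintype.card V := by exact_mod_cast Finset.card_le_univ A
      have e8 : eR G.Adj W A ≤ W.card * A'.card + h * Fintype.card V := by
        rw [eR_split_left _ W (topF G h A)]
        have t1 : eR G.Adj (W ∩ topF G h A) A ≤ h * Fintype.card V := by
          refine (eR_le_mul _ _ _).trans ?_
          have : ((W ∩ topF G h A).card : ℝ) ≤ h := by
            have h1 := Finset.card_le_card (Finset.inter_subset_right : W ∩ topF G h A ⊆ _)
            rw [topF_card] at h1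
            exact_mod_cast h1.trans (min_le_left _ _)
          gcongr
        have t2 : eR G.Adj (W \ topF G h A) A ≤ W.card * A'.card := by
          rw [eR_adj]
          calc _ ≤ ∑ v ∈ W \ topF G h A, (A'.card : ℝ) := by
                refine Finset.sum_le_sum fun v hv => ?_
                have := topF_deg G h A x hx' v (by
                  simp only [hW, Finset.mem_sdiff] at hv ⊢; exact ⟨hv.1.1, hv.2⟩)
                exact_mod_cast this
            _ = (W \ topF G h A).card * A'.card := by simp
            _ ≤ _ := by
              gcongr
              exact Finset.sdiff_subset
        linarith
      have hcard : (A.card : ℝ) = A'.card + W.card := by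
        rw [hA', hW]; exact_mod_cast (Finset.card_inter_add_card_sdiff A (nbF G x)).symm
      have key : 2 * ((W.card : ℝ) * A'.card) + ((l.length - 1 : ℕ) : ℝ) / l.length * A'.card ^ 2
          ≤ ((l.length : ℕ) : ℝ) / (l.length + 1) * A.card ^ 2 + 2 * (h * Fintype.card V) := by
        rcases Nat.eq_zero_or_pos l.length with h0 | h0
        · have hlnil : l = [] := List.eq_nil_of_length_eq_zero h0
          have ha' : (A'.card : ℝ) ≤ h := by
            have : A'.filter (fun v => c v = 0) = A' := by
              apply Finset.filter_true_of_mem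
              intro v _; have := hc1 v; omega
            rw [this] at hc2
            exact_mod_cast hc2.le
          have hw : (W.card : ℝ) ≤ Fintype.card V := by exact_mod_cast Finset.card_le_univ W
          simp only [h0]
          norm_num
          calc (W.card : ℝ) * A'.card ≤ Fintype.card V * h := by gcongr
            _ = _ := by ring
        · have hd : (0 : ℝ) < l.length := by exact_mod_cast h0
          rw [hcard, Nat.cast_sub h0]
          have hh : (0 : ℝ) ≤ h * Fintype.card V := by positivity
          generalize (l.length : ℝ) = d at hd
          generalize (A'.card : ℝ) = a
          generalize (W.card : ℝ) = v
          have : d / (d + 1) * (a + v) ^ 2 - (2 * (v * a) + (d - (1 : ℕ)) / d * a ^ 2) =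
              (a - d * v) ^ 2 / (d * (d + 1)) := by
            push_cast
            field_simp
            ring
          have h2 : 0 ≤ (a - d * v) ^ 2 / (d * (d + 1)) := by positivity
          linarith
      simp only [List.length_cons, Nat.add_sub_cancel]
      push_cast
      linarith

theorem furedi (G : SimpleGraph V) (h : ℕ) (l : List V) (r : ℕ) (hr : 1 ≤ r)
    (hl : l.length ≤ r) (hch : ChainF (candF G h r Finset.univ) l)
    (hs : (candF G h r Finset.univ l).card < h) :
    ∃ c : V → Fin r, 
      eR G.Adj Finset.univ Finset.univ +
        eR (fun x y => G.Adj x y ∧ c x = c y) Finset.univ Finset.univ ≤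
        (1 - 1 / r) * (Fintype.card V : ℝ) ^ 2 + 8 * r * (h * Fintype.card V) := by
  obtain ⟨c, h1, h2, h3⟩ := furedi_aux G h l r Finset.univ hl hch hs
  refine ⟨fun v => ⟨c v - 1, by have := h1 v; omega⟩, ?_⟩
  set Z := Finset.univ.filter (fun v => c v = 0) with hZ
  have hZ1 : ∀ v, v ∈ Z ↔ c v = 0 := by simp [hZ]
  have e1 : eR (fun x y => G.Adj x y ∧
      ((⟨c x - 1, by have := h1 x; omega⟩ : Fin r) = ⟨c y - 1, by have := h1 y; omega⟩))
        Finset.univ Finset.univ ≤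
      eR (fun x y => G.Adj x y ∧ c x = c y) Finset.univ Finset.univ +
        (eR (fun x y => x ∈ Z) Finset.univ Finset.univ +
          eR (fun x y => y ∈ Z) Finset.univ Finset.univ) := by
    refine (eR_or_le (R'' := fun x y => x ∈ Z ∨ y ∈ Z) ?_).trans
      (add_le_add le_rfl (eR_or_le fun x _ y _ h => h))
    rintro x - y - ⟨ha, hb⟩
    simp only [hZ1, Fin.mk.injEq] at hb ⊢
    by_cases h0 : c x = 0 ∨ c y = 0
    · exact Or.inr h0
    · left; exact ⟨ha, by omega⟩
  have hZc : (Z.card : ℝ) ≤ h := by exact_mod_cast h2.le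
  have e2 : eR (fun x y : V => x ∈ Z) Finset.univ Finset.univ ≤ h * Fintype.card V := by
    have : eR (fun x y : V => x ∈ Z) Finset.univ Finset.univ = Z.card * Fintype.card V := by
      unfold eR; simp
    rw [this]; gcongr
  have e3 : eR (fun x y : V => y ∈ Z) Finset.univ Finset.univ ≤ h * Fintype.card V := by
    have : eR (fun x y : V => y ∈ Z) Finset.univ Finset.univ = Z.card * Fintype.card V := by
      unfold eR; rw [Finset.sum_comm]; simp
    rw [this]; gcongr
  have hr' : (1 : ℝ) ≤ r := by exact_mod_cast hr
  have hlr : (l.length : ℝ) ≤ r := by exact_mod_cast hl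
  have hq : ((l.length - 1 : ℕ) : ℝ) / l.length ≤ 1 - 1 / r := by
    rcases Nat.eq_zero_or_pos l.length with h0 | h0
    · simp [h0]; exact inv_le_one_of_one_le₀ hr'
    · have hd : (0 : ℝ) < l.length := by exact_mod_cast h0
      rw [Nat.cast_sub h0, Nat.cast_one, sub_div, div_self hd.ne']
      have : 1 / (r : ℝ) ≤ 1 / l.length := one_div_le_one_div_of_le hd hlr
      linarith
  have hN : (0 : ℝ) ≤ (Fintype.card V : ℝ) ^ 2 := by positivity
  have h4 := mul_le_mul_of_nonneg_right hq hN
  have hh : (0 : ℝ) ≤ h * Fintype.card V := by positivity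
  have h5 : (4 * (l.length : ℝ) + 2) * (h * Fintype.card V) + 2 * (h * Fintype.card V) ≤
      8 * r * (h * Fintype.card V) := by
    rw [← add_mul]
    refine mul_le_mul_of_nonneg_right ?_ hh
    linarith
  rw [Finset.card_univ] at h3
  linarith

end Container

section Container
variable {V : Type*} [Fintype V] [DecidableEq V]

theorem rich_step (G Γ : SimpleGraph V) {δ : ℝ} (hδ0 : 0 < δ) (hδ1 : δ ≤ 1) (d : ℕ) :
    ∀ (X : List V → Finset V) (b : ℝ) (U : Finset V), 0 < b →
      (∀ l, l.length ≤ d → ChainF X l → b ≤ (X l).card ∧ ∀ x ∈ l, X l ⊆ nbF Γ x) →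
      (∀ l, X l ⊆ U) →
      (∃ K ⊆ U, G.IsNClique (d + 1) K) ∨
      ∃ (P B : Finset V) (w : V → List V), (∀ x, (w x).length ≤ d) ∧ δ ^ d * b ≤ B.card ∧
        ∀ x ∈ B, X (w x) ∩ P ⊆ nbF Γ x ∧ δ ^ d * b ≤ (X (w x) ∩ P).card ∧
          ((X (w x) ∩ P ∩ nbF G x).card : ℝ) ≤ δ * (X (w x) ∩ P).card := by
  induction d with
  | zero =>
    intro X b U hb hX hU
    left
    have h1 := (hX [] le_rfl trivial).1
    have h2 : 0 < (X []).card := by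
      have : (0 : ℝ) < (X []).card := lt_of_lt_of_le hb h1
      exact_mod_cast this
    obtain ⟨x, hx⟩ := Finset.card_pos.1 h2
    refine ⟨{x}, by simpa using hU _ hx, ?_⟩
    rw [SimpleGraph.isNClique_iff]
    simp
  | succ d ih =>
    intro X b U hb hX hU
    by_cases hbad : ∀ x ∈ X [], ∃ l, l.length ≤ d ∧ ChainF X (x :: l) ∧
        ((X (x :: l) ∩ nbF G x).card : ℝ) < δ * (X (x :: l)).card
    · right
      choose! f hf1 hf2 hf3 using hbad
      have hdl : δ ^ (d + 1) * b ≤ b := by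
        have : δ ^ (d + 1) ≤ 1 := pow_le_one₀ hδ0.le hδ1
        nlinarith
      refine ⟨Finset.univ, X [], fun x => if x ∈ X [] then x :: f x else [], ?_, ?_, ?_⟩
      · intro x
        simp only
        split_ifs with hx
        · have := hf1 x hx; simp; omega
        · simp
      · exact hdl.trans (hX [] (by simp) trivial).1
      · intro x hx
        simp only [hx, if_true, Finset.inter_univ]
        obtain ⟨h1, h2⟩ := hX (x :: f x) (by simpa using hf1 x hx) (hf2 x hx)
        exact ⟨h2 x (by simp), hdl.trans h1, (hf3 x hx).le⟩
    · push Not at hbad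
      obtain ⟨x, hx, hgood⟩ := hbad
      have hchain : ∀ l (Y Z : List V → Finset V), (∀ l, Y l ⊆ Z l) → ChainF Y l → ChainF Z l := by
        intro l
        induction l with
        | nil => intros; trivial
        | cons y l ihl =>
          intro Y Z hYZ hc
          exact ⟨hYZ _ hc.1, ihl _ _ (fun l' => hYZ _) hc.2⟩
      have hch2 : ∀ l, ChainF (fun l => X (x :: l) ∩ nbF G x) l → ChainF X (x :: l) := fun l hl =>
        ⟨hx, hchain l _ _ (fun l' => Finset.inter_subset_left) hl⟩
      rcases ih (fun l => X (x :: l) ∩ nbF G x) (δ * b) (U ∩ nbF G x) (by positivity)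
        (by
          intro l hl hc
          have h1 := hX (x :: l) (by simpa using hl) (hch2 l hc)
          have h2 := hgood l hl (hch2 l hc)
          refine ⟨le_trans ?_ h2, fun z hz => ?_⟩
          · exact mul_le_mul_of_nonneg_left h1.1 hδ0.le
          · exact Finset.inter_subset_left.trans (h1.2 z (by simp [hz])))
        (fun l => Finset.inter_subset_inter_right (hU _)) with ⟨K, hK, hKc⟩ | ⟨P, B, w, h1, h2, h3⟩
      · left
        refine ⟨insert x K, ?_, ?_⟩
        · exact Finset.insert_subset (hU _ hx) (hK.trans Finset.inter_subset_left)
        · refine hKc.insert fun y hy => ?_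
          have := hK hy
          simpa [mem_nbF] using (Finset.mem_inter.1 this).2
      · right
        have e : δ ^ (d + 1) * b = δ ^ d * (δ * b) := by ring
        have e2 : ∀ y, X (x :: w y) ∩ (P ∩ nbF G x) = X (x :: w y) ∩ nbF G x ∩ P := by
          intro y; ext z; simp; tauto
        refine ⟨P ∩ nbF G x, B, fun y => x :: w y, fun y => by simpa using h1 y, by rwa [e], ?_⟩
        intro y hy
        rw [e2, e]
        exact h3 y hy

/-- Delete from `Γ` the pairs `(x, y)` with `x ∈ B`, `y ∈ Y x`. -/
def stepF (Γ : SimpleGraph V) (B : Finset V) (Y : V → Finset V) : SimpleGraph V where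
  Adj x y := Γ.Adj x y ∧ ¬ (x ∈ B ∧ y ∈ Y x) ∧ ¬ (y ∈ B ∧ x ∈ Y y)
  symm := ⟨fun _ _ h => ⟨h.1.symm, h.2.2, h.2.1⟩⟩
  loopless := ⟨fun _ h => h.1.ne rfl⟩

instance codeListFinite (r : ℕ) : Finite {l : List V // l.length ≤ r} :=
  (List.finite_length_le V r).to_subtype

omit [DecidableEq V] in
theorem card_codeList (r : ℕ) [Fintype {l : List V // l.length ≤ r}] :
    Fintype.card {l : List V // l.length ≤ r} ≤ (Fintype.card V + 1) ^ r := by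
  have := Fintype.card_le_of_injective
    (fun (l : {l : List V // l.length ≤ r}) (i : Fin r) => l.1[(i : ℕ)]?) (by
      intro l l' h
      apply Subtype.ext
      apply List.ext_getElem?
      intro i
      by_cases hi : i < r
      · exact congrFun h ⟨i, hi⟩
      · rw [List.getElem?_eq_none (by have := l.2; omega),
          List.getElem?_eq_none (by have := l'.2; omega)])
  simpa using this

/-- The possible successors of a container. -/
noncomputable def succF (h r : ℕ) (Γ : SimpleGraph V) : Finset (SimpleGraph V) :=
  letI := Fintype.ofFinite {l : List V // l.length ≤ r}
  Finset.univ.image (fun p : Finset V × Finset V × (V → {l : List V // l.length ≤ r}) =>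
    stepF Γ p.2.1 (fun x => candF Γ h r Finset.univ (p.2.2 x).1 ∩ p.1))

theorem mem_succF (h r : ℕ) (Γ : SimpleGraph V) (P B : Finset V) (w : V → List V)
    (hw : ∀ x, (w x).length ≤ r) :
    stepF Γ B (fun x => candF Γ h r Finset.univ (w x) ∩ P) ∈ succF h r Γ := by
  let _ := Fintype.ofFinite {l : List V // l.length ≤ r}
  unfold succF
  exact Finset.mem_image.2 ⟨(P, B, fun x => ⟨w x, hw x⟩), Finset.mem_univ _, rfl⟩

omit [DecidableEq V] in
theorem eR_mem_and (B : Finset V) (S : V → V → Prop) :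
    eR (fun x y => x ∈ B ∧ S x y) Finset.univ Finset.univ =
      ∑ x ∈ B, ((Finset.univ.filter (fun y => S x y)).card : ℝ) := by
  unfold eR
  rw [← Finset.sum_filter_add_sum_filter_not Finset.univ (fun x => x ∈ B)]
  refine (congrArg₂ (· + ·) ?_ (Finset.sum_eq_zero ?_)).trans (add_zero _)
  · simp only [Finset.filter_mem_eq_inter, Finset.univ_inter]
    refine Finset.sum_congr rfl fun x hx => ?_
    simp [hx]
  · intro x hx
    simp only [Finset.mem_filter, Finset.mem_univ, true_and] at hx
    simp [hx]

theorem card_succF (h r : ℕ) (Γ : SimpleGraph V) :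
    (succF h r Γ).card ≤ 4 ^ Fintype.card V * (Fintype.card V + 1) ^ (r * Fintype.card V) := by
  let _ := Fintype.ofFinite {l : List V // l.length ≤ r}
  unfold succF
  refine Finset.card_image_le.trans ?_
  rw [Finset.card_univ]
  simp only [Fintype.card_prod, Fintype.card_finset, Fintype.card_fun]
  rw [show (4 : ℕ) = 2 * 2 by norm_num, mul_pow, mul_assoc, pow_mul]
  gcongr
  exact card_codeList r

/-- The containers reachable in at most `T` steps. -/
noncomputable def famF (h r : ℕ) : ℕ → Finset (SimpleGraph V)
  | 0 => {⊤}
  | T + 1 => famF h r T ∪ (famF h r T).biUnion (succF h r)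

theorem card_famF (h r T : ℕ) : (famF (V := V) h r T).card ≤
    (4 ^ Fintype.card V * (Fintype.card V + 1) ^ (r * Fintype.card V) + 1) ^ T := by
  induction T with
  | zero => simp [famF]
  | succ T ih =>
    unfold famF
    refine (Finset.card_union_le _ _).trans ?_
    have h1 : ((famF (V := V) h r T).biUnion (succF h r)).card ≤ (famF (V := V) h r T).card *
        (4 ^ Fintype.card V * (Fintype.card V + 1) ^ (r * Fintype.card V)) :=
      Finset.card_biUnion_le_card_mul _ _ _ (fun Γ _ => card_succF h r Γ)
    rw [pow_succ, Nat.mul_add, mul_one, Nat.add_comm]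
    exact Nat.add_le_add (h1.trans (Nat.mul_le_mul_right _ ih)) ih

theorem container_iter (h r : ℕ) (hh : 1 ≤ h) {δ : ℝ} (hδ0 : 0 < δ) (hδ1 : δ ≤ 1)
    (G : SimpleGraph V) (hG : G.CliqueFree (r + 1)) (T : ℕ) :
    (∃ Γ ∈ famF (V := V) h r T,
      eR (fun x y => G.Adj x y ∧ ¬ Γ.Adj x y) Finset.univ Finset.univ ≤
        2 * δ * ((Fintype.card V : ℝ) ^ 2 - eR Γ.Adj Finset.univ Finset.univ) ∧
      ∃ l : List V, l.length ≤ r ∧ ChainF (candF Γ h r Finset.univ) l ∧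
        (candF Γ h r Finset.univ l).card < h) ∨
    (∃ Γ ∈ famF (V := V) h r T,
      eR (fun x y => G.Adj x y ∧ ¬ Γ.Adj x y) Finset.univ Finset.univ ≤
        2 * δ * ((Fintype.card V : ℝ) ^ 2 - eR Γ.Adj Finset.univ Finset.univ) ∧
      eR Γ.Adj Finset.univ Finset.univ ≤ (Fintype.card V : ℝ) ^ 2 - T * (δ ^ r * h) ^ 2) := by
  induction T with
  | zero =>
    right
    refine ⟨⊤, by simp [famF], ?_, ?_⟩
    · have h1 : eR (fun x y => G.Adj x y ∧ ¬ (⊤ : SimpleGraph V).Adj x y) Finset.univ Finset.univ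
          ≤ 0 := by
        unfold eR
        refine Finset.sum_nonpos fun x _ => Finset.sum_nonpos fun y _ => ?_
        rw [if_neg]
        rintro ⟨h1, h2⟩
        exact h2 h1.ne
      have h2 := eR_le_mul (⊤ : SimpleGraph V).Adj Finset.univ Finset.univ
      rw [Finset.card_univ, ← sq] at h2
      have : 0 ≤ 2 * δ * ((Fintype.card V : ℝ) ^ 2 -
        eR (⊤ : SimpleGraph V).Adj Finset.univ Finset.univ) := by
        apply mul_nonneg <;> linarith
      linarith
    · have h2 := eR_le_mul (⊤ : SimpleGraph V).Adj Finset.univ Finset.univ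
      rw [Finset.card_univ, ← sq] at h2
      simpa using h2
  | succ T ih =>
    rcases ih with ⟨Γ, h1, h2, h3⟩ | ⟨Γ, h1, h2, h3⟩
    · left; exact ⟨Γ, by unfold famF; exact Finset.mem_union_left _ h1, h2, h3⟩
    · by_cases hpoor : ∃ l : List V, l.length ≤ r ∧ ChainF (candF Γ h r Finset.univ) l ∧
        (candF Γ h r Finset.univ l).card < h
      · left; exact ⟨Γ, by unfold famF; exact Finset.mem_union_left _ h1, h2, hpoor⟩
      · right
        push Not at hpoor
        rcases rich_step G Γ hδ0 hδ1 r (candF Γ h r Finset.univ) h Finset.univ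
          (by exact_mod_cast hh)
          (fun l hl hc => ⟨by exact_mod_cast hpoor l hl hc, candF_subset_nb Γ h l r _⟩)
          (fun l => Finset.subset_univ _) with ⟨K, _, hK⟩ | ⟨P, B, w, hw, hB, hY⟩
        · exact absurd hK (hG K)
        · set Y : V → Finset V := fun x => candF Γ h r Finset.univ (w x) ∩ P with hYdef
          refine ⟨stepF Γ B Y, ?_, ?_, ?_⟩
          · unfold famF
            refine Finset.mem_union_right _ (Finset.mem_biUnion.2 ⟨Γ, h1, ?_⟩)
            exact mem_succF h r Γ P B w hw
          all_goals
            have a1 : eR (fun x y => x ∈ B ∧ y ∈ Y x) Finset.univ Finset.univ =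
                ∑ x ∈ B, ((Y x).card : ℝ) := by
              rw [eR_mem_and]
              simp
            have a2 : eR (fun x y => (x ∈ B ∧ y ∈ Y x) ∧ G.Adj x y) Finset.univ Finset.univ =
                ∑ x ∈ B, ((Y x ∩ nbF G x).card : ℝ) := by
              simp only [and_assoc]
              rw [eR_mem_and]
              refine Finset.sum_congr rfl fun x _ => ?_
              congr 2
              ext y; simp [mem_nbF]
            have a3 : ∑ x ∈ B, ((Y x ∩ nbF G x).card : ℝ) ≤ δ * ∑ x ∈ B, ((Y x).card : ℝ) := by
              rw [Finset.mul_sum]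
              exact Finset.sum_le_sum fun x hx => (hY x hx).2.2
            have a4 : eR (fun x y => (x ∈ B ∧ y ∈ Y x)) Finset.univ Finset.univ +
                eR (stepF Γ B Y).Adj Finset.univ Finset.univ ≤
                eR Γ.Adj Finset.univ Finset.univ := by
              unfold eR
              rw [← Finset.sum_add_distrib]
              refine Finset.sum_le_sum fun x _ => ?_
              rw [← Finset.sum_add_distrib]
              refine Finset.sum_le_sum fun y _ => ?_
              by_cases c1 : x ∈ B ∧ y ∈ Y x
              · have : Γ.Adj x y := by
                  have := (hY x c1.1).1 c1.2
                  simpa [mem_nbF] using this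
                have c2 : ¬ (stepF Γ B Y).Adj x y := fun h => h.2.1 c1
                rw [if_pos c1, if_neg c2, if_pos this]; norm_num
              · by_cases c2 : (stepF Γ B Y).Adj x y
                · rw [if_neg c1, if_pos c2, if_pos c2.1]; norm_num
                · rw [if_neg c1, if_neg c2]; split_ifs <;> norm_num
            rw [a1] at a4
          · have a5 : eR (fun x y => G.Adj x y ∧ ¬ (stepF Γ B Y).Adj x y) Finset.univ Finset.univ ≤
                eR (fun x y => G.Adj x y ∧ ¬ Γ.Adj x y) Finset.univ Finset.univ +
                (eR (fun x y => (x ∈ B ∧ y ∈ Y x) ∧ G.Adj x y) Finset.univ Finset.univ +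
                  eR (fun y x => (x ∈ B ∧ y ∈ Y x) ∧ G.Adj x y) Finset.univ Finset.univ) := by
              refine (eR_or_le (R'' := fun x y => ((x ∈ B ∧ y ∈ Y x) ∧ G.Adj x y) ∨
                ((y ∈ B ∧ x ∈ Y y) ∧ G.Adj y x)) ?_).trans
                (add_le_add le_rfl (eR_or_le fun x _ y _ h => h))
              rintro x - y - ⟨b1, b2⟩
              by_cases b3 : Γ.Adj x y
              · right
                by_contra b4
                push Not at b4
                exact b2 ⟨b3, fun b5 => b4.1 b5 b1, fun b5 => b4.2 b5 b1.symm⟩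
              · exact Or.inl ⟨b1, b3⟩
            have a6 : eR (fun y x => (x ∈ B ∧ y ∈ Y x) ∧ G.Adj x y) Finset.univ Finset.univ =
                eR (fun x y => (x ∈ B ∧ y ∈ Y x) ∧ G.Adj x y) Finset.univ Finset.univ := by
              unfold eR; exact Finset.sum_comm
            rw [a6, a2] at a5
            have a7 := mul_le_mul_of_nonneg_left a4 (by linarith : 0 ≤ 2 * δ)
            nlinarith
          · have a8 : (δ ^ r * h) ^ 2 ≤ ∑ x ∈ B, ((Y x).card : ℝ) := by
              calc (δ ^ r * h) ^ 2 = (δ ^ r * h) * (δ ^ r * h) := sq _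
                _ ≤ B.card * (δ ^ r * h) := by gcongr
                _ = ∑ x ∈ B, (δ ^ r * h) := by simp
                _ ≤ _ := Finset.sum_le_sum fun x hx => (hY x hx).2.1
            push_cast
            linarith

omit [DecidableEq V] in
theorem eR_eq_edges (G : SimpleGraph V) :
    eR G.Adj Finset.univ Finset.univ = 2 * G.edgeFinset.card := by
  rw [eR_adj]
  have := G.sum_degrees_eq_twice_card_edges
  have h2 : ∀ x, G.degree x = (Finset.univ ∩ nbF G x).card := by
    intro x
    rw [← SimpleGraph.card_neighborFinset_eq_degree]
    congr 1
    ext y; simp [mem_nbF]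
  simp_rw [h2] at this
  exact_mod_cast this

/-- Counting clique-free graphs far from `r`-partite. -/
theorem container_count (h r : ℕ) (hh : 1 ≤ h) (hr : 1 ≤ r) {δ τ : ℝ} (hδ0 : 0 < δ) (hδ1 : δ ≤ 1)
    (T s M : ℕ) (hT : (Fintype.card V : ℝ) ^ 2 < T * (δ ^ r * h) ^ 2)
    (hs : δ * (Fintype.card V : ℝ) ^ 2 ≤ s)
    (hM : (1 - 1 / r) * (Fintype.card V : ℝ) ^ 2 + 8 * r * (h * Fintype.card V) - τ +
      2 * δ * (Fintype.card V : ℝ) ^ 2 ≤ 2 * M) :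
    ((Finset.univ : Finset (SimpleGraph V)).filter (fun G => G.CliqueFree (r + 1) ∧
      ∀ c : V → Fin r, τ ≤ eR (fun x y => G.Adj x y ∧ c x = c y) Finset.univ Finset.univ)).card ≤
    (4 ^ Fintype.card V * (Fintype.card V + 1) ^ (r * Fintype.card V) + 1) ^ T *
      (2 ^ M * (Fintype.card V ^ 2 + 1) ^ s) := by
  set N := Fintype.card V with hN
  have hsub : ((Finset.univ : Finset (SimpleGraph V)).filter (fun G => G.CliqueFree (r + 1) ∧
      ∀ c : V → Fin r, τ ≤ eR (fun x y => G.Adj x y ∧ c x = c y) Finset.univ Finset.univ)) ⊆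
      (famF (V := V) h r T).biUnion (fun Γ => Finset.univ.filter (fun G =>
        Γ.edgeFinset.card ≤ M ∧ (G.edgeFinset \ Γ.edgeFinset).card ≤ s)) := by
    intro G hG
    simp only [Finset.mem_filter, Finset.mem_univ, true_and, Finset.mem_biUnion] at hG ⊢
    rcases container_iter h r hh hδ0 hδ1 G hG.1 T with ⟨Γ, h1, h2, l, h3, h4, h5⟩ | ⟨Γ, h1, h2, h3⟩
    · have hnn := eR_nonneg Γ.Adj Finset.univ Finset.univ
      have h6 : eR (fun x y => G.Adj x y ∧ ¬ Γ.Adj x y) Finset.univ Finset.univ ≤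
          2 * δ * (N : ℝ) ^ 2 := by
        refine h2.trans ?_
        apply mul_le_mul_of_nonneg_left _ (by linarith)
        linarith
      refine ⟨Γ, h1, ?_, ?_⟩
      · obtain ⟨c, hc⟩ := furedi Γ h l r hr h3 h4 h5
        have h7 := hG.2 c
        have h8 : eR (fun x y => G.Adj x y ∧ c x = c y) Finset.univ Finset.univ ≤
            eR (fun x y => Γ.Adj x y ∧ c x = c y) Finset.univ Finset.univ +
            eR (fun x y => G.Adj x y ∧ ¬ Γ.Adj x y) Finset.univ Finset.univ :=
          eR_or_le (fun x _ y _ h => by tauto)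
        rw [eR_eq_edges] at hc
        have : (2 : ℝ) * Γ.edgeFinset.card ≤ 2 * M := by linarith
        have h9 : (Γ.edgeFinset.card : ℝ) ≤ M := by linarith
        exact_mod_cast h9
      · have h7 : eR (fun x y => G.Adj x y ∧ ¬ Γ.Adj x y) Finset.univ Finset.univ =
          2 * (G.edgeFinset \ Γ.edgeFinset).card := by
          have e : eR (fun x y => G.Adj x y ∧ ¬ Γ.Adj x y) Finset.univ Finset.univ =
            eR (G \ Γ).Adj Finset.univ Finset.univ := eR_congr fun x _ y _ => by
              rw [SimpleGraph.sdiff_adj]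
          rw [e, eR_eq_edges]
          congr 2
          congr 1
          ext e
          simp
        have h8 : ((G.edgeFinset \ Γ.edgeFinset).card : ℝ) ≤ s := by linarith
        exact_mod_cast h8
    · exfalso
      have := eR_nonneg Γ.Adj Finset.univ Finset.univ
      linarith
  refine (Finset.card_le_card hsub).trans ?_
  refine (Finset.card_biUnion_le_card_mul _ _ (2 ^ M * (N ^ 2 + 1) ^ s) ?_).trans
    (Nat.mul_le_mul_right _ (card_famF h r T))
  intro Γ _
  by_cases hΓ : Γ.edgeFinset.card ≤ M
  · have hmap : (Finset.univ.filter (fun G : SimpleGraph V =>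
        Γ.edgeFinset.card ≤ M ∧ (G.edgeFinset \ Γ.edgeFinset).card ≤ s)).card ≤
        (Γ.edgeFinset.powerset ×ˢ ((Finset.range (s + 1)).biUnion
          (fun i => (⊤ : SimpleGraph V).edgeFinset.powersetCard i))).card := by
      refine Finset.card_le_card_of_injOn
        (fun G => (G.edgeFinset ∩ Γ.edgeFinset, G.edgeFinset \ Γ.edgeFinset)) ?_ ?_
      · intro G hG
        simp only [Finset.coe_filter, Set.mem_ofPred_eq, Finset.mem_univ, true_and] at hG
        simp only [Finset.coe_product, Set.mem_prod, Finset.mem_coe, Finset.mem_powerset,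
          Finset.mem_biUnion, Finset.mem_range, Finset.mem_powersetCard]
        refine ⟨Finset.inter_subset_right, _, by have := hG.2; omega, ?_, rfl⟩
        refine Finset.sdiff_subset.trans ?_
        rw [SimpleGraph.edgeFinset_subset_edgeFinset]
        exact le_top
      · intro G _ G' _ hGG
        simp only [Prod.mk.injEq] at hGG
        have : G.edgeFinset = G'.edgeFinset := by
          rw [← Finset.sdiff_union_inter G.edgeFinset Γ.edgeFinset, hGG.1, hGG.2,
            Finset.sdiff_union_inter]
        exact SimpleGraph.edgeFinset_inj.1 this
    refine hmap.trans ?_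
    rw [Finset.card_product, Finset.card_powerset]
    refine Nat.mul_le_mul (Nat.pow_le_pow_right (by norm_num) hΓ) ?_
    refine Finset.card_biUnion_le.trans ?_
    simp only [Finset.card_powersetCard]
    refine (sum_choose_le_pow _ s).trans ?_
    gcongr
    rw [SimpleGraph.card_edgeFinset_top_eq_card_choose_two]
    exact Nat.choose_le_pow _ _
  · have : (Finset.univ.filter (fun G : SimpleGraph V =>
        Γ.edgeFinset.card ≤ M ∧ (G.edgeFinset \ Γ.edgeFinset).card ≤ s)) = ∅ := by
      simp [hΓ]
    rw [this]; simp

end Container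

theorem eR_self_eq {n : ℕ} (G : SimpleGraph (Fin n)) (A : Finset (Fin n)) :
    eR G.Adj A A = 2 * edgesIn G A := by
  let H : SimpleGraph (Fin n) :=
    { Adj := fun x y => G.Adj x y ∧ x ∈ A ∧ y ∈ A
      symm := ⟨fun _ _ h => ⟨h.1.symm, h.2.2, h.2.1⟩⟩
      loopless := ⟨fun _ h => h.1.ne rfl⟩ }
  have h1 : eR G.Adj A A = eR H.Adj Finset.univ Finset.univ := by
    have e1 : eR H.Adj Finset.univ Finset.univ = eR H.Adj A A := by
      have z : ∀ X Y : Finset (Fin n), (∀ x ∈ X, ∀ y ∈ Y, ¬ H.Adj x y) → eR H.Adj X Y = 0 := by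
        intro X Y hXY
        unfold eR
        exact Finset.sum_eq_zero fun x hx => Finset.sum_eq_zero fun y hy => by simp [hXY x hx y hy]
      rw [eR_split_left _ Finset.univ A, Finset.univ_inter, eR_split_right _ A Finset.univ A,
        Finset.univ_inter, z A (Finset.univ \ A), z (Finset.univ \ A)]
      · ring
      · intro x hx y _ h; simp at hx; exact hx h.2.1
      · intro x _ y hy h; simp at hy; exact hy h.2.2
    rw [e1]
    exact eR_congr fun x hx y hy => ⟨fun h => ⟨h, hx, hy⟩, fun h => h.1⟩
  rw [h1, eR_eq_edges, edgesIn_eq]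
  congr 3
  ext e
  induction e with
  | _ a b =>
    simp only [SimpleGraph.mem_edgeFinset, SimpleGraph.mem_edgeSet, tr, Finset.mem_filter,
      mk_mem_prs]
    constructor
    · intro h; exact ⟨⟨h.1.ne, h.2.1, h.2.2⟩, h.1⟩
    · intro h; exact ⟨h.2, h.1.2.1, h.1.2.2⟩

theorem eR_color_eq {n r : ℕ} (G : SimpleGraph (Fin n)) (S : Finset (Fin n)) (c : Fin n → Fin r) :
    eR (fun x y => G.Adj x y ∧ c x = c y) S S =
      2 * ((∑ i, edgesIn G (S.filter (fun x => c x = i)) : ℕ) : ℝ) := by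
  push_cast
  rw [Finset.mul_sum]
  simp_rw [← eR_self_eq]
  unfold eR
  rw [← Finset.sum_fiberwise S c]
  refine Finset.sum_congr rfl fun i _ => Finset.sum_congr rfl fun x hx => ?_
  rw [Finset.sum_filter]
  refine Finset.sum_congr rfl fun y _ => ?_
  have hxi : c x = i := (Finset.mem_filter.1 hx).2
  by_cases h : c y = i
  · simp [h, hxi]
  · have : ¬ (i = c y) := fun h' => h h'.symm
    simp [h, hxi, this]

theorem tr_subset {n : ℕ} (G : SimpleGraph (Fin n)) (D : Finset (Sym2 (Fin n))) :
    tr G D ⊆ D :=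
  Finset.filter_subset _ _

theorem grPr_induce_le {n : ℕ} (S : Finset (Fin n))
    (F : Finset (SimpleGraph (S : Set (Fin n)))) :
    grPr n {G | G.induce (S : Set (Fin n)) ∈ F} ≤ F.card * (1 / 2 : ℝ) ^ (S.card.choose 2) := by
  have h1 := grPr_iUnion_le (n := n) F
    (fun H => {G | tr G (prs S) = tr H.spanningCoe (prs S)})
    {G | G.induce (S : Set (Fin n)) ∈ F} (by
      intro G hG
      refine ⟨_, hG, ?_⟩
      simp only [Set.mem_ofPred_eq, tr]
      ext e
      simp only [Finset.mem_filter]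
      refine and_congr_right fun he => ?_
      induction e with
      | _ a b =>
        rw [mk_mem_prs] at he
        simp [he.2.1, he.2.2])
  refine h1.trans ?_
  calc _ = ∑ H ∈ F, (1 / 2 : ℝ) ^ (S.card.choose 2) := by
        refine Finset.sum_congr rfl fun H _ => ?_
        rw [grPr_pattern (prs_not_isDiag S) (tr_subset _ _),
          card_prs]
    _ ≤ _ := by simp

theorem eR_induce {n r : ℕ} (G : SimpleGraph (Fin n)) (S : Finset (Fin n)) (c : Fin n → Fin r) :
    eR (fun x y => (G.induce (S : Set (Fin n))).Adj x y ∧ c x.1 = c y.1) Finset.univ Finset.univ =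
      eR (fun x y => G.Adj x y ∧ c x = c y) S S := by
  unfold eR
  rw [Finset.sum_subtype S (p := fun x => x ∈ (S : Set (Fin n))) (by simp)]
  refine Finset.sum_congr rfl fun x _ => ?_
  rw [Finset.sum_subtype S (p := fun x => x ∈ (S : Set (Fin n))) (by simp)]
  refine Finset.sum_congr rfl fun y _ => ?_
  simp

theorem grPr_stab {n : ℕ} (S : Finset (Fin n)) (h r : ℕ) (hh : 1 ≤ h) (hr : 1 ≤ r) {δ : ℝ}
    (hδ0 : 0 < δ) (hδ1 : δ ≤ 1) (T s M t : ℕ) (hT : (S.card : ℝ) ^ 2 < T * (δ ^ r * h) ^ 2)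
    (hs : δ * (S.card : ℝ) ^ 2 ≤ s)
    (hM : (1 - 1 / r) * (S.card : ℝ) ^ 2 + 8 * r * (h * S.card) - 2 * t +
      2 * δ * (S.card : ℝ) ^ 2 ≤ 2 * M) :
    grPr n {G | G.CliqueFreeOn (S : Set (Fin n)) (r + 1) ∧ ∀ c : Fin n → Fin r,
      t ≤ ∑ i, edgesIn G (S.filter (fun x => c x = i))} ≤
    ((4 ^ S.card * (S.card + 1) ^ (r * S.card) + 1) ^ T * (2 ^ M * (S.card ^ 2 + 1) ^ s) : ℝ) *
      (1 / 2 : ℝ) ^ (S.card.choose 2) := by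
  have hc : Fintype.card (S : Set (Fin n)) = S.card := by simp
  have h1 := container_count (V := (S : Set (Fin n))) h r hh hr (τ := 2 * t) hδ0 hδ1 T s M
    (by rw [hc]; exact hT) (by rw [hc]; exact hs) (by rw [hc]; exact hM)
  rw [hc] at h1
  have h2 : (((Finset.univ : Finset (SimpleGraph (S : Set (Fin n)))).filter (fun G =>
      G.CliqueFree (r + 1) ∧ ∀ c : ↥(S : Set (Fin n)) → Fin r, (2 * t : ℝ) ≤
        eR (fun x y => G.Adj x y ∧ c x = c y) Finset.univ Finset.univ)).card : ℝ) ≤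
    ((4 ^ S.card * (S.card + 1) ^ (r * S.card) + 1) ^ T * (2 ^ M * (S.card ^ 2 + 1) ^ s) : ℝ) := by
    exact_mod_cast h1
  refine (grPr_mono ?_).trans ((grPr_induce_le S _).trans
    (mul_le_mul_of_nonneg_right h2 (by positivity)))
  rintro G ⟨hG1, hG2⟩
  simp only [Set.mem_ofPred_eq, Finset.mem_filter, Finset.mem_univ, true_and]
  refine ⟨by rwa [SimpleGraph.cliqueFree_induce_iff], fun c => ?_⟩
  let c' : Fin n → Fin r := fun x => if hx : x ∈ (S : Set (Fin n)) then c ⟨x, hx⟩ else ⟨0, hr⟩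
  have e : eR (fun x y => (G.induce (S : Set (Fin n))).Adj x y ∧ c x = c y)
      Finset.univ Finset.univ =
      eR (fun x y => (G.induce (S : Set (Fin n))).Adj x y ∧ c' x.1 = c' y.1)
      Finset.univ Finset.univ := eR_congr fun x _ y _ => by
    have hx : c' x.1 = c x := by simp only [c', x.2, dif_pos]
    have hy : c' y.1 = c y := by simp only [c', y.2, dif_pos]
    rw [hx, hy]
  rw [e, eR_induce, eR_color_eq]
  have := hG2 c'
  have h3 : ((t : ℕ) : ℝ) ≤ ((∑ i, edgesIn G (S.filter (fun x => c' x = i)) : ℕ) : ℝ) := by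
    exact_mod_cast this
  linarith

/-- Expectation over `G_{n,1/2}`. -/
noncomputable def grEx (n : ℕ) (f : SimpleGraph (Fin n) → ℝ) : ℝ :=
  (∑ G, f G) / (Fintype.card (SimpleGraph (Fin n)) : ℝ)

/-- Indicator of an event. -/
noncomputable def grInd {n : ℕ} (S : Set (SimpleGraph (Fin n))) (G : SimpleGraph (Fin n)) : ℝ :=
  if G ∈ S then 1 else 0

theorem grEx_indicator {n : ℕ} (S : Set (SimpleGraph (Fin n))) :
    grEx n (fun G => grInd S G) = grPr n S := by
  rw [grPr_eq]; unfold grEx grInd; simp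

theorem grEx_sum {n : ℕ} {ι : Type*} (s : Finset ι) (f : ι → SimpleGraph (Fin n) → ℝ) :
    grEx n (fun G => ∑ i ∈ s, f i G) = ∑ i ∈ s, grEx n (f i) := by
  unfold grEx
  rw [Finset.sum_comm, Finset.sum_div]

theorem grEx_mono {n : ℕ} {f g : SimpleGraph (Fin n) → ℝ} (h : ∀ G, f G ≤ g G) :
    grEx n f ≤ grEx n g := by
  unfold grEx
  gcongr
  exact h _

theorem grPr_disjoint_bound {n K : ℕ} (μ : ℕ) {A B : Finset (Fin n)} (hA : A.card = K)
    (hB : B.card = K) :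
    grPr n ({G | edgesIn G A = μ} ∩ {G | edgesIn G B = μ}) ≤
      ((K.choose 2).choose μ * (1 / 2 : ℝ) ^ (K.choose 2)) * 
      (((K.choose 2 : ℝ) + 1) ^ μ * (1 / 2 : ℝ) ^ (K.choose 2 - ((A ∩ B).card).choose 2)) := by
  have h1 : ({G | edgesIn G A = μ} ∩ {G | edgesIn G B = μ} : Set (SimpleGraph (Fin n))) ⊆
      {G | (tr G (prs A)).card = μ} ∩ {G | (tr G (prs B \ prs A)).card ≤ μ} := by
    rintro G ⟨h1, h2⟩
    simp only [Set.mem_ofPred_eq, edgesIn_eq] at h1 h2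
    refine ⟨h1, ?_⟩
    simp only [Set.mem_ofPred_eq]
    rw [← h2]
    apply Finset.card_le_card
    intro e he
    simp only [tr, Finset.mem_filter, Finset.mem_sdiff] at he ⊢
    tauto
  refine (grPr_mono h1).trans ?_
  rw [grPr_inter_of_depOn (depOn_tr (prs A) (fun X => X.card = μ))
    (depOn_tr (prs B \ prs A) (fun X => X.card ≤ μ))
    (by rw [Finset.disjoint_coe]; exact Finset.disjoint_sdiff)]
  rw [grPr_card_eq (prs_not_isDiag A), card_prs, hA]
  refine mul_le_mul_of_nonneg_left ?_ (by positivity)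
  refine (grPr_card_le (fun e he => prs_not_isDiag B e (Finset.mem_sdiff.1 he).1) μ).trans ?_
  have hi : prs A ∩ prs B = prs (A ∩ B) := by
    ext e
    simp only [Finset.mem_inter, mem_prs]
    constructor
    · rintro ⟨⟨a, b⟩, _, c⟩; exact ⟨a, fun v hv => ⟨b v hv, c v hv⟩⟩
    · rintro ⟨a, b⟩; exact ⟨⟨a, fun v hv => (b v hv).1⟩, a, fun v hv => (b v hv).2⟩
  have hc : (prs B \ prs A).card = K.choose 2 - ((A ∩ B).card).choose 2 := by
    rw [Finset.card_sdiff, hi, card_prs, card_prs, hB]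
  rw [hc]
  gcongr
  exact_mod_cast Nat.sub_le _ _

theorem card_inter_eq_le {n K : ℕ} (l : ℕ) {A : Finset (Fin n)} (hA : A.card = K) :
    (((Finset.univ : Finset (Fin n)).powersetCard K).filter
      (fun B => (A ∩ B).card = l)).card ≤ K.choose l * n.choose (K - l) := by
  calc _ ≤ (A.powersetCard l ×ˢ (Finset.univ : Finset (Fin n)).powersetCard (K - l)).card := by
        refine Finset.card_le_card_of_injOn (fun B => (A ∩ B, B \ A)) ?_ ?_
        · intro B hB
          simp only [Finset.coe_filter, Finset.mem_powersetCard, Finset.subset_univ, true_and,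
            Set.mem_ofPred_eq] at hB
          simp only [Finset.coe_product, Set.mem_prod, Finset.mem_coe, Finset.mem_powersetCard,
            Finset.subset_univ, true_and]
          refine ⟨⟨Finset.inter_subset_left, hB.2⟩, ?_⟩
          rw [Finset.card_sdiff, hB.1, hB.2]
        · intro B _ B' _ h
          simp only [Prod.mk.injEq] at h
          rw [← Finset.sdiff_union_inter B A, h.2, Finset.inter_comm B A, h.1,
            Finset.inter_comm A B', Finset.sdiff_union_inter]
    _ = _ := by simp [Finset.card_product, hA]

theorem second_moment {n K μ ξ : ℕ} {E : ℝ}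
    (hE : E = n.choose K * ((K.choose 2).choose μ * (1 / 2 : ℝ) ^ (K.choose 2)))
    (hE0 : 0 < E) (hξ : (ξ : ℝ) ≤ E / 2) :
    grPr n {G | numZ n K μ G < ξ} ≤ 4 / E * (1 + ∑ l ∈ Finset.Ico 2 K,
      (K.choose l * n.choose (K - l) : ℝ) *
      (((K.choose 2 : ℝ) + 1) ^ μ * (1 / 2 : ℝ) ^ (K.choose 2 - l.choose 2))) := by
  set P := (Finset.univ : Finset (Fin n)).powersetCard K with hP
  set p : ℝ := (K.choose 2).choose μ * (1 / 2 : ℝ) ^ (K.choose 2) with hp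
  set q : ℕ → ℝ := fun l => ((K.choose 2 : ℝ) + 1) ^ μ * (1 / 2 : ℝ) ^ (K.choose 2 - l.choose 2)
    with hq
  have hp0 : 0 ≤ p := by positivity
  have hq0 : ∀ l, 0 ≤ q l := fun l => by positivity
  have hPc : (P.card : ℝ) = n.choose K := by simp [hP]
  have hcard : ∀ A ∈ P, A.card = K := fun A hA => (Finset.mem_powersetCard.1 hA).2
  have hone : ∀ A ∈ P, grPr n {G | edgesIn G A = μ} = p := by
    intro A hA
    simp only [edgesIn_eq]
    rw [grPr_card_eq (prs_not_isDiag A), card_prs, hcard A hA]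
  set Z : SimpleGraph (Fin n) → ℝ := fun G => ∑ A ∈ P, grInd {G | edgesIn G A = μ} G
    with hZ
  have hZn : ∀ G, Z G = numZ n K μ G := by
    intro G
    simp only [hZ, grInd, numZ, Set.mem_ofPred_eq, hP]
    rw [Finset.card_filter, Nat.cast_sum]
    exact Finset.sum_congr rfl fun A _ => by split_ifs <;> simp
  have hEZ : grEx n Z = E := by
    rw [hZ, grEx_sum]
    simp only [grEx_indicator]
    rw [Finset.sum_congr rfl hone, Finset.sum_const, nsmul_eq_mul, hPc, hE]
  have hEZ2 : grEx n (fun G => Z G ^ 2) ≤ E ^ 2 + E * (1 + ∑ l ∈ Finset.Ico 2 K,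
      (K.choose l * n.choose (K - l) : ℝ) * q l) := by
    have h1 : (fun G => Z G ^ 2) = fun G => ∑ A ∈ P, ∑ B ∈ P,
        grInd ({G | edgesIn G A = μ} ∩ {G | edgesIn G B = μ}) G := by
      funext G
      rw [sq, hZ, Finset.sum_mul_sum]
      refine Finset.sum_congr rfl fun A _ => Finset.sum_congr rfl fun B _ => ?_
      by_cases c1 : edgesIn G A = μ <;> by_cases c2 : edgesIn G B = μ <;> simp [grInd, c1, c2]
    rw [h1, grEx_sum]
    have h2 : ∀ A ∈ P, grEx n (fun G => ∑ B ∈ P,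
        grInd ({G | edgesIn G A = μ} ∩ {G | edgesIn G B = μ}) G) ≤
        n.choose K * p ^ 2 + p * (1 + ∑ l ∈ Finset.Ico 2 K,
          (K.choose l * n.choose (K - l) : ℝ) * q l) := by
      intro A hA
      rw [grEx_sum]
      simp only [grEx_indicator]
      have h3 : ∀ B ∈ P, grPr n ({G | edgesIn G A = μ} ∩ {G | edgesIn G B = μ}) ≤
          p ^ 2 + ((if B = A then p else 0) + p * (∑ l ∈ Finset.Ico 2 K,
            if (A ∩ B).card = l then q l else 0)) := by
        intro B hB
        have hs0 : 0 ≤ p * (∑ l ∈ Finset.Ico 2 K, if (A ∩ B).card = l then q l else 0) :=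
          mul_nonneg hp0 (Finset.sum_nonneg fun l _ => by split_ifs; exacts [hq0 l, le_rfl])
        by_cases c1 : B = A
        · have := grPr_mono (n := n) (Set.inter_subset_left :
            ({G | edgesIn G A = μ} ∩ {G | edgesIn G B = μ} : Set (SimpleGraph (Fin n))) ⊆ _)
          rw [hone A hA] at this
          rw [if_pos c1]
          nlinarith [sq_nonneg p]
        · rw [if_neg c1]
          by_cases c2 : (A ∩ B).card < 2
          · have hd : Disjoint (prs A : Set (Sym2 (Fin n))) (prs B : Set (Sym2 (Fin n))) := by
              rw [Finset.disjoint_coe, Finset.disjoint_left]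
              intro e
              induction e with
              | _ a b =>
                rw [mk_mem_prs, mk_mem_prs]
                rintro ⟨h1, h2, h3⟩ ⟨_, h4, h5⟩
                have : 1 < (A ∩ B).card := Finset.one_lt_card.2 ⟨a, by simp [h2, h4], b,
                  by simp [h3, h5], h1⟩
                omega
            have h4 := grPr_inter_of_depOn (depOn_tr (prs A) (fun X => X.card = μ))
              (depOn_tr (prs B) (fun X => X.card = μ)) hd
            simp only [← edgesIn_eq] at h4
            rw [h4, hone A hA, hone B hB]
            nlinarith
          · have hlt : (A ∩ B).card < K := by
              by_contra c3
              push Not at c3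
              have e1 : A ∩ B = A := Finset.eq_of_subset_of_card_le Finset.inter_subset_left
                (by rw [hcard A hA]; exact c3)
              have e2 : A ∩ B = B := Finset.eq_of_subset_of_card_le Finset.inter_subset_right
                (by rw [hcard B hB]; exact c3)
              exact c1 (e2.symm.trans e1)
            have h5 := grPr_disjoint_bound μ (hcard A hA) (hcard B hB)
            have h6 : (∑ l ∈ Finset.Ico 2 K, if (A ∩ B).card = l then q l else 0) =
                q (A ∩ B).card := by
              rw [Finset.sum_ite_eq, if_pos]
              simp; omega
            rw [h6]
            have h7 := sq_nonneg p
            linarith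
      refine (Finset.sum_le_sum h3).trans ?_
      rw [Finset.sum_add_distrib, Finset.sum_add_distrib, Finset.sum_const, nsmul_eq_mul, hPc,
        Finset.sum_ite_eq', if_pos hA, ← Finset.mul_sum, mul_add, mul_one]
      have h8 : (∑ B ∈ P, ∑ l ∈ Finset.Ico 2 K, if (A ∩ B).card = l then q l else 0) ≤
          ∑ l ∈ Finset.Ico 2 K, (K.choose l * n.choose (K - l) : ℝ) * q l := by
        rw [Finset.sum_comm]
        refine Finset.sum_le_sum fun l _ => ?_
        rw [← Finset.sum_filter, Finset.sum_const, nsmul_eq_mul]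
        refine mul_le_mul_of_nonneg_right ?_ (hq0 l)
        exact_mod_cast card_inter_eq_le l (hcard A hA)
      have h9 := mul_le_mul_of_nonneg_left h8 hp0
      linarith
    refine (Finset.sum_le_sum h2).trans ?_
    rw [Finset.sum_const, nsmul_eq_mul, hPc, hE]
    apply le_of_eq
    ring
  have hch : grPr n {G | numZ n K μ G < ξ} ≤ 4 / E ^ 2 * (grEx n (fun G => Z G ^ 2) - E ^ 2) := by
    rw [← grEx_indicator]
    have h1 : ∀ G : SimpleGraph (Fin n), grInd {G | numZ n K μ G < ξ} G ≤
        4 / E ^ 2 * (Z G ^ 2 - 2 * E * Z G + E ^ 2) := by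
      intro G
      have hsq : Z G ^ 2 - 2 * E * Z G + E ^ 2 = (E - Z G) ^ 2 := by ring
      rw [hsq]
      unfold grInd
      split_ifs with h
      · simp only [Set.mem_ofPred_eq] at h
        have h2 : Z G ≤ E / 2 := by
          rw [hZn]
          have : (numZ n K μ G : ℝ) ≤ ξ := by exact_mod_cast h.le
          linarith
        have h3 : (E / 2) ^ 2 ≤ (E - Z G) ^ 2 := by
          apply pow_le_pow_left₀ (by positivity); linarith
        calc (1 : ℝ) = 4 / E ^ 2 * (E / 2) ^ 2 := by field_simp; norm_num
          _ ≤ _ := by gcongr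
      · positivity
    refine (grEx_mono h1).trans (le_of_eq ?_)
    have h2 : ∑ G, Z G = E * (Fintype.card (SimpleGraph (Fin n)) : ℝ) := by
      have := hEZ
      unfold grEx at this
      rwa [div_eq_iff (grPr_card_pos n).ne'] at this
    have hpos := grPr_card_pos n
    unfold grEx
    rw [← Finset.mul_sum, Finset.sum_add_distrib, Finset.sum_sub_distrib, ← Finset.mul_sum, h2,
      Finset.sum_const, nsmul_eq_mul, Finset.card_univ]
    field_simp
    ring
  refine hch.trans ?_
  calc 4 / E ^ 2 * (grEx n (fun G => Z G ^ 2) - E ^ 2) ≤ 4 / E ^ 2 * (E * (1 + ∑ l ∈ Finset.Ico 2 K,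
      (K.choose l * n.choose (K - l) : ℝ) * q l)) := by
        gcongr; linarith
    _ = _ := by simp only [hq]; rw [← mul_assoc]; congr 1; field_simp

/-- The asymptotic regime: `x = log n`, `l = log log n`. -/
structure Reg (n k r j : ℕ) (l x : ℝ) : Prop where
  hx : x = Real.exp l
  hn : (n : ℝ) = Real.exp x
  hk1 : 2 * x - l ^ 2 ≤ k * Real.log 2
  hk2 : k * Real.log 2 ≤ 2 * x + l ^ 2
  hr : 1 ≤ r
  hrl : (r : ℝ) ≤ l
  hj : 1 ≤ j
  hjr : j ≤ r
  hL : 1000 ≤ l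
  hLx : l ^ 200 ≤ Real.exp (l / 100)
  hrx : l ^ (60 * r) ≤ Real.exp (l / 100)

namespace Reg
variable {n k r j : ℕ} {l x : ℝ}

theorem w_pow (R : Reg n k r j l x) : Real.exp (l / 100) ^ 100 = x := by
  rw [← Real.exp_nat_mul, R.hx]; congr 1; push_cast; ring

theorem one_le_w (R : Reg n k r j l x) : 1 ≤ Real.exp (l / 100) := by
  have := R.hL
  exact Real.one_le_exp (by positivity)

theorem w_le (R : Reg n k r j l x) : Real.exp (l / 100) ≤ x := by
  rw [← R.w_pow]
  exact le_self_pow₀ R.one_le_w (by norm_num)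

theorem pow_le_w (R : Reg n k r j l x) {p : ℕ} (hp : p ≤ 190) :
    10 ^ 30 * l ^ p ≤ Real.exp (l / 100) := by
  have := R.hL
  calc 10 ^ 30 * l ^ p = 1000 ^ 10 * l ^ p := by norm_num
    _ ≤ l ^ 10 * l ^ 190 := by
        gcongr
        · linarith
    _ = l ^ 200 := by ring
    _ ≤ _ := R.hLx

theorem pow_le (R : Reg n k r j l x) {p : ℕ} (hp : p ≤ 190) :
    10 ^ 30 * l ^ p ≤ x := (R.pow_le_w hp).trans R.w_le

theorem x_pos (R : Reg n k r j l x) : 0 < x := by rw [R.hx]; positivity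

theorem l_pos (R : Reg n k r j l x) : 0 < l := by linarith [R.hL]

theorem x_big (R : Reg n k r j l x) : 10 ^ 30 ≤ x := by
  have := R.pow_le (p := 0) (by norm_num); simpa using this

theorem k_lb (R : Reg n k r j l x) : 2.885 * x ≤ k := by
  have h1 := R.hk1
  have h2 := R.pow_le (p := 2) (by norm_num)
  have h3 := Real.log_two_lt_d9
  have h4 := Real.log_two_gt_d9
  have h5 := R.x_pos
  have h6 := R.l_pos
  nlinarith [pow_pos h6 2]

theorem k_ub (R : Reg n k r j l x) : (k : ℝ) ≤ 2.886 * x := by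
  have h1 := R.hk2
  have h2 := R.pow_le (p := 2) (by norm_num)
  have h3 := Real.log_two_lt_d9
  have h4 := Real.log_two_gt_d9
  have h5 := R.x_pos
  have h6 := R.l_pos
  nlinarith [pow_pos h6 2]

theorem n_big (R : Reg n k r j l x) : x ^ 2 / 2 ≤ n := by
  rw [R.hn]
  have := Real.quadratic_le_exp_of_nonneg R.x_pos.le
  linarith [R.x_pos]

theorem exp_l (R : Reg n k r j l x) : Real.exp l = x := R.hx.symm

theorem x_le_n (R : Reg n k r j l x) : 10 ^ 20 * x ≤ n := by
  have := R.n_big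
  have := R.x_big
  nlinarith

theorem xi_le (R : Reg n k r j l x) : xiD r j ≤ r := by
  unfold xiD muD
  have h1 := Nat.div_mul_le_self (r - j) j
  have h2 := R.hjr
  rw [mul_add, mul_comm]
  omega

end Reg

theorem muD_le (r j : ℕ) : muD r j ≤ r :=
  (Nat.div_le_self _ _).trans (Nat.sub_le _ _)

theorem half_pow_eq (m : ℕ) : (1 / 2 : ℝ) ^ m = Real.exp (-(m * Real.log 2)) := by
  rw [Real.exp_neg, Real.exp_nat_mul, Real.exp_log (by norm_num), one_div, inv_pow]

theorem two_pow_eq (m : ℕ) : (2 : ℝ) ^ m = Real.exp (m * Real.log 2) := by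
  rw [Real.exp_nat_mul, Real.exp_log (by norm_num)]

theorem choose_sub_mul_le {n K : ℕ} (l : ℕ) (hl : l ≤ K) :
    n.choose (K - l) * (n - K) ^ l ≤ n.choose K * K ^ l := by
  induction l with
  | zero => simp
  | succ l ih =>
    have h1 := Nat.choose_succ_right_eq n (K - (l + 1))
    rw [show K - (l + 1) + 1 = K - l by omega] at h1
    calc n.choose (K - (l + 1)) * (n - K) ^ (l + 1)
        = n.choose (K - (l + 1)) * (n - K) * (n - K) ^ l := by ring
      _ ≤ n.choose (K - (l + 1)) * (n - (K - (l + 1))) * (n - K) ^ l := by gcongr; omega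
      _ = (K - l) * (n.choose (K - l) * (n - K) ^ l) := by rw [← h1]; ring
      _ ≤ K * (n.choose K * K ^ l) := Nat.mul_le_mul (by omega) (ih (by omega))
      _ = _ := by ring

theorem choose_two_real (m : ℕ) : (m.choose 2 : ℝ) = m * (m - 1) / 2 := by
  rw [Nat.cast_choose_two]

namespace Reg
variable {n k r j : ℕ} {l x : ℝ}

theorem exp_neg_le (R : Reg n k r j l x) {c : ℝ} (hc : 0.1 ≤ c) : Real.exp (-(c * x)) ≤ 1 / x ^ 9 := by
  rw [Real.exp_neg, one_div]
  have hx := R.x_pos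
  gcongr
  have h1 : x ^ 9 = Real.exp (9 * l) := by
    rw [R.hx, ← Real.exp_nat_mul]; norm_num
  rw [h1]
  apply Real.exp_le_exp.2
  have := R.pow_le (p := 1) (by norm_num)
  have := R.l_pos
  nlinarith

theorem K2_le (R : Reg n k r j l x) : (((k + 1).choose 2 : ℕ) : ℝ) + 1 ≤ Real.exp (3 * l) := by
  have h1 : Real.exp (3 * l) = x ^ 3 := by rw [R.hx, ← Real.exp_nat_mul]; norm_num
  rw [h1, choose_two_real]
  have := R.k_ub
  have := R.x_big
  have hk : (0 : ℝ) ≤ k := by positivity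
  push_cast
  nlinarith [pow_pos R.x_pos 2, pow_pos R.x_pos 3]

theorem K2mu_le (R : Reg n k r j l x) :
    ((((k + 1).choose 2 : ℕ) : ℝ) + 1) ^ muD r j ≤ Real.exp (3 * l ^ 2) := by
  have h3 : (muD r j : ℝ) ≤ l := le_trans (by exact_mod_cast muD_le r j) R.hrl
  calc _ ≤ (Real.exp (3 * l)) ^ muD r j := by gcongr; exact R.K2_le
    _ = Real.exp (muD r j * (3 * l)) := by rw [← Real.exp_nat_mul]
    _ ≤ _ := by
      apply Real.exp_le_exp.2
      have := R.l_pos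
      nlinarith

theorem K_lt_n (R : Reg n k r j l x) : k + 1 ≤ n := by
  have h1 := R.k_ub
  have h2 := R.x_le_n
  have h3 := R.x_big
  have : ((k + 1 : ℕ) : ℝ) ≤ n := by push_cast; nlinarith
  exact_mod_cast this

set_option maxHeartbeats 1000000 in
theorem term_small (R : Reg n k r j l x) {E : ℝ}
    (hE : E = n.choose (k + 1) *
      (((k + 1).choose 2).choose (muD r j) * (1 / 2 : ℝ) ^ ((k + 1).choose 2)))
    (hE1 : 1 ≤ E) {i : ℕ} (hi2 : 2 ≤ i) (hiK : i < k + 1) :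
    ((k + 1).choose i * n.choose (k + 1 - i) : ℝ) *
      ((((k + 1).choose 2 : ℝ) + 1) ^ (muD r j) * (1 / 2 : ℝ) ^ ((k + 1).choose 2 - i.choose 2)) ≤
    Real.exp (-(0.4 * x)) * E := by
  have hl := R.l_pos
  have hx := R.x_pos
  have hk0 : (0 : ℝ) ≤ k := by positivity
  have hkub := R.k_ub
  have hl1 := R.pow_le (p := 1) (by norm_num)
  have hl2 := R.pow_le (p := 2) (by norm_num)
  have ha := Real.log_two_lt_d9
  have ha' := Real.log_two_gt_d9
  have hKx : ((k + 1 : ℕ) : ℝ) ≤ Real.exp (2 * l) := by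
    have h1 : Real.exp (2 * l) = x ^ 2 := by rw [R.hx, ← Real.exp_nat_mul]; norm_num
    rw [h1]; push_cast; nlinarith [R.x_big]
  have hile : i.choose 2 ≤ (k + 1).choose 2 := Nat.choose_le_choose 2 hiK.le
  have hmu1 : (1 : ℝ) ≤ ((k + 1).choose 2).choose (muD r j) := by
    have : 0 < ((k + 1).choose 2).choose (muD r j) := by
      rcases Nat.eq_zero_or_pos (((k + 1).choose 2).choose (muD r j)) with h | h
      · rw [hE, h] at hE1; norm_num at hE1
      · exact h
    exact_mod_cast this
  by_cases hi : 2 * i ≤ k + 1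
  · have hEge : (n.choose (k + 1) : ℝ) * (1 / 2 : ℝ) ^ ((k + 1).choose 2) ≤ E := by
      rw [hE]
      have h0 : (0 : ℝ) ≤ (1 / 2 : ℝ) ^ ((k + 1).choose 2) := by positivity
      gcongr
      nlinarith
    have hD : Real.exp (x - 1) ≤ ((n - (k + 1) : ℕ) : ℝ) := by
      rw [Nat.cast_sub R.K_lt_n]
      have h1 := R.x_le_n
      have h2 := R.x_big
      have h3 : Real.exp (x - 1) = n / Real.exp 1 := by rw [Real.exp_sub, R.hn]
      have h4 : (2 : ℝ) ≤ Real.exp 1 := by have := Real.add_one_le_exp (1 : ℝ); linarith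
      have h5 : (n : ℝ) / Real.exp 1 ≤ n / 2 := by gcongr
      rw [h3]; push_cast; nlinarith
    have hch : (n.choose (k + 1 - i) : ℝ) ≤ n.choose (k + 1) * Real.exp (i * (2 * l - (x - 1))) := by
      have h1 : (n.choose (k + 1 - i) : ℝ) * ((n - (k + 1) : ℕ) : ℝ) ^ i ≤
          n.choose (k + 1) * ((k + 1 : ℕ) : ℝ) ^ i := by
        exact_mod_cast choose_sub_mul_le (n := n) i hiK.le
      have h2 : (n.choose (k + 1 - i) : ℝ) * Real.exp (x - 1) ^ i ≤
          n.choose (k + 1) * Real.exp (2 * l) ^ i := by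
        refine le_trans ?_ (h1.trans ?_) <;> gcongr
      rw [← Real.exp_nat_mul, ← Real.exp_nat_mul] at h2
      rw [mul_sub, Real.exp_sub, ← mul_div_assoc, le_div_iff₀ (Real.exp_pos _)]
      exact h2
    have hci : ((k + 1).choose i : ℝ) ≤ Real.exp (i * (2 * l)) := by
      calc ((k + 1).choose i : ℝ) ≤ ((k + 1 : ℕ) : ℝ) ^ i := by
            exact_mod_cast Nat.choose_le_pow _ _
        _ ≤ Real.exp (2 * l) ^ i := by gcongr
        _ = _ := by rw [← Real.exp_nat_mul]
    have hpow : (1 / 2 : ℝ) ^ ((k + 1).choose 2 - i.choose 2) =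
        (1 / 2 : ℝ) ^ ((k + 1).choose 2) * Real.exp (i * ((i - 1) / 2 * Real.log 2)) := by
      rw [half_pow_eq, half_pow_eq, ← Real.exp_add, Nat.cast_sub hile, choose_two_real i]
      congr 1; ring
    have hiR : (2 * i : ℝ) ≤ k + 1 := by exact_mod_cast hi
    have hi2R : (2 : ℝ) ≤ i := by exact_mod_cast hi2
    have hexp : (i : ℝ) * (2 * l) + i * (2 * l - (x - 1)) + 3 * l ^ 2 +
        i * ((i - 1) / 2 * Real.log 2) ≤ -(0.4 * x) := by
      have h1 : ((i : ℝ) - 1) / 2 * Real.log 2 ≤ 0.501 * x := by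
        have h2 := R.hk2
        have : ((i : ℝ) - 1) / 2 * Real.log 2 ≤ (k / 4) * Real.log 2 :=
          mul_le_mul_of_nonneg_right (by linarith) (by linarith)
        nlinarith
      have h2 : (i : ℝ) * (2 * l) + i * (2 * l - (x - 1)) + i * ((i - 1) / 2 * Real.log 2) ≤
          i * (4 * l + 1 - 0.499 * x) := by
        have := mul_le_mul_of_nonneg_left h1 (by positivity : (0 : ℝ) ≤ i)
        nlinarith
      have h3 : 4 * l + 1 - 0.499 * x ≤ -0.4 * x := by
        have := R.x_big
        nlinarith
      nlinarith
    calc _ ≤ (Real.exp (i * (2 * l)) * (n.choose (k + 1) * Real.exp (i * (2 * l - (x - 1))))) *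
        (Real.exp (3 * l ^ 2) * ((1 / 2 : ℝ) ^ ((k + 1).choose 2) *
          Real.exp (i * ((i - 1) / 2 * Real.log 2)))) := by
          rw [hpow]
          gcongr
          exact R.K2mu_le
      _ = Real.exp ((i : ℝ) * (2 * l) + i * (2 * l - (x - 1)) + 3 * l ^ 2 +
        i * ((i - 1) / 2 * Real.log 2)) * (n.choose (k + 1) * (1 / 2 : ℝ) ^ ((k + 1).choose 2)) := by
          rw [Real.exp_add, Real.exp_add, Real.exp_add]; ring
      _ ≤ _ := by
          gcongr
  · obtain ⟨t, ht⟩ : ∃ t, k + 1 = i + t := ⟨k + 1 - i, by omega⟩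
    have htR : (k : ℝ) + 1 = i + t := by exact_mod_cast ht
    have ht1 : (1 : ℝ) ≤ t := by
      have : 1 ≤ t := by omega
      exact_mod_cast this
    have hiR : (k : ℝ) + 1 ≤ 2 * i := by
      have : k + 1 ≤ 2 * i := by omega
      exact_mod_cast this
    have hci : ((k + 1).choose i : ℝ) ≤ Real.exp (t * (2 * l)) := by
      rw [show (k + 1).choose i = (k + 1).choose t by
        rw [← Nat.choose_symm (by omega : t ≤ k + 1)]; congr 1; omega]
      calc ((k + 1).choose t : ℝ) ≤ ((k + 1 : ℕ) : ℝ) ^ t := by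
            exact_mod_cast Nat.choose_le_pow _ _
        _ ≤ Real.exp (2 * l) ^ t := by gcongr
        _ = _ := by rw [← Real.exp_nat_mul]
    have hch : (n.choose (k + 1 - i) : ℝ) ≤ Real.exp (t * x) := by
      rw [show k + 1 - i = t by omega, Real.exp_nat_mul, ← R.hn]
      exact_mod_cast Nat.choose_le_pow _ _
    have hpow : (1 / 2 : ℝ) ^ ((k + 1).choose 2 - i.choose 2) ≤
        Real.exp (t * (-(1.49 * x))) := by
      rw [half_pow_eq]
      apply Real.exp_le_exp.2
      rw [Nat.cast_sub hile, choose_two_real i, choose_two_real (k + 1)]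
      push_cast
      have h1 : ((k : ℝ) + 1) * (k + 1 - 1) / 2 - i * (i - 1) / 2 = t * ((2 * i + t - 1) / 2) := by
        rw [htR]; ring
      have h2 : 3 / 4 * (k : ℝ) - 1 ≤ (2 * i + t - 1) / 2 := by linarith
      have h3 := R.hk1
      have h4 : 1.49 * x ≤ (2 * i + t - 1) / 2 * Real.log 2 := by
        have : (3 / 4 * (k : ℝ) - 1) * Real.log 2 ≤ (2 * i + t - 1) / 2 * Real.log 2 :=
          mul_le_mul_of_nonneg_right h2 (by linarith)
        nlinarith [R.x_big]
      rw [h1]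
      nlinarith
    have hexp : (t : ℝ) * (2 * l) + t * x + 3 * l ^ 2 + t * (-(1.49 * x)) ≤ -(0.4 * x) := by
      have h3 : 2 * l - 0.49 * x ≤ -0.45 * x := by
        nlinarith
      nlinarith
    calc _ ≤ (Real.exp (t * (2 * l)) * Real.exp (t * x)) *
        (Real.exp (3 * l ^ 2) * Real.exp (t * (-(1.49 * x)))) := by
          gcongr
          exact R.K2mu_le
      _ = Real.exp ((t : ℝ) * (2 * l) + t * x + 3 * l ^ 2 + t * (-(1.49 * x))) * 1 := by
          rw [Real.exp_add, Real.exp_add, Real.exp_add]; ring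
      _ ≤ _ := by
          gcongr

theorem caseA (R : Reg n k r j l x)
    (hE : 5 * √x ≤ n.choose (k + 1) *
      (((k + 1).choose 2).choose (muD r j) * (1 / 2 : ℝ) ^ ((k + 1).choose 2))) :
    1 ≤ grPr n {G | xiD r j ≤ numZ n (k + 1) (muD r j) G} + 1 / √x := by
  set E : ℝ := n.choose (k + 1) *
      (((k + 1).choose 2).choose (muD r j) * (1 / 2 : ℝ) ^ ((k + 1).choose 2)) with hEdef
  have hx := R.x_pos
  have hsx : 0 < √x := Real.sqrt_pos.2 hx
  have hsq : √x ^ 2 = x := Real.sq_sqrt hx.le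
  have hs1 : 10 ^ 15 ≤ √x := by
    apply Real.le_sqrt_of_sq_le
    have := R.x_big
    norm_num at this ⊢; exact this
  have hE0 : 0 < E := by linarith
  have hE1 : 1 ≤ E := by linarith
  have hxi : (xiD r j : ℝ) ≤ E / 2 := by
    have h1 : (xiD r j : ℝ) ≤ l := le_trans (by exact_mod_cast R.xi_le) R.hrl
    have h2 : l ≤ √x := by
      apply Real.le_sqrt_of_sq_le
      have := R.pow_le (p := 2) (by norm_num)
      nlinarith [pow_pos R.l_pos 2]
    linarith
  have h1 := second_moment (n := n) (ξ := xiD r j) hEdef hE0 hxi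
  have h2 : ∑ i ∈ Finset.Ico 2 (k + 1), ((k + 1).choose i * n.choose (k + 1 - i) : ℝ) *
      ((((k + 1).choose 2 : ℝ) + 1) ^ (muD r j) * (1 / 2 : ℝ) ^ ((k + 1).choose 2 - i.choose 2)) ≤
      (k + 1) * (Real.exp (-(0.4 * x)) * E) := by
    calc _ ≤ ∑ i ∈ Finset.Ico 2 (k + 1), Real.exp (-(0.4 * x)) * E := by
          refine Finset.sum_le_sum fun i hi => ?_
          rw [Finset.mem_Ico] at hi
          exact R.term_small hEdef hE1 hi.1 hi.2
      _ ≤ _ := by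
          rw [Finset.sum_const, nsmul_eq_mul, Nat.card_Ico]
          gcongr
          have : ((k + 1 - 2 : ℕ) : ℝ) ≤ ((k + 1 : ℕ) : ℝ) := by
            exact_mod_cast Nat.sub_le _ _
          push_cast at this; exact this
  have h3 : grPr n {G | numZ n (k + 1) (muD r j) G < xiD r j} ≤ 1 / √x := by
    refine h1.trans ?_
    calc _ ≤ 4 / E * (1 + (k + 1) * (Real.exp (-(0.4 * x)) * E)) := by gcongr
      _ = 4 / E + 4 * (k + 1) * Real.exp (-(0.4 * x)) := by field_simp
      _ ≤ 4 / (5 * √x) + 4 * (k + 1) * (1 / x ^ 9) := by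
        gcongr
        exact R.exp_neg_le (by norm_num)
      _ ≤ 4 / (5 * √x) + 1 / (5 * √x) := by
        gcongr
        rw [mul_one_div, div_le_div_iff₀ (by positivity) (by positivity)]
        have h4 := R.k_ub
        have h5 : (x : ℝ) ^ 2 ≤ x ^ 9 := pow_le_pow_right₀ (by linarith [R.x_big]) (by norm_num)
        have h6 : 4 * ((k : ℝ) + 1) ≤ 13 * x := by linarith [R.x_big]
        calc 4 * ((k : ℝ) + 1) * (5 * √x) ≤ 13 * x * (5 * √x) := by gcongr
          _ = 65 * √x * x := by ring
          _ ≤ √x * √x * x := by gcongr; linarith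
          _ = x ^ 2 := by rw [← sq, hsq]; ring
          _ ≤ _ := by linarith
      _ = _ := by field_simp; norm_num
  have h4 := grPr_univ n
  have h5 := grPr_union_le {G : SimpleGraph (Fin n) | xiD r j ≤ numZ n (k + 1) (muD r j) G}
    {G | numZ n (k + 1) (muD r j) G < xiD r j}
  have h6 : ({G : SimpleGraph (Fin n) | xiD r j ≤ numZ n (k + 1) (muD r j) G} ∪
    {G | numZ n (k + 1) (muD r j) G < xiD r j}) = Set.univ := by
    ext G; simp [le_or_gt]
  rw [h6, h4] at h5
  linarith

end Reg

/-- Expected number of independent `v`-sets in `G_{n,1/2}`. -/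
noncomputable def fv (n v : ℕ) : ℝ := n.choose v * (1 / 2 : ℝ) ^ v.choose 2

theorem fv_nonneg (n v : ℕ) : 0 ≤ fv n v := by unfold fv; positivity

theorem fv_succ (n v : ℕ) : fv n (v + 1) * (v + 1) = fv n v * ((n - v : ℕ) : ℝ) * (1 / 2) ^ v := by
  have h1 : (n.choose (v + 1) : ℝ) * (v + 1) = n.choose v * ((n - v : ℕ) : ℝ) := by
    exact_mod_cast Nat.choose_succ_right_eq n v
  unfold fv
  rw [show (v + 1).choose 2 = v + v.choose 2 by simp [Nat.choose_succ_succ' v 1], pow_add]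
  linear_combination ((1 / 2 : ℝ) ^ v * (1 / 2) ^ v.choose 2) * h1

namespace Reg
variable {n k r j : ℕ} {l x : ℝ}

theorem fv_up (R : Reg n k r j l x) (h : fv n (k + 1) ≤ Real.exp l) (t : ℕ) :
    fv n (k + 1 + t) ≤
      Real.exp (l + t * (x - (k + 1) * Real.log 2) - t * (t - 1) / 2 * Real.log 2) := by
  induction t with
  | zero => simpa using h
  | succ t ih =>
    have h1 := fv_succ n (k + 1 + t)
    have h2 : fv n (k + 1 + t + 1) ≤ fv n (k + 1 + t + 1) * ((k + 1 + t : ℕ) + 1) := by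
      apply le_mul_of_one_le_right (fv_nonneg _ _)
      have : (0 : ℝ) ≤ ((k + 1 + t : ℕ) : ℝ) := by positivity
      linarith
    have h3 : ((n - (k + 1 + t) : ℕ) : ℝ) ≤ Real.exp x := by
      rw [← R.hn]; exact_mod_cast Nat.sub_le _ _
    rw [h1, half_pow_eq] at h2
    refine h2.trans ?_
    have h0 := fv_nonneg n (k + 1 + t)
    calc _ ≤ Real.exp (l + t * (x - (k + 1) * Real.log 2) - t * (t - 1) / 2 * Real.log 2) *
        Real.exp x * Real.exp (-(((k + 1 + t : ℕ) : ℝ) * Real.log 2)) := by gcongr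
      _ = _ := by
        rw [← Real.exp_add, ← Real.exp_add]
        congr 1; push_cast; ring

theorem n_sub_ge (R : Reg n k r j l x) {v : ℕ} (hv : v ≤ k + 1) :
    Real.exp (x - 1) ≤ ((n - v : ℕ) : ℝ) := by
  have hv' : (v : ℝ) ≤ k + 1 := by exact_mod_cast hv
  rw [Nat.cast_sub (hv.trans R.K_lt_n)]
  have h1 := R.x_le_n
  have h2 := R.x_big
  have h3 : Real.exp (x - 1) = n / Real.exp 1 := by rw [Real.exp_sub, R.hn]
  have h4 : (2 : ℝ) ≤ Real.exp 1 := by have := Real.add_one_le_exp (1 : ℝ); linarith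
  have h5 : (n : ℝ) / Real.exp 1 ≤ n / 2 := by gcongr
  have h6 := R.k_ub
  rw [h3]; nlinarith

theorem fv_down (R : Reg n k r j l x) (h : fv n (k + 1) ≤ Real.exp l) (t : ℕ) (ht : t ≤ k + 1) :
    fv n (k + 1 - t) ≤
      Real.exp (l + t * (2 * l - x + 1 + k * Real.log 2) - t * (t - 1) / 2 * Real.log 2) := by
  induction t with
  | zero => simpa using h
  | succ t ih =>
    specialize ih (by omega)
    have h1 := fv_succ n (k - t)
    rw [show k + 1 - t = k - t + 1 by omega] at ih
    rw [show k + 1 - (t + 1) = k - t by omega]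
    have h3 := R.n_sub_ge (v := k - t) (by omega)
    have h4 : ((k - t : ℕ) : ℝ) + 1 ≤ Real.exp (2 * l) := by
      have h1 : Real.exp (2 * l) = x ^ 2 := by rw [R.hx, ← Real.exp_nat_mul]; norm_num
      have h2 : ((k - t : ℕ) : ℝ) ≤ k := by exact_mod_cast Nat.sub_le _ _
      rw [h1]; nlinarith [R.x_big, R.k_ub]
    have h0 := fv_nonneg n (k - t)
    have h0' := fv_nonneg n (k - t + 1)
    have h5 : fv n (k - t) * Real.exp (x - 1) * Real.exp (-((k - t : ℕ) * Real.log 2)) ≤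
        Real.exp (l + t * (2 * l - x + 1 + k * Real.log 2) - t * (t - 1) / 2 * Real.log 2) *
        Real.exp (2 * l) := by
      rw [← half_pow_eq]
      calc _ ≤ fv n (k - t) * ((n - (k - t) : ℕ) : ℝ) * (1 / 2) ^ (k - t) := by gcongr
        _ = fv n (k - t + 1) * ((k - t : ℕ) + 1) := h1.symm
        _ ≤ _ := by gcongr
    rw [← Real.exp_add, mul_assoc, ← Real.exp_add, ← le_div_iff₀ (Real.exp_pos _),
      ← Real.exp_sub] at h5
    refine h5.trans (le_of_eq ?_)
    congr 1
    rw [Nat.cast_sub (by omega)]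
    push_cast; ring

theorem fv_le (R : Reg n k r j l x) (h : fv n (k + 1) ≤ Real.exp l) (v : ℕ) {s : ℝ}
    (hs : s = v - k) :
    fv n v ≤ Real.exp ((1 - s) * x + 20 * l ^ 4 - s ^ 2 / 8) := by
  have hl := R.hL
  have ha := Real.log_two_lt_d9
  have ha' := Real.log_two_gt_d9
  have hk1 := R.hk1
  have hk2 := R.hk2
  have hl4 : l ^ 4 = (l ^ 2) ^ 2 := by ring
  have hll : 1000 * l ≤ l ^ 2 := by nlinarith
  have hll2 : 1000000 ≤ l ^ 2 := by nlinarith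
  have hll4 : 1000000 * l ^ 2 ≤ l ^ 4 := by nlinarith
  rcases le_or_gt (k + 1) v with hv | hv
  · obtain ⟨t, rfl⟩ := Nat.exists_eq_add_of_le hv
    refine (R.fv_up h t).trans (Real.exp_le_exp.2 ?_)
    push_cast at hs
    have ht : (0 : ℝ) ≤ t := by positivity
    have hst : s = t + 1 := by linarith
    rw [hst]
    have h1 : (t : ℝ) * (x - (k + 1) * Real.log 2) ≤ t * (-x + l ^ 2 - Real.log 2) :=
      mul_le_mul_of_nonneg_left (by linarith) ht
    have h2 := sq_nonneg ((t : ℝ) - 3 * l ^ 2)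
    have h3 : 0.34 * ((t : ℝ) * (t + 1)) ≤ t * (t - 1) / 2 * Real.log 2 + t * Real.log 2 := by
      nlinarith [mul_nonneg ht (by linarith : (0 : ℝ) ≤ t + 1)]
    nlinarith
  · have : v = k + 1 - (k + 1 - v) := by omega
    rw [this]
    refine (R.fv_down h (k + 1 - v) (by omega)).trans (Real.exp_le_exp.2 ?_)
    set t := k + 1 - v with htdef
    have hvt : (v : ℝ) + t = k + 1 := by exact_mod_cast (by omega : v + t = k + 1)
    have ht : (1 : ℝ) ≤ t := by exact_mod_cast (by omega : 1 ≤ t)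
    have hst : s = 1 - t := by linarith
    rw [hst]
    have h1 : (t : ℝ) * (2 * l - x + 1 + k * Real.log 2) ≤ t * (x + 2 * l ^ 2) :=
      mul_le_mul_of_nonneg_left (by nlinarith) (by linarith)
    have h3 : 0.34 * ((t : ℝ) * (t - 1)) ≤ t * (t - 1) / 2 * Real.log 2 := by
      nlinarith [mul_nonneg (by linarith : (0 : ℝ) ≤ t) (by linarith : (0 : ℝ) ≤ t - 1)]
    have h2 := sq_nonneg ((t : ℝ) - 5 * l ^ 2)
    nlinarith

theorem prod_fv_le (R : Reg n k r j l x) (h : fv n (k + 1) ≤ Real.exp l) (v : Fin r → ℕ)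
    (hv : ∑ i, v i = k * r + j) :
    ∏ i, fv n (v i) ≤
      Real.exp ((r - j) * x + 20 * r * l ^ 4 - (∑ i, ((v i : ℝ) - k) ^ 2) / 8) := by
  calc _ ≤ ∏ i, Real.exp ((1 - ((v i : ℝ) - k)) * x + 20 * l ^ 4 - ((v i : ℝ) - k) ^ 2 / 8) :=
        Finset.prod_le_prod (fun i _ => fv_nonneg _ _) fun i _ => R.fv_le h (v i) rfl
    _ = _ := by
      rw [← Real.exp_sum]
      congr 1
      have h2 : ∑ i, (v i : ℝ) = k * r + j := by exact_mod_cast hv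
      rw [Finset.sum_sub_distrib, Finset.sum_add_distrib, ← Finset.sum_mul,
        Finset.sum_sub_distrib, Finset.sum_sub_distrib, ← Finset.sum_div, h2]
      simp
      ring

/-- Expected number of `K`-sets with few edges is small when there are few critical sets. -/
theorem fv_of_small (R : Reg n k r j l x)
    (hE : n.choose (k + 1) *
      (((k + 1).choose 2).choose (muD r j) * (1 / 2 : ℝ) ^ ((k + 1).choose 2)) < 5 * √x) :
    fv n (k + 1) ≤ Real.exp l := by
  have hx := R.x_pos
  have hx2 := R.x_big
  have hmu1 : (1 : ℝ) ≤ ((k + 1).choose 2).choose (muD r j) := by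
    have h1 : muD r j ≤ (k + 1).choose 2 := by
      have h2 : (muD r j : ℝ) ≤ l := le_trans (by exact_mod_cast muD_le r j) R.hrl
      have h3 := R.pow_le (p := 1) (by norm_num)
      have h4 := R.k_lb
      have h5 := R.l_pos
      have h6 : ((muD r j : ℕ) : ℝ) ≤ ((k + 1).choose 2 : ℕ) := by
        rw [choose_two_real]; push_cast
        nlinarith
      exact_mod_cast h6
    exact_mod_cast Nat.choose_pos h1
  have h5 : 5 * √x ≤ x := by
    have : √x * √x = x := Real.mul_self_sqrt hx.le
    have : 5 ≤ √x := Real.le_sqrt_of_sq_le (by linarith)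
    nlinarith
  rw [← R.hx]
  refine le_trans ?_ (hE.le.trans h5)
  unfold fv
  gcongr
  exact le_mul_of_one_le_left (by positivity) hmu1

end Reg

theorem choose_le_of_lt {N μ i : ℕ} {q : ℝ} (hq0 : 0 ≤ q) (hq1 : q ≤ 1) (hμ : μ < N)
    (hq : (μ : ℝ) ≤ q * ((N - μ : ℕ) : ℝ)) (hi : i < μ) :
    (N.choose i : ℝ) ≤ q * N.choose μ := by
  have step : ∀ i, i < μ → (N.choose i : ℝ) ≤ q * N.choose (i + 1) := by
    intro i hi
    have h1 : (N.choose (i + 1) : ℝ) * (i + 1) = N.choose i * ((N - i : ℕ) : ℝ) := by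
      exact_mod_cast Nat.choose_succ_right_eq N i
    have h2 : ((i : ℝ) + 1) ≤ μ := by exact_mod_cast hi
    have h3 : ((N - μ : ℕ) : ℝ) ≤ ((N - i : ℕ) : ℝ) := by exact_mod_cast (by omega)
    have h4 : (0 : ℝ) < ((N - i : ℕ) : ℝ) := by exact_mod_cast (by omega)
    have h5 : ((i : ℝ) + 1) ≤ q * ((N - i : ℕ) : ℝ) :=
      h2.trans (hq.trans (mul_le_mul_of_nonneg_left h3 hq0))
    refine le_of_mul_le_mul_right ?_ h4
    rw [← h1]
    calc (N.choose (i + 1) : ℝ) * (i + 1) ≤ N.choose (i + 1) * (q * ((N - i : ℕ) : ℝ)) := by gcongr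
      _ = _ := by ring
  obtain ⟨d, rfl⟩ := Nat.exists_eq_add_of_lt hi
  have h6 : ∀ e, i + 1 + e ≤ i + d + 1 → (N.choose i : ℝ) ≤ q * N.choose (i + 1 + e) := by
    intro e
    induction e with
    | zero => intro _; exact step i hi
    | succ e ih =>
      intro he
      refine (ih (by omega)).trans (mul_le_mul_of_nonneg_left ?_ hq0)
      refine (step _ (by omega)).trans ?_
      exact mul_le_of_le_one_left (by positivity) hq1
  have := h6 d (by omega)
  rwa [show i + 1 + d = i + d + 1 by omega] at this

namespace Reg
variable {n k r j : ℕ} {l x : ℝ}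

theorem bad_few (R : Reg n k r j l x)
    (hE : n.choose (k + 1) *
      (((k + 1).choose 2).choose (muD r j) * (1 / 2 : ℝ) ^ ((k + 1).choose 2)) < 5 * √x) :
    grPr n {G | ∃ A : Finset (Fin n), A.card = k + 1 ∧ edgesIn G A < muD r j} ≤ 1 / x := by
  set μ := muD r j with hμ
  have hx := R.x_pos
  have hx2 := R.x_big
  have hl := R.l_pos
  have hl1 := R.pow_le (p := 1) (by norm_num)
  have hμl : (μ : ℝ) ≤ l := le_trans (by exact_mod_cast muD_le r j) R.hrl
  have hK2 : x ^ 2 + l ≤ (((k + 1).choose 2 : ℕ) : ℝ) := by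
    have h4 := R.k_lb
    rw [choose_two_real]; push_cast; nlinarith
  have hμK : μ < (k + 1).choose 2 := by
    have : (μ : ℝ) < ((k + 1).choose 2 : ℕ) := by nlinarith
    exact_mod_cast this
  have hq1 : l / x ^ 2 ≤ 1 := by
    rw [div_le_one (by positivity)]; nlinarith
  have hq : (μ : ℝ) ≤ l / x ^ 2 * (((k + 1).choose 2 - μ : ℕ) : ℝ) := by
    rw [Nat.cast_sub hμK.le]
    calc (μ : ℝ) ≤ l := hμl
      _ = l / x ^ 2 * x ^ 2 := by field_simp
      _ ≤ _ := by gcongr; linarith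
  have h1 := grPr_iUnion_le (n := n)
    ((Finset.univ : Finset (Fin n)).powersetCard (k + 1) ×ˢ Finset.range μ)
    (fun p => {G | (tr G (prs p.1)).card = p.2})
    {G | ∃ A : Finset (Fin n), A.card = k + 1 ∧ edgesIn G A < μ} (by
      rintro G ⟨A, hA, hAG⟩
      refine ⟨(A, edgesIn G A), by simp [hA, hAG], ?_⟩
      simp [edgesIn_eq])
  refine h1.trans ?_
  have h2 : ∀ p ∈ (Finset.univ : Finset (Fin n)).powersetCard (k + 1) ×ˢ Finset.range μ,
      grPr n {G | (tr G (prs p.1)).card = p.2} ≤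
        (l / x ^ 2 * ((k + 1).choose 2).choose μ) * (1 / 2 : ℝ) ^ ((k + 1).choose 2) := by
    intro p hp
    simp only [Finset.mem_product, Finset.mem_powersetCard, Finset.mem_range] at hp
    rw [grPr_card_eq (prs_not_isDiag _), card_prs, hp.1.2]
    gcongr
    exact choose_le_of_lt (by positivity) hq1 hμK hq hp.2
  refine (Finset.sum_le_sum h2).trans ?_
  rw [Finset.sum_const, nsmul_eq_mul, Finset.card_product, Finset.card_powersetCard,
    Finset.card_range, Finset.card_univ, Fintype.card_fin]
  push_cast
  have hsq : √x * √x = x := Real.mul_self_sqrt hx.le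
  have hs0 : 0 < √x := Real.sqrt_pos.2 hx
  have hs1 : √x ≤ x := by
    have : 1 ≤ √x := Real.le_sqrt_of_sq_le (by linarith)
    nlinarith
  have hl2 := R.pow_le (p := 4) (by norm_num)
  have h5 : 5 * l ^ 2 ≤ √x := by
    apply Real.le_sqrt_of_sq_le
    calc (5 * l ^ 2) ^ 2 = 25 * l ^ 4 := by ring
      _ ≤ 10 ^ 30 * l ^ 4 := by gcongr; norm_num
      _ ≤ x := hl2
  calc _ = μ * (l / x ^ 2) * (n.choose (k + 1) *
      (((k + 1).choose 2).choose μ * (1 / 2 : ℝ) ^ ((k + 1).choose 2))) := by ring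
    _ ≤ l * (l / x ^ 2) * (5 * √x) := by gcongr
    _ = (5 * l ^ 2 * √x) / x ^ 2 := by ring
    _ ≤ x / x ^ 2 := by
      gcongr; nlinarith
    _ = 1 / x := by field_simp

end Reg

theorem cube_ge {l : ℝ} (h : 1000 ≤ l) : 100 * l ≤ l ^ 3 := by
  nlinarith [mul_nonneg (by linarith : 0 ≤ l) (by nlinarith : 0 ≤ l ^ 2 - 100)]

theorem sq_ge {l : ℝ} (h : 1000 ≤ l) : 100 ≤ l ^ 2 := by nlinarith

namespace Reg
variable {n k r j : ℕ} {l x : ℝ}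

theorem sq_w_le (R : Reg n k r j l x) : Real.exp (l / 100) ^ 2 ≤ x := by
  exact (pow_le_pow_right₀ R.one_le_w (by norm_num)).trans R.w_pow.le

theorem exp_pow (R : Reg n k r j l x) (p : ℕ) : Real.exp (p * l) = x ^ p := by
  rw [R.hx, ← Real.exp_nat_mul]

set_option maxHeartbeats 600000 in
/-- Quantitative counting and stability bound for `K_{q+1}`-free graphs. -/
theorem stab_bound (R : Reg n k r j l x) (S : Finset (Fin n)) {q t : ℕ} (hq1 : 1 ≤ q) (hqr : q ≤ r)
    (hS1 : x / l ^ 6 ≤ S.card) (hS2 : (S.card : ℝ) ≤ 3 * x * l)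
    (ht : 2 * (t : ℝ) ≤ (1 - 1 / q) * (S.card : ℝ) ^ 2) :
    grPr n {G | G.CliqueFreeOn ↑S (q + 1) ∧
      ∀ c : Fin n → Fin q, t ≤ ∑ i, edgesIn G (S.filter (c · = i))} ≤
    Real.exp (-(((S.card : ℝ) ^ 2 / (2 * q) + t) * Real.log 2) + (S.card : ℝ) ^ 2 / l ^ 17) := by
  set N : ℝ := (S.card : ℝ) with hN
  have hl := R.l_pos
  have hl1 := R.hL
  have hx := R.x_pos
  have ha := Real.log_two_lt_d9
  have ha' := Real.log_two_gt_d9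
  set w := Real.exp (l / 100) with hw
  have hw2 : w ^ 2 ≤ x := R.sq_w_le
  have hw1 : 10 ^ 30 * l ^ 190 ≤ w := R.pow_le_w (p := 190) (by norm_num)
  have hw0 : 0 < w := Real.exp_pos _
  have hpl : ∀ {a b : ℕ}, a ≤ b → l ^ a ≤ l ^ b := fun h => pow_le_pow_right₀ (by linarith) h
  have hNw : w * l ^ 180 ≤ N := by
    refine le_trans ?_ hS1
    rw [le_div_iff₀ (by positivity)]
    calc w * l ^ 180 * l ^ 6 = w * l ^ 186 := by ring
      _ ≤ w * w := by
        gcongr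
        calc l ^ 186 ≤ l ^ 190 := hpl (by norm_num)
          _ ≤ 10 ^ 30 * l ^ 190 := le_mul_of_one_le_left (by positivity) (by norm_num)
          _ ≤ w := hw1
      _ ≤ x := by rw [← sq]; exact hw2
  have hN0 : 0 < N := lt_of_lt_of_le (by positivity) hNw
  set d : ℝ := 1 / l ^ 20 with hd
  have hd0 : 0 < d := by positivity
  have hd1 : d ≤ 1 := by
    rw [hd, div_le_one (by positivity)]; exact one_le_pow₀ (by linarith)
  have hw1' : 1 ≤ w := R.one_le_w
  have hNl : l ^ 100 ≤ N := by
    calc l ^ 100 ≤ l ^ 180 := hpl (by norm_num)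
      _ ≤ w * l ^ 180 := le_mul_of_one_le_left (by positivity) hw1'
      _ ≤ N := hNw
  set u : ℝ := N ^ 2 / l ^ 20 with hu
  have hdN : d * N ^ 2 = u := by rw [hd, hu]; ring
  have hu1 : 1 ≤ d * N := by
    rw [hd, one_div_mul_eq_div, le_div_iff₀ (by positivity), one_mul]
    exact (hpl (by norm_num)).trans hNl
  have hNu : N ≤ u := by
    rw [← hdN]
    calc N = 1 * N := (one_mul N).symm
      _ ≤ d * N * N := mul_le_mul_of_nonneg_right hu1 hN0.le
      _ = _ := by ring
  have hN1 : 1 ≤ N := (one_le_pow₀ (by linarith)).trans hNl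
  set h := ⌈d * N⌉₊ with hh
  have hh1 : d * N ≤ h := Nat.le_ceil _
  have hh2 : (h : ℝ) ≤ 2 * (d * N) := by
    have := Nat.ceil_lt_add_one (by positivity : 0 ≤ d * N)
    linarith
  have hh0 : 1 ≤ h := by
    have : (1 : ℝ) ≤ h := hu1.trans hh1
    exact_mod_cast this
  set s := ⌈u⌉₊ with hs
  have hs1 : u ≤ s := Nat.le_ceil _
  have hs2 : (s : ℝ) ≤ 2 * u := by
    have := Nat.ceil_lt_add_one (by positivity : 0 ≤ u)
    linarith
  set T := ⌊(l ^ (40 * q + 40) : ℝ)⌋₊ + 1 with hT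
  have hT1 : l ^ (40 * q + 40) < T := by rw [hT]; push_cast; exact Nat.lt_floor_add_one _
  have hT2 : (T : ℝ) ≤ 2 * w * l ^ 40 := by
    have h1 : (T : ℝ) ≤ l ^ (40 * q + 40) + 1 := by
      rw [hT]; push_cast
      have := Nat.floor_le (by positivity : 0 ≤ l ^ (40 * q + 40)); linarith
    have h2 : l ^ (40 * q + 40) ≤ w * l ^ 40 := by
      rw [pow_add]
      gcongr
      exact (hpl (by omega)).trans R.hrx
    have h3 : 1 ≤ w * l ^ 40 := one_le_mul_of_one_le_of_one_le hw1' (one_le_pow₀ (by linarith))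
    linarith
  set Y : ℝ := (1 - 1 / q) * N ^ 2 + 8 * q * (h * N) - 2 * t + 2 * u with hY
  set M := ⌈Y / 2⌉₊ with hM
  have hq0 : (1 : ℝ) ≤ q := by exact_mod_cast hq1
  have hY0 : 0 ≤ Y := by rw [hY]; have : 0 ≤ 8 * (q : ℝ) * (h * N) := by positivity
                         linarith
  have hM1 : Y / 2 ≤ M := Nat.le_ceil _
  have hM2 : (M : ℝ) ≤ Y / 2 + 1 := (Nat.ceil_lt_add_one (by positivity)).le
  clear_value h s T M Y u d w N
  have hql : (q : ℝ) ≤ l := le_trans (by exact_mod_cast hqr) R.hrl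
  have key := grPr_stab (n := n) S h q hh0 hq1 hd0 hd1 T s M t (by
      rw [← hN]
      have h1 : (1 : ℝ) < T * (d ^ q * d) ^ 2 := by
        have : (d ^ q * d) ^ 2 = 1 / l ^ (40 * q + 40) := by
          rw [← pow_succ, ← pow_mul, hd, div_pow, one_pow, ← pow_mul]
          congr 2; ring
        rw [this, mul_one_div, lt_div_iff₀ (by positivity), one_mul]
        exact hT1
      calc N ^ 2 = 1 * N ^ 2 := by ring
        _ < T * (d ^ q * d) ^ 2 * N ^ 2 := by gcongr
        _ = T * (d ^ q * (d * N)) ^ 2 := by ring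
        _ ≤ _ := by gcongr) (by rw [← hN, hdN]; exact hs1) (by
      rw [← hN, mul_assoc 2 d, hdN]; linarith)
  refine key.trans ?_
  rw [← hN]
  have hNx : N + 1 ≤ Real.exp (2 * l) := by
    have := R.exp_pow 2
    push_cast at this
    rw [this]
    have h1 := R.pow_le (p := 1) (by norm_num)
    have h2 : 10 ^ 20 * l ≤ x := by linarith
    have h3 := R.x_big
    calc N + 1 ≤ 3 * x * l + 1 := by linarith
      _ ≤ 3 * x * (x / 10 ^ 20) + 1 := by gcongr; linarith
      _ ≤ x ^ 2 := by clear * - h3; nlinarith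
  have hA : ((4 : ℝ) ^ S.card * (N + 1) ^ (q * S.card) + 1) ≤ Real.exp (4 * l ^ 2 * N) := by
    have h4 : (4 : ℝ) ^ S.card ≤ Real.exp (2 * N) := by
      have : (4 : ℝ) = 2 ^ 2 := by norm_num
      rw [this, ← pow_mul, two_pow_eq]
      apply Real.exp_le_exp.2
      push_cast
      rw [← hN]
      exact mul_le_of_le_one_right (by positivity) (by linarith)
    have h5 : (N + 1) ^ (q * S.card) ≤ Real.exp (2 * l ^ 2 * N) := by
      calc _ ≤ Real.exp (2 * l) ^ (q * S.card) := by gcongr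
        _ = Real.exp (q * N * (2 * l)) := by
          rw [← Real.exp_nat_mul]; push_cast; rw [hN]
        _ ≤ _ := by
          apply Real.exp_le_exp.2
          calc (q : ℝ) * N * (2 * l) ≤ l * N * (2 * l) := by gcongr
            _ = _ := by ring
    have h6 : (1 : ℝ) ≤ Real.exp (2 * N + 2 * l ^ 2 * N) := Real.one_le_exp (by positivity)
    have h7 : (2 : ℝ) ≤ Real.exp 1 := by have := Real.add_one_le_exp (1 : ℝ); linarith
    calc _ ≤ Real.exp (2 * N) * Real.exp (2 * l ^ 2 * N) + Real.exp (2 * N + 2 * l ^ 2 * N) := by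
          gcongr
      _ = 2 * Real.exp (2 * N + 2 * l ^ 2 * N) := by rw [Real.exp_add]; ring
      _ ≤ Real.exp 1 * Real.exp (2 * N + 2 * l ^ 2 * N) := by gcongr
      _ = Real.exp (1 + (2 * N + 2 * l ^ 2 * N)) := by rw [Real.exp_add 1]
      _ ≤ _ := by
        apply Real.exp_le_exp.2
        have : 100 * N ≤ l ^ 2 * N := mul_le_mul_of_nonneg_right (sq_ge hl1) hN0.le
        linarith
  have hB : (N ^ 2 + 1) ≤ Real.exp (4 * l) := by
    calc N ^ 2 + 1 ≤ (N + 1) ^ 2 := by linarith [add_sq N 1]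
      _ ≤ Real.exp (2 * l) ^ 2 := by gcongr
      _ = _ := by rw [← Real.exp_nat_mul]; congr 1; push_cast; ring
  clear key
  calc _ ≤ (Real.exp (4 * l ^ 2 * N) ^ T * (2 ^ M * Real.exp (4 * l) ^ s)) *
      (1 / 2) ^ S.card.choose 2 := by gcongr
    _ = Real.exp (T * (4 * l ^ 2 * N) + M * Real.log 2 + s * (4 * l) +
        -((N * (N - 1) / 2) * Real.log 2)) := by
      rw [half_pow_eq, two_pow_eq, ← Real.exp_nat_mul, ← Real.exp_nat_mul, choose_two_real, ← hN,
        Real.exp_add, Real.exp_add, Real.exp_add]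
      ring
    _ ≤ _ := by
      apply Real.exp_le_exp.2
      have e1 : T * (4 * l ^ 2 * N) ≤ u := by
        have h1 : T * (4 * l ^ 2 * N) ≤ 2 * w * l ^ 40 * (4 * l ^ 2 * N) := by gcongr
        have h2 : u * l ^ 20 = N ^ 2 := by rw [hu]; field_simp
        have h3 : 2 * w * l ^ 40 * (4 * l ^ 2 * N) * l ^ 20 ≤ u * l ^ 20 := by
          rw [h2]
          calc _ = 8 * (w * l ^ 62) * N := by ring
            _ ≤ l * (w * l ^ 62) * N := by gcongr; linarith
            _ = w * l ^ 63 * N := by ring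
            _ ≤ w * l ^ 180 * N := by gcongr; exacts [by linarith, by norm_num]
            _ ≤ N * N := by gcongr
            _ = _ := by ring
        exact h1.trans (le_of_mul_le_mul_right h3 (by positivity))
      have e2 : s * (4 * l) ≤ 8 * l * u := by
        calc s * (4 * l) ≤ 2 * u * (4 * l) := by gcongr
          _ = _ := by ring
      have e3 : q * (h * N) ≤ 2 * l * u := by
        calc q * (h * N) ≤ l * (2 * (d * N) * N) := by gcongr
          _ = 2 * l * (d * N ^ 2) := by ring
          _ = _ := by rw [hdN]
      have e4 : N ^ 2 / l ^ 17 = l ^ 3 * u := by rw [hu]; field_simp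
      have e5 : N ^ 2 / (2 * q) = 1 / q * N ^ 2 / 2 := by field_simp
      rw [e4, e5]
      have hu0 : 0 < u := by linarith
      have e6 : 100 * (l * u) ≤ l ^ 3 * u := by
        rw [← mul_assoc]
        exact mul_le_mul_of_nonneg_right (cube_ge hl1) hu0.le
      have e7 : M * Real.log 2 ≤ (Y / 2 + 1) * Real.log 2 := by gcongr
      have e8 : (Y / 2 + 1) * Real.log 2 - (N * (N - 1) / 2) * Real.log 2 ≤
          -((1 / q * N ^ 2 / 2 + t) * Real.log 2) + (8 * l * u + 3 * u) := by
        have : (Y / 2 + 1) - (N * (N - 1) / 2) ≤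
          -((1 / q * N ^ 2 / 2 + t)) + (8 * l * u + 3 * u) := by
          linarith
        have h9 : 0 ≤ 8 * l * u + 3 * u := by positivity
        have h10 := mul_le_mul_of_nonneg_right this (by linarith : 0 ≤ Real.log 2)
        have h11 := mul_le_of_le_one_right h9 (by linarith : Real.log 2 ≤ 1)
        linarith
      have e9 : u ≤ l * u := le_mul_of_one_le_left hu0.le (by linarith)
      linarith
end Reg

theorem grPr_union_add_inter {n : ℕ} (S T : Set (SimpleGraph (Fin n))) :
    grPr n (S ∪ T) + grPr n (S ∩ T) = grPr n S + grPr n T := by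
  simp only [grPr_eq, ← add_div]
  congr 1
  have h := Finset.card_union_add_card_inter (Finset.univ.filter (fun G => G ∈ S))
    (Finset.univ.filter (fun G => G ∈ T))
  have h1 : (Finset.univ.filter (fun G => G ∈ S)) ∪ (Finset.univ.filter (fun G => G ∈ T)) =
    Finset.univ.filter (fun G => G ∈ S ∪ T) := by ext; simp
  have h2 : (Finset.univ.filter (fun G => G ∈ S)) ∩ (Finset.univ.filter (fun G => G ∈ T)) =
    Finset.univ.filter (fun G => G ∈ S ∩ T) := by ext; simp
  rw [h1, h2] at h
  rw [← Nat.cast_add, ← Nat.cast_add]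
  congr 1
  convert h using 2 <;> (congr 1; ext; simp)

theorem grPr_compl {n : ℕ} (S : Set (SimpleGraph (Fin n))) : grPr n Sᶜ = 1 - grPr n S := by
  have h := grPr_union_add_inter S Sᶜ
  rw [Set.union_compl_self, Set.inter_compl_self, grPr_univ, grPr_empty] at h
  linarith

theorem grPr_all {n : ℕ} {D : Finset (Sym2 (Fin n))} (hD : ∀ e ∈ D, ¬ e.IsDiag) :
    grPr n {G | ∀ e ∈ D, e ∈ G.edgeSet} = (1 / 2 : ℝ) ^ D.card := by
  rw [← grPr_pattern hD (Finset.Subset.refl D)]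
  congr 1
  ext G
  simp only [Set.mem_ofPred_eq, tr, Finset.filter_eq_self]

/-- Pairs joining `C` to `W`. -/
def starE {n : ℕ} (C W : Finset (Fin n)) : Set (Sym2 (Fin n)) :=
  {e | ∃ c ∈ C, ∃ z ∈ W, e = s(c, z)}

/-- Number of common neighbours of `u` and `v` in `W`. -/
noncomputable def cn {n : ℕ} (G : SimpleGraph (Fin n)) (u v : Fin n) (W : Finset (Fin n)) : ℕ :=
  (W.filter (fun z => G.Adj u z ∧ G.Adj v z)).card

theorem depOn_cn {n : ℕ} {u v : Fin n} {C W : Finset (Fin n)} (hu : u ∈ C) (hv : v ∈ C) (y : ℕ) :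
    DepOn (starE C W) {G | cn G u v W ≤ y} := by
  intro G G' h hG
  simp only [Set.mem_ofPred_eq] at hG ⊢
  have : cn G' u v W = cn G u v W := by
    unfold cn
    congr 1
    refine Finset.filter_congr fun z hz => ?_
    have h1 := h s(u, z) ⟨u, hu, z, hz, rfl⟩
    have h2 := h s(v, z) ⟨v, hv, z, hz, rfl⟩
    rw [SimpleGraph.mem_edgeSet, SimpleGraph.mem_edgeSet] at h1 h2
    rw [h1, h2]
  rwa [this]

theorem depOn_edges {n : ℕ} {D : Set (Sym2 (Fin n))} {u v u' v' : Fin n}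
    (h1 : s(u, v) ∈ D) (h2 : s(u', v') ∈ D) :
    DepOn D {G : SimpleGraph (Fin n) | G.Adj u v ∧ G.Adj u' v'} := by
  intro G G' h hG
  simp only [Set.mem_ofPred_eq, ← SimpleGraph.mem_edgeSet] at hG ⊢
  exact ⟨(h _ h1).1 hG.1, (h _ h2).1 hG.2⟩

theorem DepOn.compl {n : ℕ} {D : Set (Sym2 (Fin n))} {A : Set (SimpleGraph (Fin n))}
    (h : DepOn D A) : DepOn D Aᶜ :=
  fun G G' hG hA hA' => hA (h G' G (fun e he => (hG e he).symm) hA')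

theorem grPr_adj2 {n : ℕ} {u v z : Fin n} (huv : u ≠ v) (hu : u ≠ z) (hv : v ≠ z) :
    grPr n {G | G.Adj u z ∧ G.Adj v z} = 1 / 4 := by
  have h := grPr_all (n := n) (D := {s(u, z), s(v, z)}) (by
    intro e he
    simp only [Finset.mem_insert, Finset.mem_singleton] at he
    rcases he with rfl | rfl <;> simpa)
  rw [Finset.card_pair (by simp [huv, hu])] at h
  calc _ = grPr n {G | ∀ e ∈ ({s(u, z), s(v, z)} : Finset (Sym2 (Fin n))), e ∈ G.edgeSet} := by
        congr 1; ext G; simp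
    _ = _ := by rw [h]; norm_num

theorem grPr_adj3 {n : ℕ} {u v w z : Fin n} (huv : u ≠ v) (huw : u ≠ w) (hvw : v ≠ w)
    (hu : u ≠ z) (hv : v ≠ z) (hw : w ≠ z) :
    grPr n {G | (G.Adj u z ∧ G.Adj v z) ∧ G.Adj w z} = 1 / 8 := by
  have h := grPr_all (n := n) (D := {s(u, z), s(v, z), s(w, z)}) (by
    intro e he
    simp only [Finset.mem_insert, Finset.mem_singleton] at he
    rcases he with rfl | rfl | rfl <;> simpa)
  rw [Finset.card_insert_of_notMem (by simp [huv, hu, huw]),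
    Finset.card_pair (by simp [hvw, hv])] at h
  calc _ = grPr n {G | ∀ e ∈ ({s(u, z), s(v, z), s(w, z)} : Finset (Sym2 (Fin n))),
        e ∈ G.edgeSet} := by
        congr 1; ext G; simp [and_assoc]
    _ = _ := by rw [h]; norm_num

theorem starE_single_disjoint {n : ℕ} {C W : Finset (Fin n)} (hCW : Disjoint C W)
    {z z' : Fin n} (hz : z ∈ W) (hz' : z' ∈ W) (hzz : z ≠ z') :
    Disjoint (starE C {z}) (starE C {z'}) := by
  rw [Set.disjoint_left]
  rintro e ⟨c, hc, a, ha, rfl⟩ ⟨c', hc', b, hb, h⟩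
  rw [Finset.mem_singleton] at ha hb
  subst ha hb
  rcases Sym2.eq_iff.1 h with ⟨_, h⟩ | ⟨h, _⟩
  · exact hzz h
  · exact Finset.disjoint_left.1 hCW hc (h ▸ hz')

theorem grPr_gadget_one {n : ℕ} {u v : Fin n} {W : Finset (Fin n)} (huv : u ≠ v) (hu : u ∉ W)
    (hv : v ∉ W) (y : ℕ) :
    grPr n {G | cn G u v W ≤ y} ≤ (W.card + 1 : ℝ) ^ y * (3 / 4 : ℝ) ^ (W.card - y) := by
  have hCW : Disjoint ({u, v} : Finset (Fin n)) W := by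
    rw [Finset.disjoint_left]; intro a ha
    simp only [Finset.mem_insert, Finset.mem_singleton] at ha
    rcases ha with rfl | rfl <;> assumption
  refine le_trans (grPr_mono ?_) (grPr_most W (D := fun z => starE {u, v} {z})
    (A := fun z => {G | G.Adj u z ∧ G.Adj v z}ᶜ) ?_ ?_ (by norm_num) (by norm_num)
    (ρ := 3 / 4) ?_ y)
  · intro G hG
    simp only [Set.mem_ofPred_eq, cn] at hG ⊢
    refine le_trans (le_of_eq ?_) hG
    congr 1; ext z; simp
  · intro z hz
    exact (depOn_edges (D := starE {u, v} {z}) ⟨u, by simp, z, by simp, rfl⟩ ⟨v, by simp, z, by simp, rfl⟩).compl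
  · intro z hz z' hz' hzz
    exact starE_single_disjoint hCW hz hz' hzz
  · intro z hz
    rw [grPr_compl, grPr_adj2 huv (by rintro rfl; exact hu hz) (by rintro rfl; exact hv hz)]
    norm_num

theorem grPr_gadget_two {n : ℕ} {u v u' v' : Fin n} {W : Finset (Fin n)} (huv : u ≠ v)
    (huv' : u' ≠ v') (hne : s(u, v) ≠ s(u', v')) (hu : u ∉ W) (hv : v ∉ W) (hu' : u' ∉ W)
    (hv' : v' ∉ W) (y : ℕ) :
    grPr n ({G | cn G u v W ≤ y} ∩ {G | cn G u' v' W ≤ y}) ≤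
      (W.card + 1 : ℝ) ^ (2 * y) * (5 / 8 : ℝ) ^ (W.card - 2 * y) := by
  have hCW : Disjoint ({u, v, u', v'} : Finset (Fin n)) W := by
    rw [Finset.disjoint_left]; intro a ha
    simp only [Finset.mem_insert, Finset.mem_singleton] at ha
    rcases ha with rfl | rfl | rfl | rfl <;> assumption
  refine le_trans (grPr_mono ?_) (grPr_most W (D := fun z => starE {u, v, u', v'} {z})
    (A := fun z => {G | G.Adj u z ∧ G.Adj v z}ᶜ ∩ {G | G.Adj u' z ∧ G.Adj v' z}ᶜ) ?_ ?_
    (by norm_num) (by norm_num) (ρ := 5 / 8) ?_ (2 * y))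
  · rintro G ⟨h1, h2⟩
    simp only [Set.mem_ofPred_eq, cn] at h1 h2 ⊢
    have h3 : (W.filter (fun z => G ∉ ({G | G.Adj u z ∧ G.Adj v z}ᶜ ∩
        {G | G.Adj u' z ∧ G.Adj v' z}ᶜ : Set (SimpleGraph (Fin n))))) ⊆
        W.filter (fun z => G.Adj u z ∧ G.Adj v z) ∪
          W.filter (fun z => G.Adj u' z ∧ G.Adj v' z) := by
      intro z
      simp only [Finset.mem_filter, Finset.mem_union, Set.mem_inter_iff, Set.mem_compl_iff,
        Set.mem_ofPred_eq]
      tauto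
    have h4 := (Finset.card_le_card h3).trans (Finset.card_union_le _ _)
    refine le_trans (le_of_eq ?_) (h4.trans (by omega))
    congr 1; ext z; simp
  · intro z hz
    have := (depOn_edges (D := starE {u, v, u', v'} {z}) ⟨u, by simp, z, by simp, rfl⟩
      ⟨v, by simp, z, by simp, rfl⟩).compl.inter
      (depOn_edges (D := starE {u, v, u', v'} {z}) ⟨u', by simp, z, by simp, rfl⟩
        ⟨v', by simp, z, by simp, rfl⟩).compl
    rwa [Set.union_self] at this
  · intro z hz z' hz' hzz
    exact starE_single_disjoint hCW hz hz' hzz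
  · intro z hz
    have hz1 : ∀ a, a ∉ W → a ≠ z := by rintro a ha rfl; exact ha hz
    rw [← Set.compl_union, grPr_compl]
    have h1 := grPr_union_add_inter {G : SimpleGraph (Fin n) | G.Adj u z ∧ G.Adj v z}
      {G | G.Adj u' z ∧ G.Adj v' z}
    rw [grPr_adj2 huv (hz1 u hu) (hz1 v hv), grPr_adj2 huv' (hz1 _ hu') (hz1 _ hv')] at h1
    have h2 : grPr n ({G : SimpleGraph (Fin n) | G.Adj u z ∧ G.Adj v z} ∩
      {G | G.Adj u' z ∧ G.Adj v' z}) ≤ 1 / 8 := by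
      by_cases hc : u' = u ∨ u' = v
      · have hvv : u ≠ v' ∧ v ≠ v' := by
          constructor
          · rintro rfl
            rcases hc with rfl | rfl
            · exact huv' rfl
            · exact hne Sym2.eq_swap
          · rintro rfl
            rcases hc with rfl | rfl
            · exact hne rfl
            · exact huv' rfl
        rw [← grPr_adj3 huv hvv.1 hvv.2 (hz1 u hu) (hz1 v hv) (hz1 _ hv')]
        exact grPr_mono fun G hG => ⟨hG.1, hG.2.2⟩
      · push Not at hc
        rw [← grPr_adj3 huv hc.1.symm hc.2.symm (hz1 u hu) (hz1 v hv) (hz1 _ hu')]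
        exact grPr_mono fun G hG => ⟨hG.1, hG.2.1⟩
    linarith

/-- Pairwise disjointness of a family of vertex sets. -/
def PDj {n : ℕ} {ι : Type*} (V : ι → Finset (Fin n)) : Prop :=
  ∀ i i', i ≠ i' → Disjoint (V i) (V i')

/-- Total number of edges inside the members of a family. -/
noncomputable def inn {n : ℕ} {ι : Type*} [Fintype ι] (G : SimpleGraph (Fin n))
    (V : ι → Finset (Fin n)) : ℕ :=
  ∑ i, edgesIn G (V i)

/-- Pairs inside some member of a family. -/
noncomputable def prsU {n : ℕ} {ι : Type*} [Fintype ι] (V : ι → Finset (Fin n)) :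
    Finset (Sym2 (Fin n)) :=
  Finset.univ.biUnion fun i => prs (V i)

theorem prs_disjoint {n : ℕ} {A B : Finset (Fin n)} (h : Disjoint A B) :
    Disjoint (prs A) (prs B) := by
  rw [Finset.disjoint_left]
  intro e
  induction e with
  | _ a b =>
    rw [mk_mem_prs, mk_mem_prs]
    rintro ⟨_, ha, _⟩ ⟨_, ha', _⟩
    exact Finset.disjoint_left.1 h ha ha'

theorem prsU_not_isDiag {n : ℕ} {ι : Type*} [Fintype ι] (V : ι → Finset (Fin n)) :
    ∀ e ∈ prsU V, ¬ e.IsDiag := by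
  intro e he
  obtain ⟨i, _, hi⟩ := Finset.mem_biUnion.1 he
  exact prs_not_isDiag _ e hi

theorem card_prsU {n : ℕ} {ι : Type*} [Fintype ι] {V : ι → Finset (Fin n)} (hV : PDj V) :
    (prsU V).card = ∑ i, (V i).card.choose 2 := by
  rw [prsU, Finset.card_biUnion fun i _ i' _ h => prs_disjoint (hV i i' h)]
  exact Finset.sum_congr rfl fun i _ => card_prs _

theorem card_tr_prsU {n : ℕ} {ι : Type*} [Fintype ι] {V : ι → Finset (Fin n)} (hV : PDj V)
    (G : SimpleGraph (Fin n)) : (tr G (prsU V)).card = inn G V := by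
  have : tr G (prsU V) = Finset.univ.biUnion fun i => tr G (prs (V i)) := by
    ext e
    simp only [tr, prsU, Finset.mem_filter, Finset.mem_biUnion, Finset.mem_univ, true_and]
    tauto
  rw [this, Finset.card_biUnion]
  · exact Finset.sum_congr rfl fun i _ => (edgesIn_eq _ _).symm
  · intro i _ i' _ h
    exact Finset.disjoint_of_subset_left (Finset.filter_subset _ _)
      (Finset.disjoint_of_subset_right (Finset.filter_subset _ _) (prs_disjoint (hV i i' h)))

theorem card_prsU_le {n : ℕ} {ι : Type*} [Fintype ι] {V : ι → Finset (Fin n)} (hV : PDj V) {m : ℕ}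
    (hm : ∑ i, (V i).card ≤ m) : (prsU V).card ≤ m ^ 2 := by
  rw [card_prsU hV]
  calc ∑ i, (V i).card.choose 2 ≤ ∑ i, (V i).card * m := by
        refine Finset.sum_le_sum fun i _ => ?_
        rw [Nat.choose_two_right]
        refine (Nat.div_le_self _ _).trans (Nat.mul_le_mul_left _ ?_)
        exact (Nat.sub_le _ _).trans
          ((Finset.single_le_sum (f := fun i => (V i).card) (fun _ _ => Nat.zero_le _)
            (Finset.mem_univ i)).trans hm)
    _ = (∑ i, (V i).card) * m := by rw [Finset.sum_mul]
    _ ≤ m ^ 2 := by rw [pow_two]; exact Nat.mul_le_mul_right _ hm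

theorem grPr_tuple_fixed {n : ℕ} {ι : Type*} [Fintype ι] (v : ι → ℕ)
    (Q : (ι → Finset (Fin n)) → Set (SimpleGraph (Fin n))) {c : ℝ} (hc : 0 ≤ c)
    (h : ∀ V, PDj V → (∀ i, (V i).card = v i) →
      grPr n (Q V) ≤ c * (1 / 2 : ℝ) ^ (∑ i, (v i).choose 2)) :
    grPr n {G | ∃ V, PDj V ∧ (∀ i, (V i).card = v i) ∧ G ∈ Q V} ≤ c * ∏ i, fv n (v i) := by
  set s : Finset (ι → Finset (Fin n)) :=
    Fintype.piFinset fun i => (Finset.univ : Finset (Fin n)).powersetCard (v i) with hs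
  have hmem : ∀ V : ι → Finset (Fin n), V ∈ s ↔ ∀ i, (V i).card = v i := by
    intro V
    simp [hs, Fintype.mem_piFinset, Finset.mem_powersetCard]
  have hcard : (s.card : ℝ) = ∏ i, (n.choose (v i) : ℝ) := by
    rw [hs, Fintype.card_piFinset]
    simp
  refine (grPr_iUnion_le (s.filter PDj) Q _ ?_).trans ?_
  · rintro G ⟨V, h1, h2, h3⟩
    exact ⟨V, Finset.mem_filter.2 ⟨(hmem V).2 h2, h1⟩, h3⟩
  · calc ∑ V ∈ s.filter PDj, grPr n (Q V)
        ≤ ∑ V ∈ s.filter PDj, c * (1 / 2 : ℝ) ^ (∑ i, (v i).choose 2) := by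
          refine Finset.sum_le_sum fun V hV => ?_
          rw [Finset.mem_filter, hmem] at hV
          exact h V hV.2 hV.1
      _ ≤ s.card * (c * (1 / 2 : ℝ) ^ (∑ i, (v i).choose 2)) := by
          rw [Finset.sum_const, nsmul_eq_mul]
          refine mul_le_mul_of_nonneg_right ?_ (by positivity)
          exact_mod_cast Finset.card_le_card (Finset.filter_subset _ _)
      _ = c * ∏ i, fv n (v i) := by
          rw [hcard]
          simp only [fv, Finset.prod_mul_distrib, Finset.prod_pow_eq_pow_sum]
          ring

theorem grPr_tuple {n : ℕ} {ι : Type*} [Fintype ι] (m : ℕ) (P : (ι → ℕ) → Prop)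
    (Q : (ι → Finset (Fin n)) → Set (SimpleGraph (Fin n))) {c F : ℝ} (hc : 0 ≤ c)
    (hF : 0 ≤ F) (hP : ∀ v : ι → ℕ, ∑ i, v i = m → P v → ∏ i, fv n (v i) ≤ F)
    (h : ∀ V, PDj V → ∑ i, (V i).card = m → P (fun i => (V i).card) →
      grPr n (Q V) ≤ c * (1 / 2 : ℝ) ^ (∑ i, (V i).card.choose 2)) :
    grPr n {G | ∃ V, PDj V ∧ ∑ i, (V i).card = m ∧ P (fun i => (V i).card) ∧ G ∈ Q V} ≤
      (m + 1 : ℝ) ^ (Fintype.card ι) * (c * F) := by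
  set s : Finset (ι → ℕ) := Fintype.piFinset fun _ => Finset.range (m + 1) with hs
  refine (grPr_iUnion_le (s.filter fun v => ∑ i, v i = m ∧ P v)
    (fun v => {G | ∃ V, PDj V ∧ (∀ i, (V i).card = v i) ∧ G ∈ Q V}) _ ?_).trans ?_
  · rintro G ⟨V, h1, h2, h3, h4⟩
    refine ⟨fun i => (V i).card, ?_, V, h1, fun i => rfl, h4⟩
    rw [Finset.mem_filter, hs, Fintype.mem_piFinset]
    refine ⟨fun i => ?_, h2, h3⟩
    rw [Finset.mem_range, Nat.lt_succ_iff, ← h2]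
    exact Finset.single_le_sum (f := fun i => (V i).card) (fun _ _ => Nat.zero_le _)
      (Finset.mem_univ i)
  · calc _ ≤ ∑ v ∈ s.filter fun v => ∑ i, v i = m ∧ P v, c * F := by
          refine Finset.sum_le_sum fun v hv => ?_
          rw [Finset.mem_filter] at hv
          refine (grPr_tuple_fixed v Q hc fun V h1 h2 => ?_).trans
            (mul_le_mul_of_nonneg_left (hP v hv.2.1 hv.2.2) hc)
          have h3 : (fun i => (V i).card) = v := funext h2
          have h4 := h V h1 (by rw [← hv.2.1]; exact Finset.sum_congr rfl fun i _ => h2 i)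
            (by rw [h3]; exact hv.2.2)
          simpa only [h2] using h4
      _ ≤ s.card * (c * F) := by
          rw [Finset.sum_const, nsmul_eq_mul]
          refine mul_le_mul_of_nonneg_right ?_ (by positivity)
          exact_mod_cast Finset.card_le_card (Finset.filter_subset _ _)
      _ = _ := by
          rw [hs, Fintype.card_piFinset]
          simp

theorem depOn_inn {n : ℕ} {ι : Type*} [Fintype ι] {V : ι → Finset (Fin n)} (hV : PDj V) (t : ℕ) :
    DepOn (prsU V : Set (Sym2 (Fin n))) {G | inn G V ≤ t} := by
  have := depOn_tr (prsU V) (fun F => F.card ≤ t)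
  simpa only [card_tr_prsU hV] using this

theorem grPr_inn_le {n : ℕ} {ι : Type*} [Fintype ι] {V : ι → Finset (Fin n)} (hV : PDj V) {m : ℕ}
    (hm : ∑ i, (V i).card ≤ m) (t : ℕ) :
    grPr n {G | inn G V ≤ t} ≤
      ((m : ℝ) ^ 2 + 1) ^ t * (1 / 2 : ℝ) ^ (∑ i, (V i).card.choose 2) := by
  have h := grPr_card_le (prsU_not_isDiag V) t
  simp only [card_tr_prsU hV] at h
  refine h.trans ?_
  rw [card_prsU hV]
  refine mul_le_mul_of_nonneg_right (pow_le_pow_left₀ (by positivity) ?_ _) (by positivity)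
  have := card_prsU_le hV hm
  rw [card_prsU hV] at this
  exact_mod_cast Nat.add_le_add_right this 1

theorem starE_disjoint {n : ℕ} {C W C' W' : Finset (Fin n)} (h1 : Disjoint C C')
    (h2 : Disjoint C W') : Disjoint (starE C W) (starE C' W') := by
  rw [Set.disjoint_left]
  rintro e ⟨c, hc, z, hz, rfl⟩ ⟨c', hc', z', hz', h⟩
  rcases Sym2.eq_iff.1 h with ⟨rfl, _⟩ | ⟨rfl, _⟩
  · exact Finset.disjoint_left.1 h1 hc hc'
  · exact Finset.disjoint_left.1 h2 hc hz'

theorem prsU_disjoint_starE {n : ℕ} {ι : Type*} [Fintype ι] {V : ι → Finset (Fin n)} (hV : PDj V)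
    {C W : Finset (Fin n)} {a b : ι} (hab : a ≠ b) (hC : C ⊆ V a) (hW : W ⊆ V b) :
    Disjoint (prsU V : Set (Sym2 (Fin n))) (starE C W) := by
  rw [Set.disjoint_left]
  rintro e he ⟨c, hc, z, hz, rfl⟩
  obtain ⟨i, _, hi⟩ := Finset.mem_biUnion.1 (Finset.mem_coe.1 he)
  rw [mk_mem_prs] at hi
  have h1 : i = a := by
    by_contra hne
    exact Finset.disjoint_left.1 (hV i a hne) hi.2.1 (hC hc)
  have h2 : i = b := by
    by_contra hne
    exact Finset.disjoint_left.1 (hV i b hne) hi.2.2 (hW hz)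
  exact hab (h1.symm.trans h2)

theorem grPr_gadgets {n : ℕ} {ι κ : Type*} [Fintype ι] {V : ι → Finset (Fin n)}
    (hV : PDj V) {m : ℕ} (hm : ∑ i, (V i).card ≤ m) (t : ℕ) (L : Finset κ)
    {C W : κ → Finset (Fin n)} {A : κ → Set (SimpleGraph (Fin n))} {a b : κ → ι}
    (hA : ∀ l ∈ L, DepOn (starE (C l) (W l)) (A l)) (hab : ∀ l ∈ L, a l ≠ b l)
    (hC : ∀ l ∈ L, C l ⊆ V (a l)) (hW : ∀ l ∈ L, W l ⊆ V (b l))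
    (hCC : ∀ l ∈ L, ∀ l' ∈ L, l ≠ l' → Disjoint (C l) (C l'))
    (hCW : ∀ l ∈ L, ∀ l' ∈ L, l ≠ l' → Disjoint (C l) (W l')) :
    grPr n ({G | inn G V ≤ t} ∩ {G | ∀ l ∈ L, G ∈ A l}) ≤
      ((m : ℝ) ^ 2 + 1) ^ t * (1 / 2 : ℝ) ^ (∑ i, (V i).card.choose 2) *
        ∏ l ∈ L, grPr n (A l) := by
  rw [← grPr_biInter_of_depOn L hA fun l hl l' hl' h =>
    starE_disjoint (hCC l hl l' hl' h) (hCW l hl l' hl' h)]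
  have h1 : DepOn (⋃ l ∈ L, starE (C l) (W l)) {G | ∀ l ∈ L, G ∈ A l} := by
    intro G G' h hG l hl
    exact hA l hl G G' (fun e he => h e (Set.mem_iUnion₂.2 ⟨l, hl, he⟩)) (hG l hl)
  rw [grPr_inter_of_depOn (depOn_inn hV t) h1]
  · exact mul_le_mul_of_nonneg_right (grPr_inn_le hV hm t) (grPr_nonneg _ _)
  · rw [Set.disjoint_iUnion₂_right]
    exact fun l hl => prsU_disjoint_starE hV (hab l hl) (hC l hl) (hW l hl)

/-- Degree threshold. -/
noncomputable def yP (k : ℕ) (l : ℝ) : ℕ := ⌈(k : ℝ) / l ^ 5⌉₊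

/-- Threshold for the number of edges inside the parts. -/
noncomputable def tP (m : ℕ) (l : ℝ) : ℕ := ⌈(m : ℝ) ^ 2 / l ^ 15⌉₊

namespace Reg
variable {n k r j : ℕ} {l x : ℝ}

theorem y_lb (R : Reg n k r j l x) : 2.885 * (x / l ^ 5) ≤ yP k l := by
  refine le_trans ?_ (Nat.le_ceil _)
  have := R.k_lb
  have := R.l_pos
  rw [← mul_div_assoc]
  gcongr

theorem div_big (R : Reg n k r j l x) {p q : ℕ} (hpq : p + q ≤ 190) :
    10 ^ 30 * l ^ q ≤ x / l ^ p := by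
  have hl := R.l_pos
  rw [le_div_iff₀ (by positivity), mul_assoc, ← pow_add]
  exact R.pow_le (by omega)

theorem y_ub (R : Reg n k r j l x) : (yP k l : ℝ) ≤ 3 * (x / l ^ 5) := by
  have h1 := Nat.ceil_lt_add_one (a := (k : ℝ) / l ^ 5) (by have := R.l_pos; positivity)
  have h2 : (k : ℝ) / l ^ 5 ≤ 2.886 * (x / l ^ 5) := by
    rw [← mul_div_assoc]
    have := R.k_ub
    have := R.l_pos
    gcongr
  have h3 := R.div_big (p := 5) (q := 0) (by norm_num)
  unfold yP
  linarith

theorem r_pos (R : Reg n k r j l x) : (1 : ℝ) ≤ r := by exact_mod_cast R.hr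

theorem m_lb (R : Reg n k r j l x) : 2.885 * x * r ≤ ((k * r + j : ℕ) : ℝ) := by
  push_cast
  have h1 := mul_le_mul_of_nonneg_right R.k_lb (Nat.cast_nonneg (α := ℝ) r)
  have h2 : (0 : ℝ) ≤ j := Nat.cast_nonneg _
  linarith

theorem m_lb' (R : Reg n k r j l x) : 2.885 * x ≤ ((k * r + j : ℕ) : ℝ) := by
  refine le_trans ?_ R.m_lb
  have := R.x_pos
  exact le_mul_of_one_le_right (by positivity) R.r_pos

theorem m_ub (R : Reg n k r j l x) : ((k * r + j : ℕ) : ℝ) ≤ 3 * x * l := by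
  push_cast
  have h0 : (j : ℝ) ≤ r := by exact_mod_cast R.hjr
  have h1 : (k : ℝ) * r ≤ 2.886 * x * l :=
    mul_le_mul R.k_ub R.hrl (by positivity) (by have := R.x_pos; positivity)
  have h2 : l * 1 ≤ l * (0.1 * x) :=
    mul_le_mul_of_nonneg_left (by linarith [R.x_big]) R.l_pos.le
  linarith [R.hrl]

theorem m_sq_ub (R : Reg n k r j l x) :
    ((k * r + j : ℕ) : ℝ) ^ 2 ≤ 9 * (x ^ 2 * l ^ 2) := by
  have := pow_le_pow_left₀ (Nat.cast_nonneg _) R.m_ub 2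
  calc _ ≤ (3 * x * l) ^ 2 := this
    _ = _ := by ring

theorem m_sq_exp (R : Reg n k r j l x) :
    ((k * r + j : ℕ) : ℝ) ^ 2 + 1 ≤ Real.exp (3 * l) := by
  have h1 := R.m_sq_ub
  have h2 := R.pow_le (p := 2) (by norm_num)
  have h3 : Real.exp (3 * l) = x ^ 3 := by
    have := R.exp_pow 3
    simpa using this
  have hx := R.x_pos
  have h4 : x ^ 2 * (10 ^ 30 * l ^ 2) ≤ x ^ 2 * x := mul_le_mul_of_nonneg_left h2 (by positivity)
  have h5 : 1 ≤ x ^ 2 * l ^ 2 := by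
    have h6 : 1 ≤ x ^ 2 := one_le_pow₀ (by linarith [R.x_big])
    have h7 : 1 ≤ l ^ 2 := one_le_pow₀ (by linarith [R.hL])
    calc (1 : ℝ) = 1 * 1 := by norm_num
      _ ≤ _ := mul_le_mul h6 h7 (by norm_num) (by positivity)
  have h6 : x ^ 2 * x = x ^ 3 := by ring
  rw [h3]
  linarith

theorem m_exp (R : Reg n k r j l x) :
    ((k * r + j : ℕ) : ℝ) + 1 ≤ Real.exp (3 * l) := by
  refine le_trans ?_ R.m_sq_exp
  have h1 := R.m_lb'
  have h2 := R.x_big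
  have h3 : (1 : ℝ) ≤ ((k * r + j : ℕ) : ℝ) := by linarith
  have := mul_le_mul_of_nonneg_left h3 (zero_le_one.trans h3)
  linarith [pow_two ((k * r + j : ℕ) : ℝ)]

theorem t_ub (R : Reg n k r j l x) : (tP (k * r + j) l : ℝ) ≤ 10 * (x ^ 2 / l ^ 13) := by
  have hl := R.l_pos
  have h1 := Nat.ceil_lt_add_one (a := ((k * r + j : ℕ) : ℝ) ^ 2 / l ^ 15) (by positivity)
  have h2 : ((k * r + j : ℕ) : ℝ) ^ 2 / l ^ 15 ≤ 9 * (x ^ 2 / l ^ 13) := by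
    calc _ ≤ 9 * (x ^ 2 * l ^ 2) / l ^ 15 := by
          have := R.m_sq_ub
          gcongr
      _ = _ := by field_simp
  have h3 := R.div_big (p := 13) (q := 0) (by norm_num)
  have h4 : x / l ^ 13 * 1 ≤ x / l ^ 13 * x :=
    mul_le_mul_of_nonneg_left (by linarith [R.x_big]) (by linarith)
  have h5 : x / l ^ 13 * x = x ^ 2 / l ^ 13 := by ring
  unfold tP
  linarith

/-- Stability event. -/
theorem bad_stab (R : Reg n k r j l x) (hr2 : 2 ≤ r) :
    grPr n {G | ∃ S : Finset (Fin n), S.card = k * r + j ∧ G.CliqueFreeOn ↑S (r + 1) ∧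
      ∀ c : Fin n → Fin r, tP (k * r + j) l ≤ ∑ i, edgesIn G (S.filter (c · = i))} ≤
    Real.exp (-(x / 20)) := by
  have hl := R.l_pos
  have hx := R.x_pos
  have hlb := R.m_lb'
  have hub := R.m_ub
  have htl : ((k * r + j : ℕ) : ℝ) ^ 2 / l ^ 15 ≤ tP (k * r + j) l := Nat.le_ceil _
  have htu := Nat.ceil_lt_add_one (a := ((k * r + j : ℕ) : ℝ) ^ 2 / l ^ 15) (by positivity)
  have hkm : (k : ℝ) * r ≤ ((k * r + j : ℕ) : ℝ) := by push_cast; linarith [Nat.cast_nonneg (α := ℝ) j]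
  change (tP (k * r + j) l : ℝ) < _ at htu
  generalize tP (k * r + j) l = T at *
  generalize k * r + j = m at *
  have hl15 : (10 : ℝ) ^ 45 ≤ l ^ 15 := by
    calc (10 : ℝ) ^ 45 = 1000 ^ 15 := by norm_num
      _ ≤ _ := pow_le_pow_left₀ (by norm_num) R.hL 15
  have hl2 : (10 : ℝ) ^ 6 ≤ l ^ 2 := by
    calc (10 : ℝ) ^ 6 = 1000 ^ 2 := by norm_num
      _ ≤ _ := pow_le_pow_left₀ (by norm_num) R.hL 2
  have hm1 : (1 : ℝ) ≤ (m : ℝ) ^ 2 / 100 := by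
    have h1 := R.x_big
    have h2 : (10 : ℝ) ≤ m := by linarith
    have := mul_le_mul h2 h2 (by norm_num) (by linarith)
    linarith [pow_two (m : ℝ)]
  have hm2 : (m : ℝ) ^ 2 / l ^ 15 ≤ (m : ℝ) ^ 2 / 100 := by
    gcongr; linarith
  have hr2' : (2 : ℝ) ≤ r := by exact_mod_cast hr2
  have hrr : (1 : ℝ) / r ≤ 1 / 2 := by gcongr
  refine (grPr_iUnion_le ((Finset.univ : Finset (Fin n)).powersetCard m)
    (fun S => {G | G.CliqueFreeOn ↑S (r + 1) ∧
      ∀ c : Fin n → Fin r, T ≤ ∑ i, edgesIn G (S.filter (c · = i))}) _ ?_).trans ?_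
  · rintro G ⟨S, h1, h2⟩
    exact ⟨S, by simp [h1], h2⟩
  have key : ∀ S ∈ (Finset.univ : Finset (Fin n)).powersetCard m,
      grPr n {G | G.CliqueFreeOn ↑S (r + 1) ∧
        ∀ c : Fin n → Fin r, T ≤ ∑ i, edgesIn G (S.filter (c · = i))} ≤
      Real.exp (-(((m : ℝ) ^ 2 / (2 * r) + T) * Real.log 2) + (m : ℝ) ^ 2 / l ^ 17) := by
    intro S hS
    have hc : S.card = m := (Finset.mem_powersetCard.1 hS).2
    rw [← hc]
    refine R.stab_bound S R.hr le_rfl ?_ ?_ ?_ <;> rw [hc]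
    · refine le_trans (div_le_self hx.le ?_) (by linarith)
      exact one_le_pow₀ (by linarith [R.hL])
    · exact hub
    · have : (1 / 2 : ℝ) * (m : ℝ) ^ 2 ≤ (1 - 1 / r) * (m : ℝ) ^ 2 := by
        gcongr; linarith
      linarith
  refine (Finset.sum_le_sum key).trans ?_
  rw [Finset.sum_const, nsmul_eq_mul, Finset.card_powersetCard, Finset.card_univ,
    Fintype.card_fin]
  have hnm : ((n.choose m : ℕ) : ℝ) ≤ Real.exp (m * x) := by
    calc ((n.choose m : ℕ) : ℝ) ≤ (n : ℝ) ^ m := by exact_mod_cast Nat.choose_le_pow n m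
      _ = _ := by rw [R.hn, ← Real.exp_nat_mul]
  refine (mul_le_mul_of_nonneg_right hnm (Real.exp_pos _).le).trans ?_
  rw [← Real.exp_add, Real.exp_le_exp]
  have ha := Real.log_two_gt_d9
  have h1 : (m : ℝ) * (x - l ^ 2 / 2) ≤ (m : ℝ) ^ 2 / (2 * r) * Real.log 2 := by
    calc (m : ℝ) * (x - l ^ 2 / 2) ≤ m * (k * Real.log 2 / 2) := by
          refine mul_le_mul_of_nonneg_left ?_ (Nat.cast_nonneg _)
          linarith [R.hk1]
      _ = (k * r) * (m / (2 * r) * Real.log 2) := by field_simp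
      _ ≤ m * (m / (2 * r) * Real.log 2) := mul_le_mul_of_nonneg_right hkm (by positivity)
      _ = _ := by ring
  have h2 : (m : ℝ) ^ 2 / l ^ 17 ≤ (m : ℝ) ^ 2 / l ^ 15 / 10 := by
    have : (m : ℝ) ^ 2 / l ^ 17 = (m : ℝ) ^ 2 / l ^ 15 / l ^ 2 := by field_simp
    rw [this]
    gcongr; linarith
  have h3 : (m : ℝ) ^ 2 / l ^ 15 * 0.6 ≤ T * Real.log 2 :=
    mul_le_mul htl (by linarith) (by norm_num) (by positivity)
  have h4 : 2 * l ^ 2 ≤ m / l ^ 15 := by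
    have h5 := R.div_big (p := 15) (q := 2) (by norm_num)
    have h6 : x / l ^ 15 ≤ m / l ^ 15 := by gcongr; linarith
    linarith
  have h5 : (m : ℝ) * (2 * l ^ 2) ≤ m * (m / l ^ 15) :=
    mul_le_mul_of_nonneg_left h4 (Nat.cast_nonneg _)
  have h6 : (m : ℝ) * (m / l ^ 15) = (m : ℝ) ^ 2 / l ^ 15 := by ring
  have h7 : (m : ℝ) * 1 ≤ m * l ^ 2 := mul_le_mul_of_nonneg_left (by linarith) (Nat.cast_nonneg _)
  linarith

end Reg

theorem depOn_cliqueFreeOn {n : ℕ} (Y : Finset (Fin n)) (s : ℕ) :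
    DepOn (prs Y : Set (Sym2 (Fin n))) {G | G.CliqueFreeOn ↑Y s} := by
  intro G G' h hG
  simp only [Set.mem_ofPred_eq] at hG ⊢
  intro t ht hc
  refine hG ht ⟨?_, hc.2⟩
  intro a ha b hb hab
  have h1 := hc.1 ha hb hab
  have h2 := h s(a, b) (Finset.mem_coe.2 (mk_mem_prs.2 ⟨hab, ht ha, ht hb⟩))
  rw [SimpleGraph.mem_edgeSet, SimpleGraph.mem_edgeSet] at h2
  first
    | exact h2.1 h1
    | exact h2.2 h1

theorem card_prsU_inter_le {n : ℕ} {ι : Type*} [Fintype ι] {V : ι → Finset (Fin n)} (hV : PDj V)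
    {Y : Finset (Fin n)} {y : ℕ} (hY : ∀ i, (Y ∩ V i).card ≤ y) :
    ((prsU V ∩ prs Y).card : ℝ) ≤ (Y.card : ℝ) * y / 2 := by
  have h1 : prsU V ∩ prs Y ⊆ Finset.univ.biUnion fun i => prs (Y ∩ V i) := by
    intro e he
    rw [Finset.mem_inter] at he
    obtain ⟨i, _, hi⟩ := Finset.mem_biUnion.1 he.1
    refine Finset.mem_biUnion.2 ⟨i, Finset.mem_univ _, ?_⟩
    induction e with
    | _ a b =>
      rw [mk_mem_prs] at hi ⊢
      have h2 := mk_mem_prs.1 he.2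
      exact ⟨hi.1, Finset.mem_inter.2 ⟨h2.2.1, hi.2.1⟩, Finset.mem_inter.2 ⟨h2.2.2, hi.2.2⟩⟩
  have h2 : ∑ i, (Y ∩ V i).card ≤ Y.card := by
    rw [← Finset.card_biUnion]
    · exact Finset.card_le_card (Finset.biUnion_subset.2 fun i _ => Finset.inter_subset_left)
    · intro i _ i' _ h
      exact Finset.disjoint_of_subset_left Finset.inter_subset_right
        (Finset.disjoint_of_subset_right Finset.inter_subset_right (hV i i' h))
  calc ((prsU V ∩ prs Y).card : ℝ) ≤ ∑ i, (((Y ∩ V i).card.choose 2 : ℕ) : ℝ) := by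
        have := (Finset.card_le_card h1).trans Finset.card_biUnion_le
        simp only [card_prs] at this
        exact_mod_cast this
    _ ≤ ∑ i, ((Y ∩ V i).card : ℝ) * y / 2 := by
        refine Finset.sum_le_sum fun i _ => ?_
        rw [choose_two_real]
        have : ((Y ∩ V i).card : ℝ) ≤ y := by exact_mod_cast hY i
        gcongr
        linarith
    _ = (∑ i, ((Y ∩ V i).card : ℝ)) * y / 2 := by rw [Finset.sum_mul, Finset.sum_div]
    _ ≤ _ := by
        gcongr
        exact_mod_cast h2

theorem grPr_inn_cliqueFree {n : ℕ} {ι : Type*} [Fintype ι] {V : ι → Finset (Fin n)} (hV : PDj V)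
    {m : ℕ} (hm : ∑ i, (V i).card ≤ m) (t s : ℕ) {Y : Finset (Fin n)} {y : ℕ}
    (hY : ∀ i, (Y ∩ V i).card ≤ y) :
    grPr n {G | inn G V ≤ t ∧ G.CliqueFreeOn ↑Y s} ≤
      ((m : ℝ) ^ 2 + 1) ^ t * (1 / 2 : ℝ) ^ (∑ i, (V i).card.choose 2) *
        Real.exp ((Y.card : ℝ) * y / 2 * Real.log 2) * grPr n {G | G.CliqueFreeOn ↑Y s} := by
  set D := prsU V \ prs Y with hD
  have h1 : grPr n {G | inn G V ≤ t ∧ G.CliqueFreeOn ↑Y s} ≤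
      grPr n ({G | (tr G D).card ≤ t} ∩ {G | G.CliqueFreeOn ↑Y s}) := by
    refine grPr_mono fun G hG => ⟨?_, hG.2⟩
    refine le_trans (Finset.card_le_card ?_) ((card_tr_prsU hV G).trans_le hG.1)
    exact Finset.filter_subset_filter _ Finset.sdiff_subset
  refine h1.trans ?_
  rw [grPr_inter_of_depOn (depOn_tr D (fun F => F.card ≤ t)) (depOn_cliqueFreeOn Y s)]
  · refine mul_le_mul_of_nonneg_right ?_ (grPr_nonneg _ _)
    refine (grPr_card_le (fun e he => prsU_not_isDiag V e (Finset.mem_sdiff.1 he).1) t).trans ?_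
    rw [mul_assoc]
    have h2 : (D.card : ℝ) ≤ (m : ℝ) ^ 2 := by
      exact_mod_cast (Finset.card_le_card Finset.sdiff_subset).trans (card_prsU_le hV hm)
    refine mul_le_mul (pow_le_pow_left₀ (by positivity) (by linarith) _) ?_ (by positivity)
      (by positivity)
    have h3 := Finset.card_sdiff_add_card_inter (prsU V) (prs Y)
    rw [card_prsU hV] at h3
    have h4 := card_prsU_inter_le hV hY
    rw [← h3, pow_add, half_pow_eq ((prsU V ∩ prs Y).card), mul_assoc, ← Real.exp_add]
    refine le_mul_of_one_le_right (by positivity) (Real.one_le_exp ?_)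
    have := mul_le_mul_of_nonneg_right h4 (Real.log_nonneg one_le_two)
    linarith
  · rw [Set.disjoint_left]
    intro e he he'
    exact (Finset.mem_sdiff.1 (Finset.mem_coe.1 he)).2 (Finset.mem_coe.1 he')

namespace Reg
variable {n k r j : ℕ} {l x : ℝ}

theorem prod_fv_le' (R : Reg n k r j l x) (h : fv n (k + 1) ≤ Real.exp l) (v : Fin r → ℕ)
    (hv : ∑ i, v i = k * r + j) : ∏ i, fv n (v i) ≤ Real.exp ((r - j) * x + 20 * l ^ 5) := by
  refine (R.prod_fv_le h v hv).trans (Real.exp_le_exp.2 ?_)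
  have h1 : 0 ≤ (∑ i, ((v i : ℝ) - k) ^ 2) / 8 :=
    div_nonneg (Finset.sum_nonneg fun _ _ => sq_nonneg _) (by norm_num)
  have h2 : (r : ℝ) * l ^ 4 ≤ l * l ^ 4 :=
    mul_le_mul_of_nonneg_right R.hrl (pow_nonneg R.l_pos.le _)
  have h3 : l * l ^ 4 = l ^ 5 := by ring
  linarith

theorem tuple_cost (R : Reg n k r j l x) :
    (((k * r + j : ℕ) : ℝ) + 1) ^ (Fintype.card (Fin r)) ≤ Real.exp (3 * l ^ 2) := by
  rw [Fintype.card_fin]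
  calc _ ≤ Real.exp (3 * l) ^ r := pow_le_pow_left₀ (by positivity) R.m_exp r
    _ = Real.exp (r * (3 * l)) := by rw [Real.exp_nat_mul]
    _ ≤ _ := by
      rw [Real.exp_le_exp]
      have := mul_le_mul_of_nonneg_right R.hrl (by linarith [R.l_pos] : (0 : ℝ) ≤ 3 * l)
      linarith [pow_two l]

theorem inn_cost (R : Reg n k r j l x) (t : ℕ) :
    (((k * r + j : ℕ) : ℝ) ^ 2 + 1) ^ t ≤ Real.exp (3 * l * t) := by
  calc _ ≤ Real.exp (3 * l) ^ t := pow_le_pow_left₀ (by positivity) R.m_sq_exp t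
    _ = Real.exp (t * (3 * l)) := by rw [Real.exp_nat_mul]
    _ = _ := by congr 1; ring

theorem t_cost (R : Reg n k r j l x) :
    3 * l * tP (k * r + j) l ≤ 30 * (x ^ 2 / l ^ 12) := by
  have hl := R.l_pos
  calc 3 * l * (tP (k * r + j) l : ℝ) ≤ 3 * l * (10 * (x ^ 2 / l ^ 13)) :=
        mul_le_mul_of_nonneg_left R.t_ub (by positivity)
    _ = _ := by field_simp; ring

theorem rj_le (R : Reg n k r j l x) : ((r : ℝ) - j) * x ≤ l * x := by
  refine mul_le_mul_of_nonneg_right ?_ R.x_pos.le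
  linarith [R.hrl, Nat.cast_nonneg (α := ℝ) j]

/-- Unbalanced part sizes. -/
theorem bad_size (R : Reg n k r j l x) (h : fv n (k + 1) ≤ Real.exp l) :
    grPr n {G | ∃ V : Fin r → Finset (Fin n), PDj V ∧ ∑ i, (V i).card = k * r + j ∧
      (∃ i, ((V i).card : ℝ) < 0.99 * k) ∧ G ∈ {G | inn G V ≤ tP (k * r + j) l}} ≤
    Real.exp (-(x / 20)) := by
  have hk := R.k_lb
  have hx := R.x_big
  have hl := R.hL
  refine (grPr_tuple (k * r + j) (fun v : Fin r → ℕ => ∃ i, (v i : ℝ) < 0.99 * k)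
    (fun V => {G | inn G V ≤ tP (k * r + j) l})
    (c := Real.exp (3 * l * tP (k * r + j) l))
    (F := Real.exp ((r - j) * x + 20 * r * l ^ 4 - x ^ 2 / 80000))
    (Real.exp_pos _).le (Real.exp_pos _).le ?_ ?_).trans ?_
  · rintro v hv ⟨i, hi⟩
    refine (R.prod_fv_le h v hv).trans (Real.exp_le_exp.2 ?_)
    have h1 : ((v i : ℝ) - k) ^ 2 ≤ ∑ i, ((v i : ℝ) - k) ^ 2 :=
      Finset.single_le_sum (f := fun i => ((v i : ℝ) - k) ^ 2) (fun _ _ => sq_nonneg _)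
        (Finset.mem_univ i)
    have h2 : (x / 100) ^ 2 ≤ ((v i : ℝ) - k) ^ 2 := by
      rw [← neg_sq ((v i : ℝ) - k)]
      exact pow_le_pow_left₀ (by positivity) (by linarith) 2
    have h3 : (x / 100) ^ 2 = x ^ 2 / 10000 := by ring
    linarith
  · intro V hV hm _
    refine (grPr_inn_le hV hm.le _).trans ?_
    exact mul_le_mul_of_nonneg_right (R.inn_cost _) (by positivity)
  · refine (mul_le_mul_of_nonneg_right R.tuple_cost (by positivity)).trans ?_
    rw [← Real.exp_add, ← Real.exp_add, Real.exp_le_exp]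
    have h1 := R.t_cost
    have h2 := R.rj_le
    have h3 : (r : ℝ) * l ^ 4 ≤ l * l ^ 4 :=
      mul_le_mul_of_nonneg_right R.hrl (pow_nonneg R.l_pos.le _)
    have h4 : l * l ^ 4 = l ^ 5 := by ring
    have h5 := R.pow_le (p := 5) (by norm_num)
    have h6 := R.pow_le (p := 2) (by norm_num)
    have h7 := R.pow_le (p := 1) (by norm_num)
    rw [pow_one] at h7
    have h8 : x * (10 ^ 30 * l) ≤ x * x := mul_le_mul_of_nonneg_left h7 R.x_pos.le
    have h9 : x * 10 ^ 30 ≤ x * x := mul_le_mul_of_nonneg_left hx R.x_pos.le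
    have h10 : x ^ 2 / l ^ 12 ≤ x ^ 2 / 10 ^ 36 := by
      gcongr
      calc (10 : ℝ) ^ 36 = 1000 ^ 12 := by norm_num
        _ ≤ _ := pow_le_pow_left₀ (by norm_num) R.hL 12
    rw [pow_two] at *
    linarith

theorem clique_saving (R : Reg n k r j l x) {s : ℕ} (hs1 : 2 ≤ s) (hs : s ≤ r)
    {Y : Finset (Fin n)} (hY : Y.card = s * yP k l) :
    Real.exp ((Y.card : ℝ) * yP k l / 2 * Real.log 2) * grPr n {G | G.CliqueFreeOn ↑Y s} ≤
      Real.exp (-(0.3 * (yP k l : ℝ) ^ 2)) := by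
  have hl := R.l_pos
  have hylb := R.y_lb
  have hyub := R.y_ub
  have hx := R.x_pos
  obtain ⟨q, rfl⟩ : ∃ q, s = q + 1 := ⟨s - 1, by omega⟩
  have hq1 : 1 ≤ q := by omega
  have hq1' : (1 : ℝ) ≤ q := by exact_mod_cast hq1
  have hsl : ((q : ℝ) + 1) ≤ l := le_trans (by exact_mod_cast hs) R.hrl
  have hc : (Y.card : ℝ) = (q + 1) * yP k l := by rw [hY]; push_cast; ring
  have hxl : 0 < x / l ^ 5 := by positivity
  generalize (yP k l) = y at *
  have h1 := R.stab_bound Y (q := q) (t := 0) hq1 (by omega) (by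
      rw [hc]
      have h2 : x / l ^ 6 ≤ x / l ^ 5 := by
        gcongr
        · linarith [R.hL]
        · norm_num
      have h3 : (1 : ℝ) * y ≤ (q + 1) * y := by gcongr; linarith
      linarith) (by
      rw [hc]
      have h2 : ((q : ℝ) + 1) * y ≤ l * (3 * (x / l ^ 5)) := mul_le_mul hsl hyub (by positivity)
        (by positivity)
      have h3 : x / l ^ 5 ≤ x := div_le_self hx.le (one_le_pow₀ (by linarith [R.hL]))
      have h4 : l * (x / l ^ 5) ≤ l * x := mul_le_mul_of_nonneg_left h3 hl.le
      linarith) (by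
      have h2 : (1 : ℝ) / q ≤ 1 := by rw [div_le_one (by linarith)]; exact hq1'
      have h3 : 0 ≤ (1 - (1 : ℝ) / q) * (Y.card : ℝ) ^ 2 := by
        apply mul_nonneg <;> [linarith; positivity]
      simpa using h3)
  have h2 := (grPr_mono (S := {G : SimpleGraph (Fin n) | G.CliqueFreeOn ↑Y (q + 1)})
    fun G hG => Set.mem_ofPred_eq ▸ And.intro hG fun c => Nat.zero_le _).trans h1
  refine (mul_le_mul_of_nonneg_left h2 (Real.exp_pos _).le).trans ?_
  rw [← Real.exp_add, Real.exp_le_exp, hc]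
  have ha := Real.log_two_gt_d9
  have e1 : (((q : ℝ) + 1) * y) ^ 2 / (2 * q) = ((q : ℝ) + 1) * y * y / 2 + y ^ 2 / 2 +
      y ^ 2 / (2 * q) := by field_simp; ring
  have e2 : 0 ≤ (y : ℝ) ^ 2 / (2 * q) * Real.log 2 := by positivity
  have e3 : (((q : ℝ) + 1) * y) ^ 2 / l ^ 17 ≤ (y : ℝ) ^ 2 / 100 := by
    calc (((q : ℝ) + 1) * y) ^ 2 / l ^ 17 ≤ (l * y) ^ 2 / l ^ 17 := by gcongr
      _ = y ^ 2 / l ^ 15 := by field_simp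
      _ ≤ _ := by
        gcongr
        calc (100 : ℝ) ≤ 1000 ^ 15 := by norm_num
          _ ≤ _ := pow_le_pow_left₀ (by norm_num) R.hL 15
  have e4 : (y : ℝ) ^ 2 / 2 * 0.69 ≤ (y : ℝ) ^ 2 / 2 * Real.log 2 := by gcongr; linarith
  rw [e1]
  have e5 : 0 ≤ (y : ℝ) ^ 2 := by positivity
  push_cast
  linarith

/-- A large `K_s`-free set meeting each part in few vertices. -/
theorem bad_free (R : Reg n k r j l x) (h : fv n (k + 1) ≤ Real.exp l) {s : ℕ} (hs1 : 1 ≤ s)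
    (hs : s ≤ r) :
    grPr n {G | ∃ V : Fin r → Finset (Fin n), PDj V ∧ ∑ i, (V i).card = k * r + j ∧ True ∧
      G ∈ {G | inn G V ≤ tP (k * r + j) l ∧ ∃ Y ⊆ Finset.univ.biUnion V, Y.card = s * yP k l ∧
        (∀ i, (Y ∩ V i).card ≤ yP k l) ∧ G.CliqueFreeOn ↑Y s}} ≤
    Real.exp (-(x / 20)) := by
  have hx := R.x_big
  have hl := R.hL
  have hylb := R.y_lb
  have hyub := R.y_ub
  have hdb := R.div_big (p := 5) (q := 0) (by norm_num)
  rcases Nat.lt_or_ge 1 s with hs2 | hs2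
  swap
  · obtain rfl : s = 1 := by omega
    have hy : 0 < yP k l := by
      have : (0 : ℝ) < yP k l := by linarith
      exact_mod_cast this
    refine le_trans (le_of_eq ?_) (Real.exp_pos _).le
    rw [← grPr_empty (n := n)]
    congr 1
    rw [Set.eq_empty_iff_forall_notMem]
    rintro G ⟨V, _, _, _, _, Y, _, hY, _, hf⟩
    obtain ⟨u, hu⟩ := Finset.card_pos.1 (by rw [hY]; omega : 0 < Y.card)
    refine hf (t := {u}) (by simpa using hu) ?_
    rw [SimpleGraph.isNClique_iff]
    simp
  refine (grPr_tuple (k * r + j) (fun v : Fin r → ℕ => True)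
    (fun V => {G | inn G V ≤ tP (k * r + j) l ∧ ∃ Y ⊆ Finset.univ.biUnion V,
      Y.card = s * yP k l ∧ (∀ i, (Y ∩ V i).card ≤ yP k l) ∧ G.CliqueFreeOn ↑Y s})
    (c := Real.exp (3 * l ^ 2 * yP k l + 3 * l * tP (k * r + j) l - 0.3 * (yP k l : ℝ) ^ 2))
    (F := Real.exp ((r - j) * x + 20 * l ^ 5))
    (Real.exp_pos _).le (Real.exp_pos _).le (fun v hv _ => R.prod_fv_le' h v hv) ?_).trans ?_
  · intro V hV hm _
    have hUc : (Finset.univ.biUnion V).card ≤ k * r + j := hm ▸ Finset.card_biUnion_le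
    refine (grPr_iUnion_le (((Finset.univ.biUnion V).powersetCard (s * yP k l)).filter
      fun Y => ∀ i, (Y ∩ V i).card ≤ yP k l)
      (fun Y => {G | inn G V ≤ tP (k * r + j) l ∧ G.CliqueFreeOn ↑Y s}) _ ?_).trans ?_
    · rintro G ⟨h1, Y, h2, h3, h4, h5⟩
      exact ⟨Y, Finset.mem_filter.2 ⟨Finset.mem_powersetCard.2 ⟨h2, h3⟩, h4⟩, h1, h5⟩
    have key : ∀ Y ∈ ((Finset.univ.biUnion V).powersetCard (s * yP k l)).filter
        fun Y => ∀ i, (Y ∩ V i).card ≤ yP k l,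
        grPr n {G | inn G V ≤ tP (k * r + j) l ∧ G.CliqueFreeOn ↑Y s} ≤
          Real.exp (3 * l * tP (k * r + j) l - 0.3 * (yP k l : ℝ) ^ 2) *
            (1 / 2 : ℝ) ^ (∑ i, (V i).card.choose 2) := by
      intro Y hY
      rw [Finset.mem_filter, Finset.mem_powersetCard] at hY
      refine (grPr_inn_cliqueFree hV hm.le _ s hY.2).trans ?_
      rw [mul_assoc]
      refine (mul_le_mul_of_nonneg_left (R.clique_saving hs2 hs hY.1.2) (by positivity)).trans ?_
      rw [sub_eq_add_neg, Real.exp_add]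
      have := mul_le_mul_of_nonneg_right (R.inn_cost (tP (k * r + j) l))
        (by positivity : 0 ≤ (1 / 2 : ℝ) ^ (∑ i, (V i).card.choose 2) *
          Real.exp (-(0.3 * (yP k l : ℝ) ^ 2)))
      linarith
    refine (Finset.sum_le_sum key).trans ?_
    have e : Real.exp (3 * l ^ 2 * yP k l + 3 * l * tP (k * r + j) l - 0.3 * (yP k l : ℝ) ^ 2) =
        Real.exp (3 * l ^ 2 * yP k l) *
          Real.exp (3 * l * tP (k * r + j) l - 0.3 * (yP k l : ℝ) ^ 2) := by
      rw [← Real.exp_add, add_sub_assoc]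
    rw [Finset.sum_const, nsmul_eq_mul, e, mul_assoc (Real.exp (3 * l ^ 2 * yP k l))]
    refine mul_le_mul_of_nonneg_right ?_ (mul_nonneg (Real.exp_pos _).le (by positivity))
    calc _ ≤ (((Finset.univ.biUnion V).powersetCard (s * yP k l)).card : ℝ) := by
          exact_mod_cast Finset.card_le_card (Finset.filter_subset _ _)
      _ ≤ (((k * r + j : ℕ) : ℝ) + 1) ^ (s * yP k l) := by
          rw [Finset.card_powersetCard]
          have h1 : (Finset.univ.biUnion V).card.choose (s * yP k l) ≤
              (k * r + j + 1) ^ (s * yP k l) :=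
            (Nat.choose_le_pow _ _).trans (Nat.pow_le_pow_left (by omega) _)
          exact_mod_cast h1
      _ ≤ Real.exp (3 * l) ^ (s * yP k l) := pow_le_pow_left₀ (by positivity) R.m_exp _
      _ = Real.exp ((s * yP k l : ℕ) * (3 * l)) := by rw [Real.exp_nat_mul]
      _ ≤ _ := by
          rw [Real.exp_le_exp]
          have h1 : (s : ℝ) ≤ l := le_trans (by exact_mod_cast hs) R.hrl
          have h2 := mul_le_mul_of_nonneg_right h1
            (by have := R.l_pos; positivity : (0 : ℝ) ≤ (yP k l : ℝ) * (3 * l))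
          push_cast
          linarith [pow_two l]
  · refine (mul_le_mul_of_nonneg_right R.tuple_cost (by positivity)).trans ?_
    rw [← Real.exp_add, ← Real.exp_add, Real.exp_le_exp]
    have hl0 := R.l_pos
    have h1 := R.t_cost
    have h2 := R.rj_le
    have h5 := R.pow_le (p := 5) (by norm_num)
    have h6 := R.pow_le (p := 2) (by norm_num)
    have h7 := R.div_big (p := 10) (q := 1) (by norm_num)
    have h8 : x * (10 ^ 30 * l ^ 1) ≤ x * (x / l ^ 10) :=
      mul_le_mul_of_nonneg_left h7 R.x_pos.le
    have h9 : x * (x / l ^ 10) = x ^ 2 / l ^ 10 := by ring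
    have h10 : x ^ 2 / l ^ 12 ≤ x ^ 2 / l ^ 10 / 10 ^ 6 := by
      have : x ^ 2 / l ^ 12 = x ^ 2 / l ^ 10 / l ^ 2 := by field_simp
      rw [this]
      gcongr
      calc (10 : ℝ) ^ 6 = 1000 ^ 2 := by norm_num
        _ ≤ _ := pow_le_pow_left₀ (by norm_num) R.hL 2
    have h11 : (2.885 * (x / l ^ 5)) ^ 2 ≤ (yP k l : ℝ) ^ 2 :=
      pow_le_pow_left₀ (by linarith) hylb 2
    have h12 : (2.885 * (x / l ^ 5)) ^ 2 = 2.885 ^ 2 * (x ^ 2 / l ^ 10) := by ring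
    have h13 : l ^ 2 * (yP k l : ℝ) ≤ l ^ 2 * (3 * (x / l ^ 5)) :=
      mul_le_mul_of_nonneg_left hyub (by positivity)
    have h14 : l ^ 2 * (3 * (x / l ^ 5)) = 3 * (x / l ^ 3) := by field_simp
    have h15 : x / l ^ 3 ≤ x := div_le_self R.x_pos.le (one_le_pow₀ (by linarith))
    have h16 : x * 1000 ≤ x * l := mul_le_mul_of_nonneg_left hl R.x_pos.le
    rw [h12] at h11
    rw [pow_one] at h8
    linarith

end Reg

theorem log_four_thirds : 0.2874 ≤ Real.log (4 / 3) := by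
  have h1 : (41 : ℝ) * Real.log 3 ≤ 65 * Real.log 2 := by
    have := Real.log_le_log (by norm_num) (by norm_num : (3 : ℝ) ^ 41 ≤ 2 ^ 65)
    rw [Real.log_pow, Real.log_pow] at this
    exact_mod_cast this
  rw [Real.log_div (by norm_num) (by norm_num), show (4 : ℝ) = 2 ^ 2 by norm_num, Real.log_pow]
  have := Real.log_two_gt_d9
  push_cast
  linarith

theorem log_eight_fifths : 0.4695 ≤ Real.log (8 / 5) := by
  have h1 : (31 : ℝ) * Real.log 5 ≤ 72 * Real.log 2 := by
    have := Real.log_le_log (by norm_num) (by norm_num : (5 : ℝ) ^ 31 ≤ 2 ^ 72)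
    rw [Real.log_pow, Real.log_pow] at this
    exact_mod_cast this
  rw [Real.log_div (by norm_num) (by norm_num), show (8 : ℝ) = 2 ^ 3 by norm_num, Real.log_pow]
  have := Real.log_two_gt_d9
  push_cast
  linarith

theorem pow_sub_le_exp {ρ c : ℝ} (hρ : 0 < ρ) (hc : 0 ≤ c) (h : c ≤ Real.log (1 / ρ)) (w y : ℕ) :
    ρ ^ (w - y) ≤ Real.exp (-(c * w) + c * y) := by
  have h1 : ρ ≤ Real.exp (-c) := by
    rw [← Real.exp_log hρ, Real.exp_le_exp]
    rw [one_div, Real.log_inv] at h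
    linarith
  calc ρ ^ (w - y) ≤ Real.exp (-c) ^ (w - y) := pow_le_pow_left₀ hρ.le h1 _
    _ = Real.exp ((w - y : ℕ) * (-c)) := by rw [Real.exp_nat_mul]
    _ ≤ _ := by
      rw [Real.exp_le_exp]
      have h2 : (w : ℝ) ≤ (w - y : ℕ) + y := by
        exact_mod_cast (by omega : w ≤ w - y + y)
      have := mul_le_mul_of_nonneg_right h2 hc
      linarith

namespace Reg
variable {n k r j : ℕ} {l x : ℝ}

theorem y_small (R : Reg n k r j l x) : l ^ 4 * (yP k l : ℝ) ≤ x / 100 := by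
  have hl := R.l_pos
  calc l ^ 4 * (yP k l : ℝ) ≤ l ^ 4 * (3 * (x / l ^ 5)) :=
        mul_le_mul_of_nonneg_left R.y_ub (by positivity)
    _ = 3 * x / l := by field_simp
    _ ≤ 3 * x / 1000 := by
      have := R.x_pos
      have := R.hL
      gcongr
    _ ≤ _ := by linarith [R.x_pos]

theorem ly_small (R : Reg n k r j l x) {p : ℕ} (hp : p ≤ 2) :
    l ^ p * (yP k l : ℝ) ≤ x / 10 ^ 8 := by
  have hl := R.hL
  have h0 : (0 : ℝ) ≤ yP k l := Nat.cast_nonneg _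
  have h1 : l ^ p ≤ l ^ 2 := pow_le_pow_right₀ (by linarith) hp
  have h2 : (1000 : ℝ) ^ 2 ≤ l ^ 2 := pow_le_pow_left₀ (by norm_num) hl 2
  have h3 : l ^ 2 * (1000 : ℝ) ^ 2 ≤ l ^ 2 * l ^ 2 :=
    mul_le_mul_of_nonneg_left h2 (by positivity)
  have h4 : l ^ 2 * l ^ 2 = l ^ 4 := by ring
  have h5 : l ^ p ≤ l ^ 4 / 10 ^ 6 := by linarith
  have h6 := mul_le_mul_of_nonneg_right h5 h0
  have h7 := R.y_small
  linarith

theorem rho_one (R : Reg n k r j l x) {w : ℕ} (hw : (w : ℝ) + 1 ≤ Real.exp (3 * l)) :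
    ((w : ℝ) + 1) ^ yP k l * (3 / 4 : ℝ) ^ (w - yP k l) ≤
      Real.exp (-(0.2874 * w) + 0.001 * x) := by
  have h1 : ((w : ℝ) + 1) ^ yP k l ≤ Real.exp (yP k l * (3 * l)) := by
    rw [Real.exp_nat_mul]
    exact pow_le_pow_left₀ (by positivity) hw _
  have h2 := pow_sub_le_exp (ρ := 3 / 4) (c := 0.2874) (by norm_num) (by norm_num)
    (by simpa using log_four_thirds) w (yP k l)
  refine (mul_le_mul h1 h2 (by positivity) (by positivity)).trans ?_
  rw [← Real.exp_add, Real.exp_le_exp]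
  have h3 := R.ly_small (p := 1) (by norm_num)
  have h4 := R.ly_small (p := 0) (by norm_num)
  have := R.x_pos
  rw [pow_one] at h3
  rw [pow_zero, one_mul] at h4
  linarith

theorem rho_two (R : Reg n k r j l x) {w : ℕ} (hw : (w : ℝ) + 1 ≤ Real.exp (3 * l)) :
    ((w : ℝ) + 1) ^ (2 * yP k l) * (5 / 8 : ℝ) ^ (w - 2 * yP k l) ≤
      Real.exp (-(0.4695 * w) + 0.001 * x) := by
  have h1 : ((w : ℝ) + 1) ^ (2 * yP k l) ≤ Real.exp ((2 * yP k l : ℕ) * (3 * l)) := by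
    rw [Real.exp_nat_mul]
    exact pow_le_pow_left₀ (by positivity) hw _
  have h2 := pow_sub_le_exp (ρ := 5 / 8) (c := 0.4695) (by norm_num) (by norm_num)
    (by simpa using log_eight_fifths) w (2 * yP k l)
  refine (mul_le_mul h1 h2 (by positivity) (by positivity)).trans ?_
  rw [← Real.exp_add, Real.exp_le_exp]
  have h3 := R.ly_small (p := 1) (by norm_num)
  have h4 := R.ly_small (p := 0) (by norm_num)
  have := R.x_pos
  rw [pow_one] at h3
  rw [pow_zero, one_mul] at h4
  push_cast
  linarith

theorem k_exp (R : Reg n k r j l x) : (k : ℝ) + 3 ≤ Real.exp (1.5 * l) := by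
  have h1 : Real.exp (1.5 * l) = x * Real.exp (l / 2) := by
    rw [R.hx, ← Real.exp_add]; congr 1; ring
  have h2 := Real.add_one_le_exp (l / 2)
  have h3 := R.k_ub
  have h4 := R.x_big
  have h5 : x * 500 ≤ x * Real.exp (l / 2) :=
    mul_le_mul_of_nonneg_left (by linarith [R.hL]) R.x_pos.le
  rw [h1]
  linarith

end Reg

/-- A matching of `q` internal pairs, each with few common neighbours in some other part. -/
def MatchData {n r : ℕ} (V : Fin r → Finset (Fin n)) (G : SimpleGraph (Fin n)) (y q : ℕ)
    (d : Fin q → (Fin n × Fin n) × (Fin r × Fin r)) : Prop :=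
  (∀ l, (d l).1.1 ≠ (d l).1.2 ∧ (d l).2.1 ≠ (d l).2.2 ∧ (d l).1.1 ∈ V (d l).2.1 ∧
    (d l).1.2 ∈ V (d l).2.1 ∧ cn G (d l).1.1 (d l).1.2 (V (d l).2.2) ≤ y) ∧
  (∀ l l', l ≠ l' → Disjoint ({(d l).1.1, (d l).1.2} : Finset (Fin n)) {(d l').1.1, (d l').1.2})

theorem cn_mono {n : ℕ} (G : SimpleGraph (Fin n)) (u v : Fin n) {W W' : Finset (Fin n)}
    (h : W ⊆ W') : cn G u v W ≤ cn G u v W' :=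
  Finset.card_le_card (Finset.filter_subset_filter _ h)

namespace Reg
variable {n k r j : ℕ} {l x : ℝ}

theorem match_fixed (R : Reg n k r j l x) {q : ℕ}
    (hq : (q : ℝ) ≤ k / 100 + 1) {V : Fin r → Finset (Fin n)} (hV : PDj V)
    (hm : ∑ i, (V i).card = k * r + j) (hVk : ∀ i, 0.99 * (k : ℝ) ≤ (V i).card)
    (t : ℕ) (d : Fin q → (Fin n × Fin n) × (Fin r × Fin r)) :
    grPr n {G | inn G V ≤ t ∧ MatchData V G (yP k l) q d} ≤
      Real.exp (3 * l * t) * (1 / 2 : ℝ) ^ (∑ i, (V i).card.choose 2) *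
        Real.exp (-(0.78 * x)) ^ q := by
  by_cases hd : (∀ i, (d i).1.1 ≠ (d i).1.2 ∧ (d i).2.1 ≠ (d i).2.2 ∧ (d i).1.1 ∈ V (d i).2.1 ∧
    (d i).1.2 ∈ V (d i).2.1) ∧ (∀ i i', i ≠ i' →
      Disjoint ({(d i).1.1, (d i).1.2} : Finset (Fin n)) {(d i').1.1, (d i').1.2})
  swap
  · refine le_trans (le_of_eq ?_) (by positivity)
    rw [← grPr_empty (n := n)]
    congr 1
    rw [Set.eq_empty_iff_forall_notMem]
    rintro G ⟨_, h1, h2⟩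
    exact hd ⟨fun i => ⟨(h1 i).1, (h1 i).2.1, (h1 i).2.2.1, (h1 i).2.2.2.1⟩, h2⟩
  obtain ⟨hd1, hd2⟩ := hd
  set C : Fin q → Finset (Fin n) := fun i => {(d i).1.1, (d i).1.2} with hC
  set U := Finset.univ.biUnion C with hU
  set W : Fin q → Finset (Fin n) := fun i => V (d i).2.2 \ U with hW
  have hUc : U.card ≤ 2 * q := by
    refine Finset.card_biUnion_le.trans ?_
    calc ∑ i, (C i).card ≤ ∑ _i : Fin q, 2 := Finset.sum_le_sum fun i _ => Finset.card_le_two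
      _ = 2 * q := by simp [mul_comm]
  have hCW : ∀ i i', Disjoint (C i) (W i') := by
    intro i i'
    rw [Finset.disjoint_left]
    intro a ha ha'
    exact (Finset.mem_sdiff.1 ha').2 (Finset.mem_biUnion.2 ⟨i, Finset.mem_univ _, ha⟩)
  have h1 := grPr_gadgets hV hm.le t (Finset.univ : Finset (Fin q)) (C := C) (W := W)
    (A := fun i => {G | cn G (d i).1.1 (d i).1.2 (W i) ≤ yP k l})
    (a := fun i => (d i).2.1) (b := fun i => (d i).2.2)
    (fun i _ => depOn_cn (by simp [hC]) (by simp [hC]) _) (fun i _ => (hd1 i).2.1)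
    (fun i _ => by
      intro z hz
      simp only [hC, Finset.mem_insert, Finset.mem_singleton] at hz
      rcases hz with rfl | rfl
      · exact (hd1 i).2.2.1
      · exact (hd1 i).2.2.2)
    (fun i _ => Finset.sdiff_subset) (fun i _ i' _ h => hd2 i i' h)
    (fun i _ i' _ _ => hCW i i')
  refine le_trans (grPr_mono ?_) (h1.trans ?_)
  · rintro G ⟨h2, h3, _⟩
    refine ⟨h2, fun i _ => ?_⟩
    exact (cn_mono G _ _ Finset.sdiff_subset).trans (h3 i).2.2.2.2
  refine mul_le_mul ?_ ?_ (Finset.prod_nonneg fun _ _ => grPr_nonneg _ _) (by positivity)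
  · exact mul_le_mul_of_nonneg_right (R.inn_cost t) (by positivity)
  refine (Finset.prod_le_prod (g := fun _ => Real.exp (-(0.78 * x)))
    (fun _ _ => grPr_nonneg _ _) fun i _ => ?_).trans (le_of_eq (by simp))
  have hnu : (d i).1.1 ∉ W i := Finset.disjoint_left.1 (hCW i i) (by simp [hC])
  have hnv : (d i).1.2 ∉ W i := Finset.disjoint_left.1 (hCW i i) (by simp [hC])
  refine (grPr_gadget_one (hd1 i).1 hnu hnv _).trans ((R.rho_one ?_).trans ?_)
  · refine le_trans ?_ R.m_exp
    have h2 : (W i).card ≤ k * r + j := by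
      rw [← hm]
      exact (Finset.card_le_card Finset.sdiff_subset).trans
        (Finset.single_le_sum (f := fun i => (V i).card) (fun _ _ => Nat.zero_le _)
          (Finset.mem_univ _))
    have h3 : ((W i).card : ℝ) ≤ ((k * r + j : ℕ) : ℝ) := by exact_mod_cast h2
    linarith
  · rw [Real.exp_le_exp]
    have h2 : (V (d i).2.2).card ≤ (W i).card + U.card := Finset.card_le_card_sdiff_add_card
    have h3 : ((V (d i).2.2).card : ℝ) ≤ (W i).card + 2 * q := by
      exact_mod_cast h2.trans (Nat.add_le_add_left hUc _)
    have h4 := hVk (d i).2.2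
    have h5 := R.k_lb
    have h6 := R.x_big
    linarith

/-- Large matchings of bad internal pairs are unlikely. -/
theorem bad_match (R : Reg n k r j l x) (h : fv n (k + 1) ≤ Real.exp l) {q : ℕ}
    (hq0 : 2 * r ≤ q) (hq : (q : ℝ) ≤ k / 100 + 1) :
    grPr n {G | ∃ V : Fin r → Finset (Fin n), PDj V ∧ ∑ i, (V i).card = k * r + j ∧
      (∀ i, 0.99 * (k : ℝ) ≤ (V i).card) ∧
      G ∈ {G | inn G V ≤ 2 * q * yP k l ∧ ∃ d, MatchData V G (yP k l) q d}} ≤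
    Real.exp (-(x / 20)) := by
  have hx := R.x_big
  have hx0 := R.x_pos
  have hl := R.hL
  have hl0 := R.l_pos
  refine (grPr_tuple (k * r + j) (fun v : Fin r → ℕ => ∀ i, 0.99 * (k : ℝ) ≤ v i)
    (fun V => {G | inn G V ≤ 2 * q * yP k l ∧ ∃ d, MatchData V G (yP k l) q d})
    (c := Real.exp (-(0.77 * x)) ^ q)
    (F := Real.exp ((r - j) * x + 20 * l ^ 5))
    (by positivity) (Real.exp_pos _).le (fun v hv _ => R.prod_fv_le' h v hv) ?_).trans ?_
  · intro V hV hm hVk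
    set U := Finset.univ.biUnion V with hU
    have hUc : U.card ≤ k * r + j := hm ▸ Finset.card_biUnion_le
    set s : Finset (Fin q → (Fin n × Fin n) × (Fin r × Fin r)) :=
      Fintype.piFinset fun _ => (U ×ˢ U) ×ˢ Finset.univ with hs
    have hsc : (s.card : ℝ) ≤ Real.exp (6 * l) ^ q := by
      rw [hs, Fintype.card_piFinset]
      simp only [Finset.card_product, Finset.card_univ, Fintype.card_prod, Fintype.card_fin,
        Finset.prod_const]
      push_cast
      refine pow_le_pow_left₀ (by positivity) ?_ _
      have h1 : (U.card : ℝ) ≤ ((k * r + j : ℕ) : ℝ) := by exact_mod_cast hUc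
      have h2 : (r : ℝ) ≤ ((k * r + j : ℕ) : ℝ) := by
        have := R.m_lb
        have h3 : 1 * (r : ℝ) ≤ 2.885 * x * r := by gcongr; linarith
        linarith
      have h3 := R.m_sq_exp
      have e : Real.exp (6 * l) = Real.exp (3 * l) * Real.exp (3 * l) := by
        rw [← Real.exp_add]; congr 1; ring
      rw [e]
      refine mul_le_mul (le_trans (mul_le_mul h1 h1 (by positivity) (by positivity)) ?_)
        (le_trans (mul_le_mul h2 h2 (by positivity) (by positivity)) ?_) (by positivity)
        (by positivity) <;> linarith [pow_two ((k * r + j : ℕ) : ℝ)]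
    refine (grPr_iUnion_le s
      (fun d => {G | inn G V ≤ 2 * q * yP k l ∧ MatchData V G (yP k l) q d}) _ ?_).trans ?_
    · rintro G ⟨h1, d, h2⟩
      refine ⟨d, ?_, h1, h2⟩
      rw [hs, Fintype.mem_piFinset]
      intro i
      simp only [Finset.mem_product, Finset.mem_univ, and_true]
      exact ⟨Finset.mem_biUnion.2 ⟨_, Finset.mem_univ _, (h2.1 i).2.2.1⟩,
        Finset.mem_biUnion.2 ⟨_, Finset.mem_univ _, (h2.1 i).2.2.2.1⟩⟩
    refine (Finset.sum_le_sum fun d _ => R.match_fixed hq hV hm hVk (2 * q * yP k l) d).trans ?_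
    rw [Finset.sum_const, nsmul_eq_mul]
    refine (mul_le_mul_of_nonneg_right hsc (by positivity)).trans ?_
    have e : Real.exp (6 * l) ^ q * (Real.exp (3 * l * ((2 * q * yP k l : ℕ) : ℝ)) *
        (1 / 2 : ℝ) ^ (∑ i, (V i).card.choose 2) * Real.exp (-(0.78 * x)) ^ q) =
        (Real.exp (6 * l) ^ q * Real.exp (3 * l * ((2 * q * yP k l : ℕ) : ℝ)) *
          Real.exp (-(0.78 * x)) ^ q) * (1 / 2 : ℝ) ^ (∑ i, (V i).card.choose 2) := by ring
    rw [e]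
    refine mul_le_mul_of_nonneg_right ?_ (by positivity)
    rw [← Real.exp_nat_mul, ← Real.exp_nat_mul, ← Real.exp_nat_mul, ← Real.exp_add,
      ← Real.exp_add, Real.exp_le_exp]
    have h1 := R.ly_small (p := 1) (by norm_num)
    have h2 := R.pow_le (p := 1) (by norm_num)
    rw [pow_one] at h1 h2
    have h3 : 6 * l + 6 * (l * yP k l) ≤ 0.01 * x := by linarith
    have h4 := mul_le_mul_of_nonneg_left h3 (Nat.cast_nonneg (α := ℝ) q)
    push_cast
    linarith
  · refine (mul_le_mul_of_nonneg_right R.tuple_cost (by positivity)).trans ?_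
    rw [← Real.exp_nat_mul, ← Real.exp_add, ← Real.exp_add, Real.exp_le_exp]
    have h5 := R.pow_le (p := 5) (by norm_num)
    have h6 := R.pow_le (p := 2) (by norm_num)
    have h7 : (r : ℝ) ≤ q / 2 := by
      have : (2 * r : ℝ) ≤ q := by exact_mod_cast hq0
      linarith
    have h8 : ((r : ℝ) - j) * x ≤ q / 2 * x := by
      refine mul_le_mul_of_nonneg_right ?_ hx0.le
      linarith [Nat.cast_nonneg (α := ℝ) j]
    have h9 : 2 * x ≤ q * x := by
      refine mul_le_mul_of_nonneg_right ?_ hx0.le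
      linarith [R.r_pos]
    linarith

end Reg

/-- Some pair in `A` has at most `y` common neighbours in `W`. -/
def evOne {n : ℕ} (A W : Finset (Fin n)) (y : ℕ) : Set (SimpleGraph (Fin n)) :=
  {G | ∃ p ∈ A ×ˢ A, G ∈ {G : SimpleGraph (Fin n) | p.1 ≠ p.2 ∧ cn G p.1 p.2 W ≤ y}}

/-- Two distinct pairs in `A` have at most `y` common neighbours in `W`. -/
def evTwo {n : ℕ} (A W : Finset (Fin n)) (y : ℕ) : Set (SimpleGraph (Fin n)) :=
  {G | ∃ p ∈ (A ×ˢ A) ×ˢ (A ×ˢ A), G ∈ {G : SimpleGraph (Fin n) |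
    (p.1.1 ≠ p.1.2 ∧ p.2.1 ≠ p.2.2 ∧ s(p.1.1, p.1.2) ≠ s(p.2.1, p.2.2)) ∧
      cn G p.1.1 p.1.2 W ≤ y ∧ cn G p.2.1 p.2.2 W ≤ y}}

theorem depOn_evOne {n : ℕ} (A W : Finset (Fin n)) (y : ℕ) :
    DepOn (starE A W) (evOne A W y) := by
  rintro G G' h ⟨p, hp, h1, h2⟩
  have hp' := Finset.mem_product.1 hp
  exact ⟨p, hp, h1, depOn_cn hp'.1 hp'.2 y G G' h h2⟩

theorem depOn_evTwo {n : ℕ} (A W : Finset (Fin n)) (y : ℕ) :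
    DepOn (starE A W) (evTwo A W y) := by
  rintro G G' h ⟨p, hp, h1, h2, h3⟩
  have hp' := Finset.mem_product.1 hp
  have hp1 := Finset.mem_product.1 hp'.1
  have hp2 := Finset.mem_product.1 hp'.2
  exact ⟨p, hp, h1, depOn_cn hp1.1 hp1.2 y G G' h h2, depOn_cn hp2.1 hp2.2 y G G' h h3⟩

namespace Reg
variable {n k r j : ℕ} {l x : ℝ}

theorem evOne_le (R : Reg n k r j l x) {A W : Finset (Fin n)} (hd : Disjoint A W)
    (hA : A.card = k + 1) (hW1 : (W.card : ℝ) + 1 ≤ Real.exp (3 * l))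
    (hW2 : (k : ℝ) - 2 * l ≤ W.card) :
    grPr n (evOne A W (yP k l)) ≤ Real.exp (-(0.82 * x)) := by
  refine (grPr_iUnion_le (A ×ˢ A)
    (fun p => {G : SimpleGraph (Fin n) | p.1 ≠ p.2 ∧ cn G p.1 p.2 W ≤ yP k l}) _
    (fun G hG => hG)).trans ?_
  have key : ∀ p ∈ A ×ˢ A,
      grPr n {G : SimpleGraph (Fin n) | p.1 ≠ p.2 ∧ cn G p.1 p.2 W ≤ yP k l} ≤
        Real.exp (-(0.2874 * W.card) + 0.001 * x) := by
    intro p hp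
    have hp' := Finset.mem_product.1 hp
    by_cases hne : p.1 = p.2
    · refine le_trans (le_of_eq ?_) (Real.exp_pos _).le
      rw [← grPr_empty (n := n)]
      congr 1
      ext G
      simp [hne]
    · refine (grPr_mono fun G hG => hG.2).trans ((grPr_gadget_one hne
        (Finset.disjoint_left.1 hd hp'.1) (Finset.disjoint_left.1 hd hp'.2) _).trans
        (R.rho_one hW1))
  refine (Finset.sum_le_sum key).trans ?_
  rw [Finset.sum_const, nsmul_eq_mul, Finset.card_product, hA]
  have h1 := R.k_exp
  have h2 : (((k + 1) * (k + 1) : ℕ) : ℝ) ≤ Real.exp (1.5 * l) * Real.exp (1.5 * l) := by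
    push_cast
    apply mul_le_mul <;> linarith
  refine (mul_le_mul_of_nonneg_right h2 (Real.exp_pos _).le).trans ?_
  rw [← Real.exp_add, ← Real.exp_add, Real.exp_le_exp]
  have h3 := R.k_lb
  have h4 := R.pow_le (p := 1) (by norm_num)
  have h5 := R.x_pos
  rw [pow_one] at h4
  linarith

theorem evTwo_le (R : Reg n k r j l x) {A W : Finset (Fin n)} (hd : Disjoint A W)
    (hA : A.card = k + 1) (hW1 : (W.card : ℝ) + 1 ≤ Real.exp (3 * l))
    (hW2 : (k : ℝ) - 2 * l ≤ W.card) :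
    grPr n (evTwo A W (yP k l)) ≤ Real.exp (-(1.34 * x)) := by
  refine (grPr_iUnion_le ((A ×ˢ A) ×ˢ (A ×ˢ A)) (fun p => {G : SimpleGraph (Fin n) |
    (p.1.1 ≠ p.1.2 ∧ p.2.1 ≠ p.2.2 ∧ s(p.1.1, p.1.2) ≠ s(p.2.1, p.2.2)) ∧
      cn G p.1.1 p.1.2 W ≤ yP k l ∧ cn G p.2.1 p.2.2 W ≤ yP k l}) _
    (fun G hG => hG)).trans ?_
  have key : ∀ p ∈ (A ×ˢ A) ×ˢ (A ×ˢ A),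
      grPr n {G : SimpleGraph (Fin n) |
        (p.1.1 ≠ p.1.2 ∧ p.2.1 ≠ p.2.2 ∧ s(p.1.1, p.1.2) ≠ s(p.2.1, p.2.2)) ∧
        cn G p.1.1 p.1.2 W ≤ yP k l ∧ cn G p.2.1 p.2.2 W ≤ yP k l} ≤
        Real.exp (-(0.4695 * W.card) + 0.001 * x) := by
    intro p hp
    have hp' := Finset.mem_product.1 hp
    have hp1 := Finset.mem_product.1 hp'.1
    have hp2 := Finset.mem_product.1 hp'.2
    by_cases hne : p.1.1 ≠ p.1.2 ∧ p.2.1 ≠ p.2.2 ∧ s(p.1.1, p.1.2) ≠ s(p.2.1, p.2.2)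
    · refine (grPr_mono (T := {G | cn G p.1.1 p.1.2 W ≤ yP k l ∧ cn G p.2.1 p.2.2 W ≤ yP k l}) fun G hG => ⟨hG.2.1, hG.2.2⟩).trans ((grPr_gadget_two hne.1 hne.2.1
        hne.2.2 (Finset.disjoint_left.1 hd hp1.1) (Finset.disjoint_left.1 hd hp1.2)
        (Finset.disjoint_left.1 hd hp2.1) (Finset.disjoint_left.1 hd hp2.2) _).trans
        (R.rho_two hW1))
    · refine le_trans (le_of_eq ?_) (Real.exp_pos _).le
      rw [← grPr_empty (n := n)]
      congr 1
      rw [Set.eq_empty_iff_forall_notMem]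
      rintro G ⟨hG, _⟩
      exact hne hG
  refine (Finset.sum_le_sum key).trans ?_
  rw [Finset.sum_const, nsmul_eq_mul, Finset.card_product, Finset.card_product, hA]
  have h1 := R.k_exp
  have h2 : (((k + 1) * (k + 1) : ℕ) : ℝ) ≤ Real.exp (1.5 * l) * Real.exp (1.5 * l) := by
    push_cast
    apply mul_le_mul <;> linarith
  have h2' : ((((k + 1) * (k + 1)) * ((k + 1) * (k + 1)) : ℕ) : ℝ) ≤
      (Real.exp (1.5 * l) * Real.exp (1.5 * l)) * (Real.exp (1.5 * l) * Real.exp (1.5 * l)) := by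
    rw [Nat.cast_mul]
    exact mul_le_mul h2 h2 (by positivity) (by positivity)
  refine (mul_le_mul_of_nonneg_right h2' (Real.exp_pos _).le).trans ?_
  rw [← Real.exp_add, ← Real.exp_add, ← Real.exp_add, Real.exp_le_exp]
  have h3 := R.k_lb
  have h4 := R.pow_le (p := 1) (by norm_num)
  have h5 := R.x_pos
  rw [pow_one] at h4
  linarith

/-- A part of size `w` absorbing bad pairs from `p₁ + p₂` parts of size `k + 1`. -/
theorem bad_absorb (R : Reg n k r j l x) (h : fv n (k + 1) ≤ Real.exp l) {p₁ p₂ w : ℕ}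
    (hp : p₁ + p₂ ≤ r) (hw : w ≤ k + 2) (hc : 1.1 + ((k : ℝ) - w) ≤ 0.8 * p₁ + 1.3 * p₂) :
    grPr n {G | ∃ V : Option (Fin p₁ ⊕ Fin p₂) → Finset (Fin n), PDj V ∧
      (∀ i, (V i).card = i.elim w fun _ => k + 1) ∧
      G ∈ {G | inn G V ≤ 4 * r * yP k l ∧ (∀ a, G ∈ evOne (V (some (.inl a))) (V none) (yP k l)) ∧
        ∀ a, G ∈ evTwo (V (some (.inr a))) (V none) (yP k l)}} ≤
    Real.exp (-(x / 20)) := by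
  have hx := R.x_big
  have hx0 := R.x_pos
  have hl := R.hL
  have hl0 := R.l_pos
  have hpr : (p₁ : ℝ) + p₂ ≤ l := le_trans (by exact_mod_cast hp) R.hrl
  have hp1 : (0 : ℝ) ≤ p₁ := Nat.cast_nonneg _
  have hp2 : (0 : ℝ) ≤ p₂ := Nat.cast_nonneg _
  have hwk : (w : ℝ) ≤ k + 2 := by exact_mod_cast hw
  have hw2 : (k : ℝ) - 2 * l ≤ w := by linarith
  have hw1 : (w : ℝ) + 1 ≤ Real.exp (3 * l) := by
    have := R.k_exp
    have h1 : Real.exp (1.5 * l) ≤ Real.exp (3 * l) := Real.exp_le_exp.2 (by linarith)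
    linarith
  refine (grPr_tuple_fixed (fun i : Option (Fin p₁ ⊕ Fin p₂) => i.elim w fun _ => k + 1)
    (fun V => {G | inn G V ≤ 4 * r * yP k l ∧
        (∀ a, G ∈ evOne (V (some (.inl a))) (V none) (yP k l)) ∧
        ∀ a, G ∈ evTwo (V (some (.inr a))) (V none) (yP k l)})
    (c := Real.exp (4 * l * (4 * r * yP k l : ℕ)) *
      (Real.exp (-(0.82 * x)) ^ p₁ * Real.exp (-(1.34 * x)) ^ p₂)) (by positivity) ?_).trans ?_
  · intro V hV hVc
    have hV0 : (V none).card = w := by simpa using hVc none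
    have hVs : ∀ a, (V (some a)).card = k + 1 := fun a => by simpa using hVc (some a)
    have hm : ∑ i, (V i).card ≤ 4 * (k * r + j) := by
      rw [Fintype.sum_option, hV0]
      simp only [hVs, Finset.sum_const, Finset.card_univ, Fintype.card_sum, Fintype.card_fin,
        smul_eq_mul]
      have h1 : (p₁ + p₂) * (k + 1) ≤ r * (k + 1) := Nat.mul_le_mul_right _ hp
      have h2 : 2 ≤ k := by
        have := R.k_lb
        have : (2 : ℝ) ≤ k := by linarith
        exact_mod_cast this
      have h3 : k * 1 ≤ k * r := Nat.mul_le_mul_left _ R.hr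
      have h4 : 1 * r ≤ k * r := Nat.mul_le_mul_right _ (by omega)
      linarith
    have h1 := grPr_gadgets hV hm (4 * r * yP k l) (Finset.univ : Finset (Fin p₁ ⊕ Fin p₂))
      (C := fun a => V (some a)) (W := fun _ => V none)
      (A := fun a => Sum.elim (fun b => evOne (V (some (.inl b))) (V none) (yP k l))
        (fun b => evTwo (V (some (.inr b))) (V none) (yP k l)) a)
      (a := fun a => some a) (b := fun _ => none)
      (fun a _ => by
        rcases a with a | a
        · exact depOn_evOne _ _ _
        · exact depOn_evTwo _ _ _)
      (fun a _ => by simp) (fun a _ => subset_rfl) (fun a _ => subset_rfl)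
      (fun a _ a' _ hne => hV _ _ (by simpa using hne)) (fun a _ a' _ _ => hV _ _ (by simp))
    refine le_trans (grPr_mono ?_) (h1.trans ?_)
    · rintro G ⟨h2, h3, h4⟩
      refine ⟨h2, ?_⟩
      rintro (a | a) -
      · exact h3 a
      · exact h4 a
    · simp only [hVc]
      have h2 : ∏ a : Fin p₁ ⊕ Fin p₂, grPr n (Sum.elim
          (fun b => evOne (V (some (.inl b))) (V none) (yP k l))
          (fun b => evTwo (V (some (.inr b))) (V none) (yP k l)) a) ≤
          Real.exp (-(0.82 * x)) ^ p₁ * Real.exp (-(1.34 * x)) ^ p₂ := by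
        rw [Fintype.prod_sum_type]
        simp only [Sum.elim_inl, Sum.elim_inr]
        refine mul_le_mul ?_ ?_ (Finset.prod_nonneg fun _ _ => grPr_nonneg _ _) (by positivity)
        · refine (Finset.prod_le_prod (g := fun _ => Real.exp (-(0.82 * x)))
            (fun _ _ => grPr_nonneg _ _) fun a _ => ?_).trans (le_of_eq (by simp))
          exact R.evOne_le (hV _ _ (by simp)) (hVs _) (by rw [hV0]; exact hw1)
            (by rw [hV0]; exact hw2)
        · refine (Finset.prod_le_prod (g := fun _ => Real.exp (-(1.34 * x)))
            (fun _ _ => grPr_nonneg _ _) fun a _ => ?_).trans (le_of_eq (by simp))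
          exact R.evTwo_le (hV _ _ (by simp)) (hVs _) (by rw [hV0]; exact hw1)
            (by rw [hV0]; exact hw2)
      have h3 : (((4 * (k * r + j) : ℕ) : ℝ) ^ 2 + 1) ^ (4 * r * yP k l) ≤
          Real.exp (4 * l * (4 * r * yP k l : ℕ)) := by
        rw [mul_comm (4 * l), Real.exp_nat_mul]
        refine pow_le_pow_left₀ (by positivity) ?_ _
        have e : Real.exp (4 * l) = Real.exp l * Real.exp (3 * l) := by
          rw [← Real.exp_add]; congr 1; ring
        have h4 := R.m_sq_exp
        have h5 := mul_le_mul (by rw [R.exp_l]; linarith : (16 : ℝ) ≤ Real.exp l) h4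
          (by positivity) (by positivity)
        rw [e]
        rw [Nat.cast_mul]
        push_cast at h5 ⊢
        linarith
      have h4 := mul_le_mul h3 h2 (Finset.prod_nonneg fun _ _ => grPr_nonneg _ _) (by positivity)
      have h5 := mul_le_mul_of_nonneg_right h4
        (by positivity : 0 ≤ (1 / 2 : ℝ) ^ (∑ i : Option (Fin p₁ ⊕ Fin p₂),
          (i.elim w fun _ => k + 1).choose 2))
      refine le_trans (le_of_eq ?_) h5
      ring
  · rw [Fintype.prod_option]
    simp only [Option.elim, Finset.prod_const, Finset.card_univ, Fintype.card_sum,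
      Fintype.card_fin]
    have h1 : fv n w * fv n (k + 1) ^ (p₁ + p₂) ≤
        Real.exp ((1 - ((w : ℝ) - k)) * x + 20 * l ^ 4 - ((w : ℝ) - k) ^ 2 / 8) *
          Real.exp l ^ (p₁ + p₂) :=
      mul_le_mul (R.fv_le h w rfl) (pow_le_pow_left₀ (fv_nonneg _ _) h _)
        (pow_nonneg (fv_nonneg _ _) _) (Real.exp_pos _).le
    refine (mul_le_mul_of_nonneg_left h1 (by positivity)).trans ?_
    rw [← Real.exp_nat_mul, ← Real.exp_nat_mul, ← Real.exp_nat_mul, ← Real.exp_add,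
      ← Real.exp_add, ← Real.exp_add, ← Real.exp_add, Real.exp_le_exp]
    push_cast
    have h2 := mul_le_mul_of_nonneg_right hc hx0.le
    have h3 := mul_le_mul_of_nonneg_right hpr hl0.le
    have h4 := R.ly_small (p := 2) (by norm_num)
    have h5 := mul_le_mul_of_nonneg_right R.hrl
      (by positivity : 0 ≤ l * (yP k l : ℝ))
    have h6 := R.pow_le (p := 2) (by norm_num)
    have h7 := R.pow_le (p := 4) (by norm_num)
    have h8 : 0 ≤ ((w : ℝ) - k) ^ 2 / 8 := by positivity
    have h9 : 0 ≤ (p₁ : ℝ) * x := by positivity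
    have h10 : 0 ≤ (p₂ : ℝ) * x := by positivity
    rw [pow_two l] at h4 h6
    linarith

end Reg

theorem exists_of_le_alphaClq {n m r : ℕ} {G : SimpleGraph (Fin n)} (h : m ≤ alphaClq n (r + 1) G) :
    ∃ S : Finset (Fin n), S.card = m ∧ G.CliqueFreeOn ↑S (r + 1) := by
  unfold alphaClq at h
  set Q := {m | ∃ s : Finset (Fin n), s.card = m ∧
    (G.induce (s : Set (Fin n))).CliqueFree (r + 1)} with hQ
  have hne : Q.Nonempty := by
    refine ⟨0, ∅, by simp, ?_⟩
    rw [SimpleGraph.cliqueFree_induce_iff]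
    simp [SimpleGraph.cliqueFreeOn_empty]
  have hb : BddAbove Q := by
    refine ⟨n, ?_⟩
    rintro _ ⟨s, rfl, _⟩
    exact (Finset.card_le_univ s).trans (by simp)
  obtain ⟨s, hs, hf⟩ := Nat.sSup_mem hne hb
  obtain ⟨S, hSs, hS⟩ := Finset.exists_subset_card_eq (hs ▸ h : m ≤ s.card)
  rw [SimpleGraph.cliqueFree_induce_iff] at hf
  exact ⟨S, hS, SimpleGraph.CliqueFreeOn.subset G (by exact_mod_cast hSs) hf⟩

theorem cliqueFreeOn_nbr {n m : ℕ} {G : SimpleGraph (Fin n)} {S : Set (Fin n)}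
    (h : G.CliqueFreeOn S (m + 1)) {u : Fin n} (hu : u ∈ S) :
    G.CliqueFreeOn {z | z ∈ S ∧ G.Adj u z} m := by
  intro T hT hc
  refine h (t := insert u T) ?_ (hc.insert fun b hb => (hT hb).2)
  rw [Finset.coe_insert]
  exact Set.insert_subset hu fun b hb => (hT hb).1

theorem edgesIn_insert {n : ℕ} (G : SimpleGraph (Fin n)) {A : Finset (Fin n)} {u : Fin n}
    (hu : u ∉ A) : edgesIn G (insert u A) = edgesIn G A + (A.filter (G.Adj u)).card := by
  rw [edgesIn_eq, edgesIn_eq]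
  have hinj : Function.Injective fun v : Fin n => s(u, v) := fun a b h => Sym2.congr_right.1 h
  rw [← Finset.card_image_of_injective (A.filter (G.Adj u)) hinj, ← Finset.card_union_of_disjoint]
  · congr 1
    ext e
    induction e with
    | _ a b =>
      simp only [tr, Finset.mem_filter, Finset.mem_union, mk_mem_prs, Finset.mem_image,
        Finset.mem_insert, SimpleGraph.mem_edgeSet]
      constructor
      · rintro ⟨⟨hab, ha, hb⟩, hadj⟩
        rcases ha with rfl | ha
        · rcases hb with rfl | hb
          · exact absurd rfl hab
          · exact Or.inr ⟨b, ⟨hb, hadj⟩, rfl⟩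
        · rcases hb with rfl | hb
          · exact Or.inr ⟨a, ⟨ha, hadj.symm⟩, Sym2.eq_swap⟩
          · exact Or.inl ⟨⟨hab, ha, hb⟩, hadj⟩
      · rintro (⟨⟨hab, ha, hb⟩, hadj⟩ | ⟨z, ⟨hz, hadj⟩, he⟩)
        · exact ⟨⟨hab, Or.inr ha, Or.inr hb⟩, hadj⟩
        · rcases Sym2.eq_iff.1 he with ⟨rfl, rfl⟩ | ⟨rfl, rfl⟩
          · exact ⟨⟨hadj.ne, Or.inl rfl, Or.inr hz⟩, hadj⟩
          · exact ⟨⟨hadj.ne', Or.inr hz, Or.inl rfl⟩, hadj.symm⟩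
  · rw [Finset.disjoint_left]
    intro e he he'
    obtain ⟨z, hz, rfl⟩ := Finset.mem_image.1 he'
    exact hu (mk_mem_prs.1 (Finset.mem_filter.1 he).1).2.1

/-- A colouring of `S` minimising the number of monochromatic edges. -/
theorem exists_min_colouring {n r : ℕ} (hr : 1 ≤ r) (G : SimpleGraph (Fin n)) (S : Finset (Fin n)) :
    ∃ c : Fin n → Fin r,
      (∀ c' : Fin n → Fin r, ∑ i, edgesIn G (S.filter (c · = i)) ≤
        ∑ i, edgesIn G (S.filter (c' · = i))) ∧
      ∀ u ∈ S, ∀ b, ((S.filter (c · = c u)).filter (G.Adj u)).card ≤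
        ((S.filter (c · = b)).filter (G.Adj u)).card := by
  have : Nonempty (Fin r) := ⟨⟨0, hr⟩⟩
  obtain ⟨c, hc⟩ := Finite.exists_min
    (fun c : Fin n → Fin r => ∑ i, edgesIn G (S.filter (c · = i)))
  refine ⟨c, hc, fun u hu b => ?_⟩
  by_cases hb : b = c u
  · rw [hb]
  have h1 := hc (Function.update c u b)
  have key : ∀ i, edgesIn G (S.filter (Function.update c u b · = i)) +
      (if i = c u then ((S.filter (c · = c u)).filter (G.Adj u)).card else 0) =
      edgesIn G (S.filter (c · = i)) +
      (if i = b then ((S.filter (c · = b)).filter (G.Adj u)).card else 0) := by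
    intro i
    by_cases hi : i = c u
    · subst hi
      have e1 : S.filter (c · = c u) = insert u (S.filter (Function.update c u b · = c u)) := by
        ext z
        by_cases hz : z = u
        · subst hz; simp [hu]
        · simp [hz]
      have e2 : u ∉ S.filter (Function.update c u b · = c u) := by simp [hb]
      rw [if_pos rfl, if_neg (Ne.symm hb), e1, edgesIn_insert G e2, Finset.filter_insert,
        if_neg (G.loopless.irrefl u)]
      rfl
    · rw [if_neg hi]
      by_cases hi' : i = b
      · subst hi'
        have e1 : S.filter (Function.update c u i · = i) = insert u (S.filter (c · = i)) := by
          ext z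
          by_cases hz : z = u
          · subst hz; simp [hu]
          · simp [hz]
        have e2 : u ∉ S.filter (c · = i) := by simp [Ne.symm hi]
        rw [if_pos rfl, e1, edgesIn_insert G e2]
        rfl
      · rw [if_neg hi']
        congr 2
        ext z
        by_cases hz : z = u
        · subst hz; simp [Ne.symm hi, Ne.symm hi']
        · simp [Function.update_of_ne hz]
  have h2 := Finset.sum_congr (s₁ := (Finset.univ : Finset (Fin r))) rfl fun i _ => key i
  rw [Finset.sum_add_distrib, Finset.sum_add_distrib, Finset.sum_ite_eq', Finset.sum_ite_eq',
    if_pos (Finset.mem_univ _), if_pos (Finset.mem_univ _)] at h2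
  omega

/-- Choosing `y` vertices from each of several disjoint large sets. -/
theorem exists_transversal {n r y : ℕ} {V : Fin r → Finset (Fin n)} (hV : PDj V)
    (T : Finset (Fin r)) (N : Fin r → Finset (Fin n)) (hN : ∀ i ∈ T, N i ⊆ V i)
    (hy : ∀ i ∈ T, y ≤ (N i).card) :
    ∃ Y : Finset (Fin n), Y ⊆ T.biUnion N ∧ Y.card = T.card * y ∧
      (∀ i, (Y ∩ V i).card ≤ y) := by
  have : ∀ i, ∃ Z : Finset (Fin n), i ∈ T → Z ⊆ N i ∧ Z.card = y := by
    intro i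
    by_cases hi : i ∈ T
    · obtain ⟨Z, h1, h2⟩ := Finset.exists_subset_card_eq (hy i hi)
      exact ⟨Z, fun _ => ⟨h1, h2⟩⟩
    · exact ⟨∅, fun h => absurd h hi⟩
  choose Z hZ using this
  refine ⟨T.biUnion Z, Finset.biUnion_mono fun i hi => (hZ i hi).1, ?_, fun i => ?_⟩
  · rw [Finset.card_biUnion, Finset.sum_congr rfl fun i hi => (hZ i hi).2]
    · simp
    · intro i hi i' hi' hne
      exact Finset.disjoint_of_subset_left ((hZ i hi).1.trans (hN i hi))
        (Finset.disjoint_of_subset_right ((hZ i' hi').1.trans (hN i' hi')) (hV i i' hne))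
  · have hsub : ∀ i' ∈ T, i' ≠ i → ∀ z ∈ Z i', z ∉ V i := fun i' hi' hne z hz hzi =>
      Finset.disjoint_left.1 (hV i' i hne) (hN i' hi' ((hZ i' hi').1 hz)) hzi
    by_cases hi : i ∈ T
    · rw [← (hZ i hi).2]
      refine Finset.card_le_card fun z hz => ?_
      obtain ⟨h1, h2⟩ := Finset.mem_inter.1 hz
      obtain ⟨i', hi', hz'⟩ := Finset.mem_biUnion.1 h1
      by_cases hne : i' = i
      · exact hne ▸ hz'
      · exact absurd h2 (hsub i' hi' hne z hz')
    · have : T.biUnion Z ∩ V i = ∅ := by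
        rw [Finset.eq_empty_iff_forall_notMem]
        intro z hz
        obtain ⟨h1, h2⟩ := Finset.mem_inter.1 hz
        obtain ⟨i', hi', hz'⟩ := Finset.mem_biUnion.1 h1
        exact hsub i' hi' (fun h => hi (h ▸ hi')) z hz' h2
      rw [this]; simp

/-- Greedy matching in a set of pairs of bounded degree. -/
theorem exists_matching {α : Type*} [DecidableEq α] {y : ℕ} (q : ℕ) :
    ∀ E : Finset (Sym2 α), (∀ u, (E.filter (u ∈ ·)).card ≤ y) → 2 * y * (q - 1) < E.card ∨ q = 0 →
    ∃ M ⊆ E, M.card = q ∧ ∀ e ∈ M, ∀ e' ∈ M, e ≠ e' → ∀ u, u ∈ e → u ∉ e' := by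
  induction q with
  | zero => intro E _ _; exact ⟨∅, by simp⟩
  | succ q ih =>
    intro E hE hq
    have hq' : 2 * y * q < E.card := by simpa using hq
    obtain ⟨e, he⟩ : E.Nonempty := Finset.card_pos.1 (by omega)
    set E' := E.filter fun e' => ∀ u, u ∈ e → u ∉ e' with hE'
    have hc : E.card ≤ E'.card + 2 * y := by
      induction e with
      | _ a b =>
        have h1 : E ⊆ E' ∪ (E.filter (a ∈ ·) ∪ E.filter (b ∈ ·)) := by
          intro e' h
          simp only [hE', Finset.mem_filter, Finset.mem_union]
          by_cases ha : a ∈ e'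
          · exact Or.inr (Or.inl ⟨h, ha⟩)
          · by_cases hb : b ∈ e'
            · exact Or.inr (Or.inr ⟨h, hb⟩)
            · refine Or.inl ⟨h, fun u hu => ?_⟩
              rcases Sym2.mem_iff.1 hu with rfl | rfl <;> assumption
        have h2 := (Finset.card_le_card h1).trans (Finset.card_union_le _ _)
        have h3 := Finset.card_union_le (E.filter (a ∈ ·)) (E.filter (b ∈ ·))
        have h4 := hE a
        have h5 := hE b
        omega
    obtain ⟨M, hM, hMc, hMd⟩ := ih E'
      (fun u => (Finset.card_le_card (Finset.filter_subset_filter _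
        (Finset.filter_subset _ _))).trans (hE u)) (by
        rcases Nat.eq_zero_or_pos q with h | h
        · exact Or.inr h
        · left
          obtain ⟨q', rfl⟩ : ∃ q', q = q' + 1 := ⟨q - 1, by omega⟩
          simp only [Nat.add_sub_cancel]
          rw [Nat.mul_add] at hq'
          omega)
    have hMe : ∀ e' ∈ M, ∀ u, u ∈ e → u ∉ e' := fun e' h => (Finset.mem_filter.1 (hM h)).2
    have heM : e ∉ M := by
      intro h
      induction e with
      | _ a b => exact hMe _ h a (Sym2.mem_mk_left a b) (Sym2.mem_mk_left a b)
    refine ⟨insert e M, ?_, by rw [Finset.card_insert_of_notMem heM, hMc], ?_⟩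
    · exact Finset.insert_subset he (hM.trans (Finset.filter_subset _ _))
    · intro a ha b hb hab u hua hub
      rcases Finset.mem_insert.1 ha with h1 | h1 <;> rcases Finset.mem_insert.1 hb with h2 | h2
      · exact hab (h1.trans h2.symm)
      · exact hMe b h2 u (h1 ▸ hua) hub
      · exact hMe a h1 u (h2 ▸ hub) hua
      · exact hMd a h1 b h2 hab u hua hub

theorem absorb_arith {p₁ p₂ q : ℕ} {μ : ℕ} {s : ℤ} (hs : -1 ≤ s)
    (h : 0.8 * (p₁ : ℝ) + 1.3 * p₂ < 1.1 + s) (h0 : μ = 0 → p₂ = 0)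
    (hq : q ≤ p₁ + (μ + 1) * p₂) :
    (q : ℤ) ≤ 1 + s * (μ + 2) + (if s = -1 then (μ + 1 : ℤ) else 0) := by
  have h' : 8 * (p₁ : ℤ) + 13 * p₂ < 11 + 10 * s := by
    have : (8 * (p₁ : ℤ) + 13 * p₂ : ℝ) < 11 + 10 * (s : ℝ) := by push_cast; linarith
    exact_mod_cast this
  have hq' : (q : ℤ) ≤ p₁ + (μ + 1) * p₂ := by exact_mod_cast hq
  have hp1 : (0 : ℤ) ≤ p₁ := Int.natCast_nonneg _
  have hp2 : (0 : ℤ) ≤ p₂ := Int.natCast_nonneg _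
  by_cases hs1 : s = -1
  · subst hs1
    have e1 : (p₁ : ℤ) = 0 := by omega
    have e2 : (p₂ : ℤ) = 0 := by omega
    rw [e1, e2] at hq'
    simp only [if_true]
    linarith
  · rw [if_neg hs1]
    have hs0 : 0 ≤ s := by omega
    by_cases hμ : μ = 0
    · rw [h0 hμ] at h' hq'
      subst hμ
      push_cast at *
      omega
    · have hμ1 : (1 : ℤ) ≤ μ := by omega
      have hd : (p₂ : ℤ) ≤ s := by omega
      obtain ⟨d, hd⟩ : ∃ d : ℤ, s = p₂ + d := ⟨s - p₂, by ring⟩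
      have hd0 : 0 ≤ d := by omega
      subst hd
      by_contra hcon
      push Not at hcon
      have h1 : d * 1 ≤ d * μ := mul_le_mul_of_nonneg_left hμ1 hd0
      nlinarith

/-- The counting step: every part of size `k + 1` with more than `μ` edges sends its edges to other
parts, which have little capacity to absorb them. -/
theorem count_main {n r k j y : ℕ} {G : SimpleGraph (Fin n)} {V : Fin r → Finset (Fin n)}
    (hV : PDj V) (hsum : ∑ i, (V i).card = k * r + j) (hle : ∀ i, (V i).card ≤ k + 1)
    (hfew : ∀ A : Finset (Fin n), A.card = k + 1 → muD r j ≤ edgesIn G A)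
    (hphi : ∀ a, ∀ e ∈ tr G (prs (V a)), ∃ b, b ≠ a ∧ ∃ u v, e = s(u, v) ∧ cn G u v (V b) ≤ y)
    (habs : ∀ i, ∀ N₁ N₂ : Finset (Fin r), Disjoint N₁ N₂ → i ∉ N₁ → i ∉ N₂ →
      (∀ a ∈ N₁, (V a).card = k + 1 ∧ G ∈ evOne (V a) (V i) y) →
      (∀ a ∈ N₂, (V a).card = k + 1 ∧ G ∈ evTwo (V a) (V i) y) →
      0.8 * (N₁.card : ℝ) + 1.3 * N₂.card < 1.1 + ((k : ℝ) - (V i).card)) :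
    xiD r j ≤ numZ n (k + 1) (muD r j) G := by
  set μ := muD r j with hμ
  set big : Finset (Fin r) := Finset.univ.filter fun a => (V a).card = k + 1 with hbig
  have hF : ∀ a, ∃ F ⊆ tr G (prs (V a)), F.card = min (edgesIn G (V a)) (μ + 1) := fun a =>
    Finset.exists_subset_card_eq (by rw [edgesIn_eq]; exact min_le_left _ _)
  choose F hFs hFc using hF
  choose! φ hφ using hphi
  set ct : Fin r → Fin r → ℕ := fun i a => ((F a).filter fun e => φ a e = i).card with hct
  have hcap : ∀ i, ((∑ a ∈ big, ct i a : ℕ) : ℤ) ≤ 1 + ((k : ℤ) - (V i).card) * (μ + 2) +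
      (if i ∈ big then (μ + 1 : ℤ) else 0) := by
    intro i
    set N₁ := big.filter fun a => ct i a = 1 with hN1
    set N₂ := big.filter fun a => 2 ≤ ct i a with hN2
    have hpair : ∀ a, ∀ e ∈ (F a).filter (fun e => φ a e = i), ∃ u v, e = s(u, v) ∧ u ≠ v ∧
        u ∈ V a ∧ v ∈ V a ∧ cn G u v (V i) ≤ y ∧ i ≠ a := by
      intro a e he
      obtain ⟨h1, h2⟩ := Finset.mem_filter.1 he
      obtain ⟨h3, u, v, rfl, h4⟩ := hφ a e (hFs a h1)
      obtain ⟨h5, h6, h7⟩ := mk_mem_prs.1 (Finset.mem_filter.1 (hFs a h1)).1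
      exact ⟨u, v, rfl, h5, h6, h7, h2 ▸ h4, h2 ▸ h3⟩
    have hne : ∀ a, 1 ≤ ct i a → i ≠ a := by
      intro a ha
      obtain ⟨e, he⟩ := Finset.card_pos.1 ha
      obtain ⟨_, _, _, _, _, _, _, h⟩ := hpair a e he
      exact h
    have h1 := habs i N₁ N₂
      (by
        rw [Finset.disjoint_left]; intro a ha ha'
        have := (Finset.mem_filter.1 ha).2
        have := (Finset.mem_filter.1 ha').2
        omega)
      (fun h => hne i (Finset.mem_filter.1 h).2.ge rfl)
      (fun h => hne i (le_trans (by norm_num) (Finset.mem_filter.1 h).2) rfl)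
      (by
        intro a ha
        obtain ⟨hb, h1⟩ := Finset.mem_filter.1 ha
        refine ⟨(Finset.mem_filter.1 hb).2, ?_⟩
        obtain ⟨e, he⟩ := Finset.card_pos.1 (show 0 < ct i a by omega)
        obtain ⟨u, v, rfl, huv, hu, hv, hcn, _⟩ := hpair a e he
        exact ⟨(u, v), Finset.mem_product.2 ⟨hu, hv⟩, huv, hcn⟩)
      (by
        intro a ha
        obtain ⟨hb, h1⟩ := Finset.mem_filter.1 ha
        refine ⟨(Finset.mem_filter.1 hb).2, ?_⟩
        obtain ⟨e, he, e', he', hee⟩ := Finset.one_lt_card.1 (show 1 < ct i a by omega)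
        obtain ⟨u, v, rfl, huv, hu, hv, hcn, _⟩ := hpair a e he
        obtain ⟨u', v', rfl, huv', hu', hv', hcn', _⟩ := hpair a e' he'
        exact ⟨((u, v), (u', v')), Finset.mem_product.2
          ⟨Finset.mem_product.2 ⟨hu, hv⟩, Finset.mem_product.2 ⟨hu', hv'⟩⟩,
          ⟨huv, huv', hee⟩, hcn, hcn'⟩)
    have hctle : ∀ a, ct i a ≤ μ + 1 := fun a =>
      (Finset.card_le_card (Finset.filter_subset _ _)).trans ((hFc a).trans_le (min_le_right _ _))
    have hq : ∑ a ∈ big, ct i a ≤ N₁.card + (μ + 1) * N₂.card := by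
      rw [hN1, hN2, Finset.card_filter, Finset.card_filter, Finset.mul_sum, ← Finset.sum_add_distrib]
      refine Finset.sum_le_sum fun a _ => ?_
      have := hctle a
      by_cases h2 : 2 ≤ ct i a
      · rw [if_pos h2]; omega
      · rw [if_neg h2]
        split_ifs <;> omega
    have h0 : μ = 0 → N₂.card = 0 := by
      intro h
      rw [Finset.card_eq_zero, hN2, Finset.filter_eq_empty_iff]
      intro a _
      have := hctle a
      omega
    have hs : (-1 : ℤ) ≤ (k : ℤ) - (V i).card := by have := hle i; omega
    have := absorb_arith (s := (k : ℤ) - (V i).card) hs (by push_cast; exact h1) h0 hq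
    refine this.trans_eq ?_
    congr 1
    have : ((k : ℤ) - (V i).card = -1) ↔ i ∈ big := by
      simp only [hbig, Finset.mem_filter, Finset.mem_univ, true_and]
      omega
    simp only [this]
  -- total number of assigned edges
  have hD : ∑ i, ∑ a ∈ big, ct i a = ∑ a ∈ big, (F a).card := by
    rw [Finset.sum_comm]
    refine Finset.sum_congr rfl fun a _ => ?_
    exact (Finset.card_eq_sum_card_fiberwise (f := φ a) (t := Finset.univ)
      (fun _ _ => Finset.mem_coe.2 (Finset.mem_univ _))).symm
  have hup : ((∑ a ∈ big, (F a).card : ℕ) : ℤ) ≤ r - j * (μ + 2) + (μ + 1) * big.card := by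
    rw [← hD, Nat.cast_sum]
    refine (Finset.sum_le_sum fun i _ => hcap i).trans (le_of_eq ?_)
    have e : (∑ i, ((V i).card : ℤ)) = k * r + j := by exact_mod_cast hsum
    rw [Finset.sum_add_distrib, Finset.sum_add_distrib, ← Finset.sum_mul, Finset.sum_sub_distrib,
      Finset.sum_ite_mem, e]
    simp
    ring
  set ex := big.filter fun a => edgesIn G (V a) = μ with hex
  have hlow : (μ + 1) * big.card ≤ ∑ a ∈ big, (F a).card + ex.card := by
    have e : (μ + 1) * big.card = ∑ _a ∈ big, (μ + 1) := by
      rw [Finset.sum_const, smul_eq_mul, mul_comm]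
    rw [e, hex, Finset.card_filter (fun a => edgesIn G (V a) = μ), ← Finset.sum_add_distrib]
    refine Finset.sum_le_sum fun a ha => ?_
    have h1 := hfew _ (Finset.mem_filter.1 ha).2
    rw [hFc]
    split_ifs <;> omega
  have hz : ex.card ≤ numZ n (k + 1) μ G := by
    unfold numZ
    refine Finset.card_le_card_of_injOn V (fun a ha => ?_) fun a ha b hb hab => ?_
    · obtain ⟨h1, h2⟩ := Finset.mem_filter.1 (Finset.mem_coe.1 ha)
      exact Finset.mem_coe.2 (Finset.mem_filter.2 ⟨Finset.mem_powersetCard.2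
        ⟨Finset.subset_univ _, (Finset.mem_filter.1 h1).2⟩, h2⟩)
    · by_contra hne
      have h1 := hV a b hne
      rw [hab, disjoint_self] at h1
      have h2 := (Finset.mem_filter.1 (Finset.mem_filter.1 (Finset.mem_coe.1 hb)).1).2
      rw [h1] at h2
      simp at h2
  unfold xiD
  rw [← hμ]
  have hlow' : ((μ + 1) * big.card : ℤ) ≤ ((∑ a ∈ big, (F a).card : ℕ) : ℤ) + ex.card := by
    exact_mod_cast hlow
  have : (j * (μ + 2) : ℤ) ≤ r + numZ n (k + 1) μ G := by
    have : (ex.card : ℤ) ≤ numZ n (k + 1) μ G := by exact_mod_cast hz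
    linarith
  have : j * (μ + 2) ≤ r + numZ n (k + 1) μ G := by exact_mod_cast this
  omega

theorem edgesIn_mono {n : ℕ} (G : SimpleGraph (Fin n)) {A B : Finset (Fin n)} (h : A ⊆ B) :
    edgesIn G A ≤ edgesIn G B := by
  rw [edgesIn_eq, edgesIn_eq]
  refine Finset.card_le_card fun e he => ?_
  obtain ⟨h1, h2⟩ := Finset.mem_filter.1 he
  refine Finset.mem_filter.2 ⟨?_, h2⟩
  induction e with
  | _ a b =>
    obtain ⟨h3, h4, h5⟩ := mk_mem_prs.1 h1
    exact mk_mem_prs.2 ⟨h3, h h4, h h5⟩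

/-- Some large `K_{r+1}`-free set is not close to being `r`-partite. -/
def badStab (n k r j : ℕ) (l : ℝ) : Set (SimpleGraph (Fin n)) :=
  {G | ∃ S : Finset (Fin n), S.card = k * r + j ∧ G.CliqueFreeOn ↑S (r + 1) ∧
      ∀ c : Fin n → Fin r, tP (k * r + j) l ≤ ∑ i, edgesIn G (S.filter (c · = i))}

/-- Some nearly `r`-partite set has an undersized part. -/
def badSize (n k r j : ℕ) (l : ℝ) : Set (SimpleGraph (Fin n)) :=
  {G | ∃ V : Fin r → Finset (Fin n), PDj V ∧ ∑ i, (V i).card = k * r + j ∧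
    (∃ i, ((V i).card : ℝ) < 0.99 * k) ∧ G ∈ {G | inn G V ≤ tP (k * r + j) l}}

/-- Some nearly `r`-partite set contains a `K_s`-free set spread over `s` parts. -/
def badFree (n k r j : ℕ) (l : ℝ) (s : ℕ) : Set (SimpleGraph (Fin n)) :=
  {G | ∃ V : Fin r → Finset (Fin n), PDj V ∧ ∑ i, (V i).card = k * r + j ∧ True ∧
    G ∈ {G | inn G V ≤ tP (k * r + j) l ∧ ∃ Y ⊆ Finset.univ.biUnion V, Y.card = s * yP k l ∧
      (∀ i, (Y ∩ V i).card ≤ yP k l) ∧ G.CliqueFreeOn ↑Y s}}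

/-- Some nearly `r`-partite set has many disjoint inner pairs with few common neighbours. -/
def badMatch (n k r j : ℕ) (l : ℝ) (q : ℕ) : Set (SimpleGraph (Fin n)) :=
  {G | ∃ V : Fin r → Finset (Fin n), PDj V ∧ ∑ i, (V i).card = k * r + j ∧
    (∀ i, 0.99 * (k : ℝ) ≤ (V i).card) ∧
      G ∈ {G | inn G V ≤ 2 * q * yP k l ∧ ∃ d, MatchData V G (yP k l) q d}}

/-- Some part of size `w` absorbs bad pairs from `p₁ + p₂` parts of size `k + 1`. -/
def badAbsorb (n k r : ℕ) (l : ℝ) (p₁ p₂ w : ℕ) : Set (SimpleGraph (Fin n)) :=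
  {G | ∃ V : Option (Fin p₁ ⊕ Fin p₂) → Finset (Fin n), PDj V ∧
      (∀ i, (V i).card = i.elim w fun _ => k + 1) ∧
      G ∈ {G | inn G V ≤ 4 * r * yP k l ∧ (∀ a, G ∈ evOne (V (some (.inl a))) (V none) (yP k l)) ∧
        ∀ a, G ∈ evTwo (V (some (.inr a))) (V none) (yP k l)}}

theorem inn_comp_le {n : ℕ} {ι κ : Type*} [Fintype ι] [Fintype κ] (G : SimpleGraph (Fin n))
    (V : κ → Finset (Fin n)) {g : ι → κ} (hg : Function.Injective g) :
    inn G (fun i => V (g i)) ≤ inn G V := by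
  unfold inn
  rw [← Finset.sum_image (f := fun b => edgesIn G (V b)) (fun a _ b _ h => hg h)]
  exact Finset.sum_le_sum_of_subset (Finset.subset_univ _)

theorem lt_of_not_badAbsorb {n k r : ℕ} {l : ℝ} {G : SimpleGraph (Fin n)}
    (h : ∀ p₁ p₂ w, p₁ + p₂ ≤ r → w ≤ k + 2 → 1.1 + ((k : ℝ) - w) ≤ 0.8 * p₁ + 1.3 * p₂ →
      G ∉ badAbsorb n k r l p₁ p₂ w)
    {V : Fin r → Finset (Fin n)} (hV : PDj V) (hinn : inn G V ≤ 4 * r * yP k l)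
    (i : Fin r) (hi : (V i).card ≤ k + 1) (N₁ N₂ : Finset (Fin r)) (hd : Disjoint N₁ N₂)
    (h1 : i ∉ N₁) (h2 : i ∉ N₂)
    (hN1 : ∀ a ∈ N₁, (V a).card = k + 1 ∧ G ∈ evOne (V a) (V i) (yP k l))
    (hN2 : ∀ a ∈ N₂, (V a).card = k + 1 ∧ G ∈ evTwo (V a) (V i) (yP k l)) :
    0.8 * (N₁.card : ℝ) + 1.3 * N₂.card < 1.1 + ((k : ℝ) - (V i).card) := by
  by_contra hcon
  push Not at hcon
  refine h N₁.card N₂.card (V i).card ?_ (by omega) hcon ?_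
  · rw [← Finset.card_union_of_disjoint hd]
    exact (Finset.card_le_univ _).trans (by simp)
  · set g : Option (Fin N₁.card ⊕ Fin N₂.card) → Fin r := fun o => o.elim i
      (Sum.elim (fun a => (N₁.equivFin.symm a : Fin r)) (fun a => (N₂.equivFin.symm a : Fin r)))
      with hg
    have m1 : ∀ a, g (some (.inl a)) ∈ N₁ := fun a => (N₁.equivFin.symm a).2
    have m2 : ∀ a, g (some (.inr a)) ∈ N₂ := fun a => (N₂.equivFin.symm a).2
    have h1' : g none ∉ N₁ := h1
    have h2' : g none ∉ N₂ := h2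
    have hinj : Function.Injective g := by
      rintro (_ | a | a) (_ | b | b) hab
      · rfl
      · exact absurd (hab ▸ m1 b) h1'
      · exact absurd (hab ▸ m2 b) h2'
      · exact absurd (hab ▸ m1 a) h1'
      · rw [N₁.equivFin.symm.injective (Subtype.ext hab)]
      · exact absurd (m2 b) (Finset.disjoint_left.1 hd (hab ▸ m1 a))
      · exact absurd (hab ▸ m2 a) h2'
      · exact absurd (m2 a) (Finset.disjoint_left.1 hd (hab ▸ m1 b))
      · rw [N₂.equivFin.symm.injective (Subtype.ext hab)]
    refine ⟨fun o => V (g o), fun o o' hne => hV _ _ fun h => hne (hinj h), ?_,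
      (inn_comp_le G V hinj).trans hinn, fun a => (hN1 _ (m1 a)).2, fun a => (hN2 _ (m2 a)).2⟩
    rintro (_ | a | a)
    · rfl
    · exact (hN1 _ (m1 a)).1
    · exact (hN2 _ (m2 a)).1

theorem card_le_of_not_badAbsorb {n k r : ℕ} {l : ℝ} {G : SimpleGraph (Fin n)}
    (h : G ∉ badAbsorb n k r l 0 0 (k + 2)) {A : Finset (Fin n)}
    (hA : edgesIn G A ≤ 4 * r * yP k l) : A.card ≤ k + 1 := by
  by_contra hcon
  obtain ⟨W, hWA, hW⟩ := Finset.exists_subset_card_eq (show k + 2 ≤ A.card by omega)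
  refine h ⟨fun _ => W, ?_, ?_, ?_, fun a => a.elim0, fun a => a.elim0⟩
  · rintro (_ | a | a) (_ | b | b) hne
    · exact absurd rfl hne
    all_goals first | exact a.elim0 | exact b.elim0
  · rintro (_ | a | a)
    · exact hW
    · exact a.elim0
    · exact a.elim0
  · refine le_trans (le_of_eq ?_) ((edgesIn_mono G hWA).trans hA)
    simp [inn]

theorem exists_matchData {n r y q : ℕ} {G : SimpleGraph (Fin n)} {V : Fin r → Finset (Fin n)}
    (hphi : ∀ a, ∀ e ∈ tr G (prs (V a)), ∃ b, b ≠ a ∧ ∃ u v, e = s(u, v) ∧ cn G u v (V b) ≤ y)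
    {M : Finset (Sym2 (Fin n))} (hM : M ⊆ tr G (prsU V)) (hq : M.card = q)
    (hd : ∀ e ∈ M, ∀ e' ∈ M, e ≠ e' → ∀ u, u ∈ e → u ∉ e') :
    ∃ d, MatchData V G y q d := by
  have key : ∀ e : M, ∃ d : (Fin n × Fin n) × (Fin r × Fin r), (e : Sym2 (Fin n)) = s(d.1.1, d.1.2) ∧
      d.1.1 ≠ d.1.2 ∧ d.2.1 ≠ d.2.2 ∧ d.1.1 ∈ V d.2.1 ∧ d.1.2 ∈ V d.2.1 ∧
        cn G d.1.1 d.1.2 (V d.2.2) ≤ y := by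
    rintro ⟨e, he⟩
    obtain ⟨h1, h2⟩ := Finset.mem_filter.1 (hM he)
    obtain ⟨a, _, ha⟩ := Finset.mem_biUnion.1 h1
    obtain ⟨b, hb, u, v, rfl, hcn⟩ := hphi a e (Finset.mem_filter.2 ⟨ha, h2⟩)
    obtain ⟨h3, h4, h5⟩ := mk_mem_prs.1 ha
    exact ⟨((u, v), (a, b)), rfl, h3, hb.symm, h4, h5, hcn⟩
  choose d hd1 hd2 using key
  set f := M.equivFinOfCardEq hq with hf
  refine ⟨fun i => d (f.symm i), fun i => hd2 _, fun i i' hne => ?_⟩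
  have h1 : ((f.symm i : M) : Sym2 (Fin n)) ≠ f.symm i' := fun h =>
    hne (f.symm.injective (Subtype.ext h))
  have h2 := hd _ (f.symm i).2 _ (f.symm i').2 h1
  rw [hd1, hd1] at h2
  rw [Finset.disjoint_left]
  intro u hu hu'
  simp only [Finset.mem_insert, Finset.mem_singleton] at hu hu'
  exact h2 u (Sym2.mem_iff.2 hu) (Sym2.mem_iff.2 hu')

theorem Reg.deterministic {n k r j : ℕ} {l x : ℝ} (R : Reg n k r j l x) (hr2 : 2 ≤ r)
    {G : SimpleGraph (Fin n)} (hal : k * r + j ≤ alphaClq n (r + 1) G)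
    (hfew : ∀ A : Finset (Fin n), A.card = k + 1 → muD r j ≤ edgesIn G A)
    (hstab : G ∉ badStab n k r j l) (hsize : G ∉ badSize n k r j l)
    (hfree1 : G ∉ badFree n k r j l r) (hfree2 : G ∉ badFree n k r j l (r - 1))
    (hmatch : ∀ q : ℕ, 2 * r ≤ q → (q : ℝ) ≤ k / 100 + 1 → G ∉ badMatch n k r j l q)
    (habs : ∀ p₁ p₂ w, p₁ + p₂ ≤ r → w ≤ k + 2 → 1.1 + ((k : ℝ) - w) ≤ 0.8 * p₁ + 1.3 * p₂ →
      G ∉ badAbsorb n k r l p₁ p₂ w) :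
    xiD r j ≤ numZ n (k + 1) (muD r j) G := by
  obtain ⟨S, hS, hSf⟩ := exists_of_le_alphaClq hal
  obtain ⟨c, hc, hdeg⟩ := exists_min_colouring (by omega : 1 ≤ r) G S
  have hx := R.x_pos
  have hl := R.l_pos
  set y := yP k l with hy
  have hy1 : 1 ≤ y := by
    have h1 := R.y_lb
    have : (0 : ℝ) < y := lt_of_lt_of_le (by positivity) h1
    exact_mod_cast this
  set V : Fin r → Finset (Fin n) := fun i => S.filter (c · = i) with hVdef
  have hmem : ∀ {u i}, u ∈ V i ↔ u ∈ S ∧ c u = i := by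
    intro u i; simp [hVdef]
  have hV : PDj V := by
    intro i i' hne
    rw [Finset.disjoint_left]
    intro u hu hu'
    exact hne ((hmem.1 hu).2.symm.trans (hmem.1 hu').2)
  have hsum : ∑ i, (V i).card = k * r + j := by
    rw [← hS]
    exact (Finset.card_eq_sum_card_fiberwise (f := c) (t := Finset.univ)
      (fun _ _ => Finset.mem_coe.2 (Finset.mem_univ _))).symm
  have hinnt : inn G V ≤ tP (k * r + j) l := by
    by_contra hcon
    push Not at hcon
    exact hstab ⟨S, hS, hSf, fun c' => hcon.le.trans (hc c')⟩
  have hVk : ∀ i, 0.99 * (k : ℝ) ≤ (V i).card := by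
    by_contra hcon
    push Not at hcon
    exact hsize ⟨V, hV, hsum, hcon, hinnt⟩
  have hVsub : ∀ T : Finset (Fin r), T.biUnion V ⊆ Finset.univ.biUnion V := fun T =>
    Finset.biUnion_subset_biUnion_of_subset_left _ (Finset.subset_univ _)
  have hinner : ∀ u ∈ S, ((V (c u)).filter (G.Adj u)).card ≤ y := by
    intro u hu
    by_contra hcon
    push Not at hcon
    obtain ⟨Y, hY1, hY2, hY3⟩ := exists_transversal (y := y) hV Finset.univ
      (fun i => (V i).filter (G.Adj u)) (fun i _ => Finset.filter_subset _ _)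
      (fun i _ => hcon.le.trans (hdeg u hu i))
    refine hfree1 ⟨V, hV, hsum, trivial, hinnt, Y, hY1.trans (Finset.biUnion_mono fun i _ =>
      Finset.filter_subset _ _), by simpa using hY2, hY3, ?_⟩
    refine SimpleGraph.CliqueFreeOn.subset G ?_ (cliqueFreeOn_nbr hSf (Finset.mem_coe.2 hu))
    intro z hz
    obtain ⟨i, _, hi⟩ := Finset.mem_biUnion.1 (hY1 hz)
    obtain ⟨h1, h2⟩ := Finset.mem_filter.1 hi
    exact ⟨(hmem.1 h1).1, h2⟩
  have hphi : ∀ a, ∀ e ∈ tr G (prs (V a)),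
      ∃ b, b ≠ a ∧ ∃ u v, e = s(u, v) ∧ cn G u v (V b) ≤ y := by
    intro a e he
    obtain ⟨he1, he2⟩ := Finset.mem_filter.1 he
    induction e with
    | _ u v =>
    obtain ⟨huv, hu, hv⟩ := mk_mem_prs.1 he1
    rw [SimpleGraph.mem_edgeSet] at he2
    by_contra hcon
    push Not at hcon
    obtain ⟨Y, hY1, hY2, hY3⟩ := exists_transversal (y := y) hV (Finset.univ.erase a)
      (fun i => (V i).filter (fun z => G.Adj u z ∧ G.Adj v z)) (fun i _ => Finset.filter_subset _ _)
      (fun i hi => (hcon i (Finset.ne_of_mem_erase hi) u v rfl).le)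
    rw [Finset.card_erase_of_mem (Finset.mem_univ a), Finset.card_univ, Fintype.card_fin] at hY2
    refine hfree2 ⟨V, hV, hsum, trivial, hinnt, Y, (hY1.trans (Finset.biUnion_mono fun i _ =>
      Finset.filter_subset _ _)).trans (hVsub _), hY2, hY3, ?_⟩
    have hf1 := cliqueFreeOn_nbr hSf (Finset.mem_coe.2 (hmem.1 hu).1)
    rw [show r = r - 1 + 1 by omega] at hf1
    have hf2 := cliqueFreeOn_nbr hf1 (u := v) ⟨Finset.mem_coe.2 (hmem.1 hv).1, he2⟩
    refine SimpleGraph.CliqueFreeOn.subset G ?_ hf2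
    intro z hz
    obtain ⟨i, _, hi⟩ := Finset.mem_biUnion.1 (hY1 hz)
    obtain ⟨h1, h2, h3⟩ := Finset.mem_filter.1 hi
    exact ⟨⟨(hmem.1 h1).1, h2⟩, h3⟩
  have hEdeg : ∀ u, ((tr G (prsU V)).filter (u ∈ ·)).card ≤ y := by
    intro u
    have hsub : ∀ e ∈ (tr G (prsU V)).filter (u ∈ ·), u ∈ S ∧
        e ∈ ((V (c u)).filter (G.Adj u)).image (fun v => s(u, v)) := by
      intro e he
      obtain ⟨h1, h2⟩ := Finset.mem_filter.1 he
      obtain ⟨v, rfl⟩ := h2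
      obtain ⟨h3, h4⟩ := Finset.mem_filter.1 h1
      obtain ⟨i, _, hi⟩ := Finset.mem_biUnion.1 h3
      obtain ⟨h5, h6, h7⟩ := mk_mem_prs.1 hi
      obtain ⟨h8, h9⟩ := hmem.1 h6
      refine ⟨h8, Finset.mem_image.2 ⟨v, Finset.mem_filter.2 ⟨h9 ▸ h7, h4⟩, rfl⟩⟩
    by_cases hu : u ∈ S
    · exact (Finset.card_le_card fun e he => (hsub e he).2).trans
        (Finset.card_image_le.trans (hinner u hu))
    · rw [Finset.card_eq_zero.2 (Finset.eq_empty_iff_forall_notMem.2 fun e he => hu (hsub e he).1)]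
      exact Nat.zero_le _
  have hinn : inn G V ≤ 4 * r * y := by
    by_contra hcon
    push Not at hcon
    set q₁ := ⌈(k : ℝ) / 100⌉₊ with hq1
    have hk := R.k_lb
    have hq1r : 2 * r ≤ q₁ := by
      have h1 := Nat.le_ceil ((k : ℝ) / 100)
      have h2 := R.hrl
      have h3 := R.pow_le (p := 1) (by norm_num)
      rw [pow_one] at h3
      have : (2 * r : ℝ) ≤ q₁ := by rw [hq1]; linarith
      exact_mod_cast this
    have ht : tP (k * r + j) l ≤ 2 * q₁ * y := by
      have h1 := Nat.le_ceil ((k : ℝ) / 100)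
      have h2 := R.y_lb
      have h3 := R.t_ub
      have h4 : (0.02 : ℝ) * x ≤ q₁ := by rw [hq1]; linarith
      have h5 : 10 * (x ^ 2 / l ^ 13) ≤ 0.1 * (x ^ 2 / l ^ 5) := by
        rw [mul_div_assoc', mul_div_assoc', div_le_div_iff₀ (by positivity) (by positivity)]
        have h8 : (100 : ℝ) ≤ l ^ 8 := by
          have := pow_le_pow_left₀ (by norm_num) R.hL 8
          norm_num at this
          linarith
        have : 0 ≤ x ^ 2 * l ^ 5 := by positivity
        calc 10 * x ^ 2 * l ^ 5 = 0.1 * (x ^ 2 * l ^ 5 * 100) := by ring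
          _ ≤ 0.1 * (x ^ 2 * l ^ 5 * l ^ 8) := by gcongr
          _ = _ := by ring
      have h6 : (0.02 * x) * (2.885 * (x / l ^ 5)) ≤ (q₁ : ℝ) * y :=
        mul_le_mul h4 h2 (by positivity) (by positivity)
      have h7 : (0.02 * x) * (2.885 * (x / l ^ 5)) = 0.0577 * (x ^ 2 / l ^ 5) := by ring
      have h8 : 0 ≤ x ^ 2 / l ^ 5 := by positivity
      have : ((tP (k * r + j) l : ℕ) : ℝ) ≤ ((2 * q₁ * y : ℕ) : ℝ) := by
        push_cast
        linarith
      exact_mod_cast this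
    set I := inn G V with hI
    set q := min q₁ ((I - 1) / (2 * y) + 1) with hq
    have hdm := Nat.div_add_mod (I - 1) (2 * y)
    have hml := Nat.mod_lt (I - 1) (show 0 < 2 * y by omega)
    have hqr : 2 * r ≤ q := by
      refine le_min hq1r (Nat.le_succ_of_le ?_)
      rw [Nat.le_div_iff_mul_le (by omega)]
      have : 2 * r * (2 * y) = 4 * r * y := by ring
      omega
    have hI1 : 2 * y * (q - 1) < I := by
      have : q - 1 ≤ (I - 1) / (2 * y) := by omega
      have := Nat.mul_le_mul_left (2 * y) this
      omega
    have hI2 : I ≤ 2 * q * y := by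
      rcases min_cases q₁ ((I - 1) / (2 * y) + 1) with ⟨h, _⟩ | ⟨h, _⟩
      · rw [hq, h]; exact hinnt.trans ht
      · rw [hq, h]
        have : 2 * ((I - 1) / (2 * y) + 1) * y = 2 * y * ((I - 1) / (2 * y)) + 2 * y := by ring
        omega
    obtain ⟨M, hM1, hM2, hM3⟩ := exists_matching (y := y) q (tr G (prsU V)) hEdeg
      (Or.inl (by rw [card_tr_prsU hV]; exact hI1))
    refine hmatch q hqr ?_ ⟨V, hV, hsum, hVk, hI2, exists_matchData hphi hM1 hM2 hM3⟩
    have h1 : (q : ℝ) ≤ q₁ := by exact_mod_cast min_le_left _ _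
    have h2 := Nat.ceil_lt_add_one (a := (k : ℝ) / 100) (by positivity)
    linarith
  have hle : ∀ i, (V i).card ≤ k + 1 := fun i =>
    card_le_of_not_badAbsorb (habs 0 0 (k + 2) (by omega) le_rfl (by push_cast; norm_num))
      ((Finset.single_le_sum (f := fun i => edgesIn G (V i)) (fun _ _ => Nat.zero_le _)
        (Finset.mem_univ i)).trans hinn)
  exact count_main hV hsum hle hfew hphi fun i N₁ N₂ =>
    lt_of_not_badAbsorb habs hV hinn i (hle i) N₁ N₂

theorem deterministic_one {n k : ℕ} {G : SimpleGraph (Fin n)} (hal : k * 1 + 1 ≤ alphaClq n (1 + 1) G) :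
    xiD 1 1 ≤ numZ n (k + 1) (muD 1 1) G := by
  obtain ⟨S, hS, hSf⟩ := exists_of_le_alphaClq hal
  rw [show xiD 1 1 = 1 from rfl, show muD 1 1 = 0 from rfl]
  refine Finset.card_pos.2 ⟨S, Finset.mem_filter.2 ⟨Finset.mem_powersetCard.2
    ⟨Finset.subset_univ _, by omega⟩, ?_⟩⟩
  rw [edgesIn_eq, Finset.card_eq_zero, Finset.eq_empty_iff_forall_notMem]
  intro e he
  obtain ⟨h1, h2⟩ := Finset.mem_filter.1 he
  induction e with
  | _ a b =>
    obtain ⟨h3, h4, h5⟩ := mk_mem_prs.1 h1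
    refine ((SimpleGraph.cliqueFreeOn_two G).1 hSf) (Finset.mem_coe.2 h4) (Finset.mem_coe.2 h5) h3 h2

namespace Reg

variable {n k r j : ℕ} {l x : ℝ}

theorem exp_twentieth (R : Reg n k r j l x) : Real.exp (-(x / 20)) ≤ 1 / x ^ 9 := by
  have h1 := R.pow_le (p := 1) (by norm_num)
  have hl := R.l_pos
  have h2 : x ^ 9 = Real.exp (9 * l) := by
    rw [R.hx, ← Real.exp_nat_mul]; norm_num
  rw [Real.exp_neg, one_div, h2, ← Real.exp_neg, ← Real.exp_neg, Real.exp_le_exp]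
  rw [pow_one] at h1
  linarith

theorem bad_matches (R : Reg n k r j l x) (h : fv n (k + 1) ≤ Real.exp l) :
    grPr n {G | ∃ q : ℕ, 2 * r ≤ q ∧ (q : ℝ) ≤ k / 100 + 1 ∧ G ∈ badMatch n k r j l q} ≤
      (k + 2) * Real.exp (-(x / 20)) := by
  refine (grPr_iUnion_le ((Finset.range (k + 2)).filter fun q => 2 * r ≤ q ∧ (q : ℝ) ≤ k / 100 + 1)
    (fun q => badMatch n k r j l q) _ ?_).trans ?_
  · rintro G ⟨q, h1, h2, h3⟩
    refine ⟨q, Finset.mem_filter.2 ⟨Finset.mem_range.2 ?_, h1, h2⟩, h3⟩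
    have : (q : ℝ) < (k + 2 : ℕ) := by
      push_cast
      have : (0 : ℝ) ≤ k := Nat.cast_nonneg _
      linarith
    exact_mod_cast this
  · refine (Finset.sum_le_sum fun q hq => R.bad_match h (Finset.mem_filter.1 hq).2.1
      (Finset.mem_filter.1 hq).2.2).trans ?_
    rw [Finset.sum_const, nsmul_eq_mul]
    refine mul_le_mul_of_nonneg_right ?_ (Real.exp_pos _).le
    have := (Finset.card_filter_le (Finset.range (k + 2))
      fun q => 2 * r ≤ q ∧ (q : ℝ) ≤ k / 100 + 1)
    rw [Finset.card_range] at this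
    exact_mod_cast this

theorem bad_absorbs (R : Reg n k r j l x) (h : fv n (k + 1) ≤ Real.exp l) :
    grPr n {G | ∃ p₁ p₂ w : ℕ, p₁ + p₂ ≤ r ∧ w ≤ k + 2 ∧
      1.1 + ((k : ℝ) - w) ≤ 0.8 * p₁ + 1.3 * p₂ ∧ G ∈ badAbsorb n k r l p₁ p₂ w} ≤
      ((r + 1) * ((r + 1) * (k + 3))) * Real.exp (-(x / 20)) := by
  set T := (Finset.range (r + 1) ×ˢ (Finset.range (r + 1) ×ˢ Finset.range (k + 3))) with hT
  set s := T.filter fun p : ℕ × ℕ × ℕ => p.1 + p.2.1 ≤ r ∧ p.2.2 ≤ k + 2 ∧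
      1.1 + ((k : ℝ) - p.2.2) ≤ 0.8 * p.1 + 1.3 * p.2.1 with hs
  refine (grPr_iUnion_le s (fun p => badAbsorb n k r l p.1 p.2.1 p.2.2) _ ?_).trans ?_
  · rintro G ⟨p₁, p₂, w, h1, h2, h3, h4⟩
    refine ⟨(p₁, p₂, w), Finset.mem_filter.2 ⟨?_, h1, h2, h3⟩, h4⟩
    simp only [hT, Finset.mem_product, Finset.mem_range]
    omega
  · refine (Finset.sum_le_sum fun p hp => R.bad_absorb h (Finset.mem_filter.1 hp).2.1
      (Finset.mem_filter.1 hp).2.2.1 (Finset.mem_filter.1 hp).2.2.2).trans ?_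
    rw [Finset.sum_const, nsmul_eq_mul]
    refine mul_le_mul_of_nonneg_right ?_ (Real.exp_pos _).le
    have : s.card ≤ T.card := Finset.card_le_card (Finset.filter_subset _ _)
    rw [hT, Finset.card_product, Finset.card_product, Finset.card_range, Finset.card_range] at this
    exact_mod_cast this

theorem two_div_le_inv_sqrt (R : Reg n k r j l x) : 2 / x ≤ 1 / √x := by
  have hx := R.x_pos
  have h1 : (2 : ℝ) ≤ √x := Real.le_sqrt_of_sq_le (by have := R.x_big; linarith)
  rw [div_le_div_iff₀ hx (by positivity)]
  nlinarith [Real.mul_self_sqrt hx.le]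

theorem main (R : Reg n k r j l x) :
    grPr n {G | k * r + j ≤ alphaClq n (r + 1) G} ≤
      grPr n {G | xiD r j ≤ numZ n (k + 1) (muD r j) G} + 1 / √x := by
  have hx := R.x_pos
  have hsq : 0 ≤ 1 / √x := by positivity
  by_cases hr1 : r = 1
  · obtain rfl : j = 1 := le_antisymm (hr1 ▸ R.hjr) R.hj
    subst hr1
    exact (grPr_mono fun G hG => deterministic_one hG).trans (le_add_of_nonneg_right hsq)
  have hr2 : 2 ≤ r := by have := R.hr; omega
  by_cases hE : 5 * √x ≤ n.choose (k + 1) *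
      (((k + 1).choose 2).choose (muD r j) * (1 / 2 : ℝ) ^ ((k + 1).choose 2))
  · exact (grPr_le_one _ _).trans (R.caseA hE)
  push Not at hE
  have h := R.fv_of_small hE
  set few : Set (SimpleGraph (Fin n)) :=
    {G | ∃ A : Finset (Fin n), A.card = k + 1 ∧ edgesIn G A < muD r j} with hfew
  set mat : Set (SimpleGraph (Fin n)) :=
    {G | ∃ q : ℕ, 2 * r ≤ q ∧ (q : ℝ) ≤ k / 100 + 1 ∧ G ∈ badMatch n k r j l q} with hmat
  set abs : Set (SimpleGraph (Fin n)) := {G | ∃ p₁ p₂ w : ℕ, p₁ + p₂ ≤ r ∧ w ≤ k + 2 ∧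
      1.1 + ((k : ℝ) - w) ≤ 0.8 * p₁ + 1.3 * p₂ ∧ G ∈ badAbsorb n k r l p₁ p₂ w} with habs
  have hsub : {G : SimpleGraph (Fin n) | k * r + j ≤ alphaClq n (r + 1) G} ⊆
      {G | xiD r j ≤ numZ n (k + 1) (muD r j) G} ∪ (few ∪ (badStab n k r j l ∪
        (badSize n k r j l ∪ (badFree n k r j l r ∪ (badFree n k r j l (r - 1) ∪
          (mat ∪ abs)))))) := by
    intro G hG
    by_contra hcon
    simp only [Set.mem_union, not_or] at hcon
    obtain ⟨h0, h1, h2, h3, h4, h5, h6, h7⟩ := hcon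
    refine h0 (R.deterministic hr2 hG ?_ h2 h3 h4 h5 ?_ ?_)
    · intro A hA
      by_contra hlt
      exact h1 ⟨A, hA, not_le.1 hlt⟩
    · exact fun q hq1 hq2 hq3 => h6 ⟨q, hq1, hq2, hq3⟩
    · exact fun p₁ p₂ w ha hb hc hd => h7 ⟨p₁, p₂, w, ha, hb, hc, hd⟩
  have b1 : grPr n few ≤ 1 / x := R.bad_few hE
  have b2 : grPr n (badStab n k r j l) ≤ _ := R.bad_stab hr2
  have b3 : grPr n (badSize n k r j l) ≤ _ := R.bad_size h
  have b4 : grPr n (badFree n k r j l r) ≤ _ := R.bad_free h (by omega) le_rfl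
  have b5 : grPr n (badFree n k r j l (r - 1)) ≤ _ := R.bad_free h (by omega) (by omega)
  have b6 : grPr n mat ≤ _ := R.bad_matches h
  have b7 : grPr n abs ≤ _ := R.bad_absorbs h
  have u1 := (grPr_mono hsub).trans (grPr_union_le _ _)
  have u2 := grPr_union_le few (badStab n k r j l ∪ (badSize n k r j l ∪ (badFree n k r j l r ∪
    (badFree n k r j l (r - 1) ∪ (mat ∪ abs)))))
  have u3 := grPr_union_le (badStab n k r j l) (badSize n k r j l ∪ (badFree n k r j l r ∪
    (badFree n k r j l (r - 1) ∪ (mat ∪ abs))))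
  have u4 := grPr_union_le (badSize n k r j l) (badFree n k r j l r ∪
    (badFree n k r j l (r - 1) ∪ (mat ∪ abs)))
  have u5 := grPr_union_le (badFree n k r j l r) (badFree n k r j l (r - 1) ∪ (mat ∪ abs))
  have u6 := grPr_union_le (badFree n k r j l (r - 1)) (mat ∪ abs)
  have u7 := grPr_union_le mat abs
  have hcount : (4 + (k + 2) + (r + 1) * ((r + 1) * (k + 3)) : ℝ) ≤ x ^ 3 := by
    have c1 := R.k_ub
    have c2 := R.x_big
    have c3 : (r : ℝ) + 1 ≤ x := by
      have d1 := R.hrl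
      have d2 := R.pow_le (p := 1) (by norm_num)
      have d3 := R.l_pos
      rw [pow_one] at d2
      linarith
    have c4 : ((r : ℝ) + 1) * (r + 1) ≤ x / 10 := by
      have d1 := R.hrl
      have d2 := R.pow_le (p := 2) (by norm_num)
      have d3 := R.hL
      have d4 : ((r : ℝ) + 1) * (r + 1) ≤ (2 * l) * (2 * l) :=
        mul_le_mul (by linarith) (by linarith) (by positivity) (by linarith)
      have d5 : 0 ≤ l ^ 2 := by positivity
      have d6 : (2 * l) * (2 * l) = 4 * l ^ 2 := by ring
      linarith
    have c5 : ((r : ℝ) + 1) * ((r + 1) * (k + 3)) ≤ x / 10 * (3 * x) := by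
      rw [← mul_assoc]
      exact mul_le_mul c4 (by linarith) (by positivity) (by positivity)
    have c6 : x * x ≤ x ^ 3 := by
      have : x * x * 1 ≤ x * x * x := mul_le_mul_of_nonneg_left (by linarith) (by positivity)
      calc x * x = x * x * 1 := by ring
        _ ≤ _ := this
        _ = _ := by ring
    have c7 : 100 * x ≤ x * x := mul_le_mul_of_nonneg_right (by linarith) hx.le
    have c8 : x / 10 * (3 * x) = 0.3 * (x * x) := by ring
    linarith
  have hfin : (4 + (k + 2) + (r + 1) * ((r + 1) * (k + 3)) : ℝ) * Real.exp (-(x / 20)) ≤ 1 / x := by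
    refine (mul_le_mul hcount R.exp_twentieth (Real.exp_pos _).le (by positivity)).trans ?_
    rw [mul_one_div, div_le_div_iff₀ (by positivity) hx]
    have : x ^ 4 ≤ x ^ 9 := pow_le_pow_right₀ (by have := R.x_big; linarith) (by norm_num)
    calc x ^ 3 * x = x ^ 4 := by ring
      _ ≤ _ := this
      _ = _ := by ring
  have h2x := R.two_div_le_inv_sqrt
  have e2 : 2 / x = 1 / x + 1 / x := by ring
  have : ((4 + (k + 2) + (r + 1) * ((r + 1) * (k + 3)) : ℝ)) * Real.exp (-(x / 20)) =
    4 * Real.exp (-(x / 20)) + (k + 2) * Real.exp (-(x / 20)) +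
      ((r + 1) * ((r + 1) * (k + 3))) * Real.exp (-(x / 20)) := by ring
  linarith

end Reg

theorem reg_of_hyps {C : ℝ} {n k r j : ℕ} (hC : C ≤ Real.log (Real.log n))
    (hL : 1000 ≤ Real.log (Real.log n))
    (hLx : Real.log (Real.log n) ^ 200 ≤ Real.exp (Real.log (Real.log n) / 100))
    (hk : |(k : ℝ) - 2 * Real.logb 2 n| ≤ C * Real.log (Real.log n)) (hr : 1 ≤ r)
    (hrl : (r : ℝ) ≤ 1 / 6000 * Real.log (Real.log n) / Real.log (Real.log (Real.log n)))
    (hj : 1 ≤ j) (hjr : j ≤ r) : Reg n k r j (Real.log (Real.log n)) (Real.log n) := by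
  set x := Real.log n with hx
  set l := Real.log x with hl
  have hx0 : 0 ≤ x := Real.log_natCast_nonneg n
  have hxpos : 0 < x := by
    rcases hx0.lt_or_eq with h | h
    · exact h
    · rw [← h, Real.log_zero] at hl
      linarith
  have hn : (0 : ℝ) < n := by
    rcases Nat.eq_zero_or_pos n with h | h
    · rw [h, Nat.cast_zero, Real.log_zero] at hx
      linarith
    · exact_mod_cast h
  have h2 : 0 < Real.log 2 := Real.log_pos (by norm_num)
  have h2' : Real.log 2 ≤ 1 := by linarith [Real.log_two_lt_d9]
  have hkx : |(k : ℝ) * Real.log 2 - 2 * x| ≤ l ^ 2 := by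
    have e : (k : ℝ) * Real.log 2 - 2 * x = ((k : ℝ) - 2 * Real.logb 2 n) * Real.log 2 := by
      rw [Real.logb, ← hx]; field_simp
    rw [e, abs_mul, abs_of_pos h2]
    calc |(k : ℝ) - 2 * Real.logb 2 n| * Real.log 2 ≤ |(k : ℝ) - 2 * Real.logb 2 n| * 1 :=
          mul_le_mul_of_nonneg_left h2' (abs_nonneg _)
      _ ≤ C * l := by rw [mul_one]; exact hk
      _ ≤ l * l := mul_le_mul_of_nonneg_right hC (by linarith)
      _ = l ^ 2 := by ring
  obtain ⟨hk1, hk2⟩ := abs_le.1 hkx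
  have hll : 1 ≤ Real.log l := by
    rw [Real.le_log_iff_exp_le (by linarith)]
    linarith [Real.exp_one_lt_d9]
  have hrl' : (r : ℝ) * Real.log l ≤ 1 / 6000 * l := (le_div_iff₀ (by linarith)).1 hrl
  have hr0 : (0 : ℝ) ≤ r := Nat.cast_nonneg _
  refine ⟨(Real.exp_log hxpos).symm, (Real.exp_log hn).symm, by linarith, by linarith, hr, ?_, hj,
    hjr, hL, hLx, ?_⟩
  · have : (r : ℝ) * 1 ≤ r * Real.log l := mul_le_mul_of_nonneg_left hll hr0
    linarith
  · have e : l ^ (60 * r) = Real.exp (60 * (r * Real.log l)) := by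
      rw [← mul_assoc, show (60 * (r : ℝ)) = ((60 * r : ℕ) : ℝ) by push_cast; ring,
        Real.exp_nat_mul, Real.exp_log (by linarith)]
    rw [e, Real.exp_le_exp]
    linarith

theorem stmt11 (C : ℝ) (hC : 0 < C) :
    ∃ ε₀ : ℝ, 0 < ε₀ ∧ ∃ N : ℕ, ∀ n : ℕ, N ≤ n → ∀ k r j : ℕ,
      |(k : ℝ) - 2 * Real.logb 2 n| ≤ C * Real.log (Real.log n) →
      1 ≤ r →
      (r : ℝ) ≤ ε₀ * Real.log (Real.log n) / Real.log (Real.log (Real.log n)) →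
      1 ≤ j → j ≤ r →
      grPr n {G | k * r + j ≤ alphaClq n (r + 1) G} ≤
        grPr n {G | xiD r j ≤ numZ n (k + 1) (muD r j) G} +
          (Real.log n) ^ (-(1 / 2 : ℝ)) := by
  have hlim : Filter.Tendsto (fun n : ℕ => Real.log (Real.log n)) Filter.atTop Filter.atTop :=
    Real.tendsto_log_atTop.comp (Real.tendsto_log_atTop.comp tendsto_natCast_atTop_atTop)
  have hexp : ∀ᶠ l : ℝ in Filter.atTop, l ^ 200 ≤ Real.exp (l / 100) := by
    have h := isLittleO_pow_exp_pos_mul_atTop (b := 1 / 100) 200 (by norm_num)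
    filter_upwards [h.bound (c := 1) (by norm_num), Filter.eventually_ge_atTop 0] with l hl hl0
    rw [one_mul, Real.norm_of_nonneg (by positivity), Real.norm_of_nonneg (Real.exp_pos _).le] at hl
    rwa [div_eq_inv_mul, ← one_div]
  obtain ⟨N, hN⟩ := Filter.eventually_atTop.1 (hlim.eventually
    ((Filter.eventually_ge_atTop C).and ((Filter.eventually_ge_atTop 1000).and hexp)))
  refine ⟨1 / 6000, by norm_num, N, fun n hn k r j hk hr hrl hj hjr => ?_⟩
  obtain ⟨h1, h2, h3⟩ := hN n hn
  have R := reg_of_hyps h1 h2 h3 hk hr hrl hj hjr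
  have e : (Real.log n) ^ (-(1 / 2 : ℝ)) = 1 / √(Real.log n) := by
    rw [Real.rpow_neg (Real.log_natCast_nonneg n), ← Real.sqrt_eq_rpow, one_div]
  rw [e]
  exact R.main
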